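/- The Glauber dynamics of the square plaquette model with periodic boundary conditions on the critical length scale L_c=⌊e^{β/2}⌋ exhibits cutoff: for every 0<ε<1/2, the ratio T_mix^per(L_c,ε)/T_mix^per(L_c,1−ε) tends to 1 as β→∞. -/

import Mathlib

open scoped BigOperators

attribute [local instance] Classical.propDecidable

noncomputable section

namespace SPMP

/-- Spin configurations on the `L × L` torus; `true` codes spin `+1`. -/
abbrev ConfigP (L : ℕ) := Fin L × Fin L → Bool

/-- The real spin value of a Boolean spin. -/
def sval (b : Bool) : ℝ := if b then 1 else -1

/-- Cyclic successor on `Fin L`. -/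
def fsucc {L : ℕ} (i : Fin L) : Fin L := ⟨(i.val + 1) % L, Nat.mod_lt _ i.pos⟩

/-- The periodic plaquette variable
`p_x(σ) = σ_{(x₁,x₂)} σ_{(x₁+1,x₂)} σ_{(x₁,x₂+1)} σ_{(x₁+1,x₂+1)}` (coordinates mod `L`). -/
def plaqP (L : ℕ) (σ : ConfigP L) (x : Fin L × Fin L) : ℝ :=
  sval (σ x) * sval (σ (fsucc x.1, x.2)) * sval (σ (x.1, fsucc x.2)) *
    sval (σ (fsucc x.1, fsucc x.2))

/-- The periodic Hamiltonian `H(σ) = -(1/2) ∑_x p_x(σ)`. -/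
def hamP (L : ℕ) (σ : ConfigP L) : ℝ := -(1 / 2) * ∑ x : Fin L × Fin L, plaqP L σ x

/-- The Gibbs measure `π(σ) = e^{-βH(σ)}/Z`. -/
def gibbsP (L : ℕ) (β : ℝ) (σ : ConfigP L) : ℝ :=
  Real.exp (-β * hamP L σ) / ∑ η : ConfigP L, Real.exp (-β * hamP L η)

/-- Flip one spin. -/
def flipP (L : ℕ) (σ : ConfigP L) (x : Fin L × Fin L) : ConfigP L :=
  fun i => if i = x then !(σ i) else σ i

/-- Metropolis rate of the move `σ → η`: `min(1, e^{-β(H(η)-H(σ))})`. -/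
def metroRateP (L : ℕ) (β : ℝ) (σ η : ConfigP L) : ℝ :=
  min 1 (Real.exp (-β * (hamP L η - hamP L σ)))

/-- The Glauber generator of the periodic dynamics, as a matrix. -/
def genP (L : ℕ) (β : ℝ) : Matrix (ConfigP L) (ConfigP L) ℝ :=
  fun σ η =>
    if η = σ then -(∑ x : Fin L × Fin L, metroRateP L β σ (flipP L σ x))
    else ∑ x : Fin L × Fin L, if η = flipP L σ x then metroRateP L β σ (flipP L σ x) else 0

/-- Entrywise matrix exponential `∑ₖ Aᵏ/k!`. -/
def mexp {n : Type*} [Fintype n] [DecidableEq n] (A : Matrix n n ℝ) : Matrix n n ℝ :=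
  fun i j => ∑' k : ℕ, (A ^ k) i j / (Nat.factorial k : ℝ)

/-- Total-variation distance between two (probability) vectors. -/
def tv {n : Type*} [Fintype n] (μ ν : n → ℝ) : ℝ := (∑ s, |μ s - ν s|) / 2

/-- The `ε`-mixing time of the periodic Glauber dynamics. -/
def tmixP (L : ℕ) (β ε : ℝ) : ℝ :=
  sInf {t : ℝ | 0 < t ∧ ∀ σ : ConfigP L, tv (mexp (t • genP L β) σ) (gibbsP L β) < ε}

/-- The set of ground states: minimizers of the Hamiltonian. -/
def GroundP (L : ℕ) : Set (ConfigP L) := {σ | ∀ η : ConfigP L, hamP L σ ≤ hamP L η}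

/-- The critical length scale `L_c = ⌊e^{β/2}⌋`. -/
def Lc (β : ℝ) : ℕ := ⌊Real.exp (β / 2)⌋₊

end SPMP

open SPMP
open scoped Matrix

section Semigroup

variable {Ω : Type*} [Fintype Ω] [DecidableEq Ω]

/-- The semigroup `e^{tA}` acting on functions. -/
def sg (A : Matrix Ω Ω ℝ) (t : ℝ) (f : Ω → ℝ) : Ω → ℝ := NormedSpace.exp (t • A) *ᵥ f

lemma hasSum_exp_apply (A : Matrix Ω Ω ℝ) (i j : Ω) :
    HasSum (fun k : ℕ => (A ^ k) i j / (Nat.factorial k : ℝ)) (NormedSpace.exp A i j) := by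
  letI := Matrix.linftyOpNormedRing (n := Ω) (α := ℝ)
  letI := Matrix.linftyOpNormedAlgebra (n := Ω) (R := ℝ) (α := ℝ)
  have h := NormedSpace.exp_series_hasSum_exp' (𝕂 := ℝ) A
  have h2 : HasSum (fun k : ℕ => ((Nat.factorial k : ℝ)⁻¹ • A ^ k) i j)
    (NormedSpace.exp A i j) := (Pi.hasSum.1 ((Pi.hasSum.1 h) i)) j
  simpa only [Matrix.smul_apply, div_eq_inv_mul, smul_eq_mul] using h2

lemma mexp_eq_exp (A : Matrix Ω Ω ℝ) : mexp A = NormedSpace.exp A := by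
  ext i j
  exact (hasSum_exp_apply A i j).tsum_eq

lemma hasSum_exp_mulVec (A : Matrix Ω Ω ℝ) (f : Ω → ℝ) :
    HasSum (fun k : ℕ => ((Nat.factorial k : ℝ)⁻¹) • (A ^ k *ᵥ f)) (NormedSpace.exp A *ᵥ f) := by
  rw [Pi.hasSum]
  intro i
  have := hasSum_sum (s := Finset.univ) fun j _ => (hasSum_exp_apply A i j).mul_right (f j)
  have e : (fun k : ℕ => (((Nat.factorial k : ℝ)⁻¹) • (A ^ k *ᵥ f)) i)
      = fun k => ∑ j, (A ^ k) i j / (Nat.factorial k : ℝ) * f j := by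
    ext k
    simp only [Pi.smul_apply, Matrix.mulVec, dotProduct, smul_eq_mul, Finset.mul_sum]
    exact Finset.sum_congr rfl fun j _ => by ring
  rw [e]
  exact this

lemma sg_zero (A : Matrix Ω Ω ℝ) (f : Ω → ℝ) : sg A 0 f = f := by
  simp [sg, NormedSpace.exp_zero]

lemma exp_add_smul (A : Matrix Ω Ω ℝ) (s t : ℝ) :
    NormedSpace.exp ((s + t) • A) = NormedSpace.exp (s • A) * NormedSpace.exp (t • A) := by
  rw [add_smul]
  exact Matrix.exp_add_of_commute _ _ (((Commute.refl A).smul_left s).smul_right t)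

lemma sg_add (A : Matrix Ω Ω ℝ) (s t : ℝ) (f : Ω → ℝ) : sg A (s + t) f = sg A s (sg A t f) := by
  simp [sg, exp_add_smul, Matrix.mulVec_mulVec]

lemma hasDerivAt_exp_apply (A : Matrix Ω Ω ℝ) (t : ℝ) (i j : Ω) :
    HasDerivAt (fun u => NormedSpace.exp (u • A) i j) ((A * NormedSpace.exp (t • A)) i j) t := by
  letI := Matrix.linftyOpNormedRing (n := Ω) (α := ℝ)
  letI := Matrix.linftyOpNormedAlgebra (n := Ω) (R := ℝ) (α := ℝ)
  have h := hasDerivAt_exp_smul_const' (𝕂 := ℝ) A t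
  have h1 := (hasDerivAt_pi.1 h) i
  exact (hasDerivAt_pi.1 h1) j

lemma hasDerivAt_sg_apply (A : Matrix Ω Ω ℝ) (t : ℝ) (f : Ω → ℝ) (i : Ω) :
    HasDerivAt (fun u => sg A u f i) ((A *ᵥ sg A t f) i) t := by
  have := HasDerivAt.fun_sum (u := Finset.univ) fun j _ =>
    (hasDerivAt_exp_apply A t i j).mul_const (f j)
  rw [sg, Matrix.mulVec_mulVec]
  exact this

lemma hasDerivAt_sg (A : Matrix Ω Ω ℝ) (t : ℝ) (f : Ω → ℝ) :
    HasDerivAt (fun u => sg A u f) (A *ᵥ sg A t f) t :=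
  hasDerivAt_pi.2 fun i => hasDerivAt_sg_apply A t f i

lemma commute_exp_smul (A : Matrix Ω Ω ℝ) (t : ℝ) : Commute A (NormedSpace.exp (t • A)) := by
  letI := Matrix.linftyOpNormedRing (n := Ω) (α := ℝ)
  letI := Matrix.linftyOpNormedAlgebra (n := Ω) (R := ℝ) (α := ℝ)
  exact ((Commute.refl A).smul_right t).exp_right

lemma sg_comm (A : Matrix Ω Ω ℝ) (t : ℝ) (f : Ω → ℝ) : A *ᵥ sg A t f = sg A t (A *ᵥ f) := by
  simp only [sg, Matrix.mulVec_mulVec, (commute_exp_smul A t).eq]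

lemma sg_linear_add (A : Matrix Ω Ω ℝ) (t : ℝ) (f g : Ω → ℝ) :
    sg A t (f + g) = sg A t f + sg A t g := Matrix.mulVec_add _ _ _

lemma sg_sub (A : Matrix Ω Ω ℝ) (t : ℝ) (f g : Ω → ℝ) :
    sg A t (f - g) = sg A t f - sg A t g := Matrix.mulVec_sub _ _ _

lemma sg_smul (A : Matrix Ω Ω ℝ) (t c : ℝ) (f : Ω → ℝ) :
    sg A t (c • f) = c • sg A t f := Matrix.mulVec_smul _ _ _

lemma sg_sum {ι : Type*} (A : Matrix Ω Ω ℝ) (t : ℝ) (s : Finset ι) (f : ι → Ω → ℝ) :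
    sg A t (∑ i ∈ s, f i) = ∑ i ∈ s, sg A t (f i) := Matrix.mulVec_sum _ _ _

lemma sg_mem (A : Matrix Ω Ω ℝ) (V : Submodule ℝ (Ω → ℝ)) (hV : ∀ f ∈ V, A *ᵥ f ∈ V)
    (t : ℝ) (f : Ω → ℝ) (hf : f ∈ V) : sg A t f ∈ V := by
  have hcl : IsClosed (V : Set (Ω → ℝ)) := V.closed_of_finiteDimensional
  have hp : ∀ k : ℕ, (t • A) ^ k *ᵥ f ∈ V := by
    intro k
    induction k with
    | zero => simpa using hf
    | succ k ih =>
      rw [pow_succ', ← Matrix.mulVec_mulVec, Matrix.smul_mulVec]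
      exact V.smul_mem _ (hV _ ih)
  exact hcl.mem_of_tendsto (hasSum_exp_mulVec (t • A) f)
    (Filter.Eventually.of_forall fun s => V.sum_mem fun k _ => V.smul_mem _ (hp k))

/-- Matrices generating Markov semigroups. -/
structure IsGen (A : Matrix Ω Ω ℝ) : Prop where
  offdiag : ∀ i j, i ≠ j → 0 ≤ A i j
  mulVec_one : A *ᵥ 1 = 0

lemma exp_apply_nonneg_of_nonneg (A : Matrix Ω Ω ℝ) (hA : ∀ i j, 0 ≤ A i j) (i j : Ω) :
    0 ≤ NormedSpace.exp A i j := by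
  refine (hasSum_exp_apply A i j).nonneg fun k => div_nonneg ?_ (by positivity)
  induction k generalizing i j with
  | zero => rw [pow_zero, Matrix.one_apply]; split_ifs <;> norm_num
  | succ k ih =>
    rw [pow_succ, Matrix.mul_apply]
    exact Finset.sum_nonneg fun l _ => mul_nonneg (ih i l) (hA l j)

lemma IsGen.exp_nonneg {A : Matrix Ω Ω ℝ} (hA : IsGen A) {t : ℝ} (ht : 0 ≤ t) (i j : Ω) :
    0 ≤ NormedSpace.exp (t • A) i j := by
  set c : ℝ := ∑ k, |A k k| with hc
  have hcomm : Commute (t • (A + c • (1 : Matrix Ω Ω ℝ))) ((-(t * c)) • (1 : Matrix Ω Ω ℝ)) :=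
    (Commute.one_right _).smul_right _
  have hsplit : t • A = t • (A + c • (1 : Matrix Ω Ω ℝ)) + (-(t * c)) • (1 : Matrix Ω Ω ℝ) := by
    rw [smul_add, smul_smul, add_assoc, ← add_smul]; simp
  have hone : NormedSpace.exp ((-(t * c)) • (1 : Matrix Ω Ω ℝ))
      = (Real.exp (-(t * c))) • (1 : Matrix Ω Ω ℝ) := by
    have h := Matrix.exp_diagonal (fun _ : Ω => -(t * c))
    have h1 : ∀ r : ℝ, r • (1 : Matrix Ω Ω ℝ) = Matrix.diagonal fun _ => r := fun r => by
      ext k l; simp [Matrix.diagonal_apply, Matrix.one_apply]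
    rw [h1, h1, h]
    congr 1
    ext k
    rw [Pi.coe_exp, Real.exp_eq_exp_ℝ]
  rw [hsplit, Matrix.exp_add_of_commute _ _ hcomm, hone, mul_smul_comm, mul_one,
    Matrix.smul_apply, smul_eq_mul]
  refine mul_nonneg (Real.exp_nonneg _) (exp_apply_nonneg_of_nonneg _ (fun k l => ?_) i j)
  simp only [Matrix.smul_apply, Matrix.add_apply, smul_eq_mul]
  refine mul_nonneg ht ?_
  by_cases hkl : k = l
  · subst hkl
    have h1 : |A k k| ≤ c := Finset.single_le_sum (f := fun k => |A k k|)
      (fun _ _ => abs_nonneg _) (Finset.mem_univ k)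
    have h2 := neg_abs_le (A k k)
    simp; linarith
  · simpa [hkl] using hA.offdiag k l hkl

lemma sg_eq_of_mulVec_eq_zero (A : Matrix Ω Ω ℝ) (f : Ω → ℝ) (h : A *ᵥ f = 0) (t : ℝ) :
    sg A t f = f := by
  have := hasSum_exp_mulVec (t • A) f
  refine this.unique ?_
  convert hasSum_single (f := fun k : ℕ => ((Nat.factorial k : ℝ)⁻¹) • ((t • A) ^ k *ᵥ f)) 0 ?_
  · simp
  · intro k hk
    obtain ⟨k, rfl⟩ := Nat.exists_eq_succ_of_ne_zero hk
    rw [Nat.succ_eq_add_one, pow_succ, ← Matrix.mulVec_mulVec, Matrix.smul_mulVec, h]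
    simp

lemma IsGen.sg_one {A : Matrix Ω Ω ℝ} (hA : IsGen A) (t : ℝ) : sg A t 1 = 1 :=
  sg_eq_of_mulVec_eq_zero A 1 hA.mulVec_one t

lemma IsGen.sum_exp {A : Matrix Ω Ω ℝ} (hA : IsGen A) (t : ℝ) (i : Ω) :
    ∑ j, NormedSpace.exp (t • A) i j = 1 := by
  have := congrFun (hA.sg_one t) i
  simpa [sg, Matrix.mulVec, dotProduct] using this

lemma IsGen.sg_mono {A : Matrix Ω Ω ℝ} (hA : IsGen A) {t : ℝ} (ht : 0 ≤ t) {f g : Ω → ℝ}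
    (h : ∀ i, f i ≤ g i) (i : Ω) : sg A t f i ≤ sg A t g i :=
  Finset.sum_le_sum fun j _ => mul_le_mul_of_nonneg_left (h j) (hA.exp_nonneg ht i j)

lemma IsGen.sg_const {A : Matrix Ω Ω ℝ} (hA : IsGen A) (t c : ℝ) (i : Ω) :
    sg A t (fun _ => c) i = c := by
  have := congrFun (sg_smul A t c 1) i
  rw [hA.sg_one] at this
  have h2 : (c • (1 : Ω → ℝ)) = fun _ => c := by ext; simp
  rw [h2] at this; exact this

lemma IsGen.sg_nonneg {A : Matrix Ω Ω ℝ} (hA : IsGen A) {t : ℝ} (ht : 0 ≤ t) {f : Ω → ℝ}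
    (h : ∀ i, 0 ≤ f i) (i : Ω) : 0 ≤ sg A t f i := by
  have := hA.sg_mono ht (f := fun _ => 0) h i
  rwa [hA.sg_const] at this

lemma IsGen.sg_abs_le {A : Matrix Ω Ω ℝ} (hA : IsGen A) {t : ℝ} (ht : 0 ≤ t) (f : Ω → ℝ)
    (i : Ω) : |sg A t f i| ≤ sg A t (fun j => |f j|) i := by
  refine (Finset.abs_sum_le_sum_abs _ _).trans (Finset.sum_le_sum fun j _ => ?_)
  rw [abs_mul, abs_of_nonneg (hA.exp_nonneg ht i j)]

lemma IsGen.tv_add_le {A : Matrix Ω Ω ℝ} (hA : IsGen A) {s : ℝ} (hs : 0 ≤ s) (t : ℝ)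
    (ν : Ω → ℝ) (i : Ω) :
    tv (NormedSpace.exp ((s + t) • A) i) ν ≤ sg A s (fun j => tv (NormedSpace.exp (t • A) j) ν) i := by
  have hν : ∀ k, ν k = ∑ j, NormedSpace.exp (s • A) i j * ν k := fun k => by
    rw [← Finset.sum_mul, hA.sum_exp, one_mul]
  have h1 : ∀ k, |NormedSpace.exp ((s + t) • A) i k - ν k|
      ≤ ∑ j, NormedSpace.exp (s • A) i j * |NormedSpace.exp (t • A) j k - ν k| := by
    intro k
    rw [exp_add_smul, Matrix.mul_apply]
    nth_rw 1 [hν k]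
    rw [← Finset.sum_sub_distrib]
    refine (Finset.abs_sum_le_sum_abs _ _).trans (Finset.sum_le_sum fun j _ => ?_)
    rw [← mul_sub, abs_mul, abs_of_nonneg (hA.exp_nonneg hs i j)]
  have h2 := Finset.sum_le_sum fun k (_ : k ∈ Finset.univ) => h1 k
  rw [Finset.sum_comm] at h2
  simp only [tv, sg, Matrix.mulVec, dotProduct]
  rw [div_le_iff₀ two_pos, Finset.sum_mul]
  refine h2.trans (le_of_eq (Finset.sum_congr rfl fun j _ => ?_))
  rw [← Finset.mul_sum]; ring

/-- Duhamel comparison of two Markov semigroups. -/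
lemma abs_sg_sub_sg_le {A B : Matrix Ω Ω ℝ} (hA : IsGen A) (hB : IsGen B) (r : Ω → ℝ)
    (hr : ∀ g : Ω → ℝ, (∀ i, 0 ≤ g i) → (∀ i, g i ≤ 1) → ∀ i, |((B - A) *ᵥ g) i| ≤ r i)
    {t : ℝ} (ht : 0 ≤ t) (f : Ω → ℝ) (h0 : ∀ i, 0 ≤ f i) (h1 : ∀ i, f i ≤ 1) (i : Ω) (C : ℝ)
    (hC : ∀ s, 0 ≤ s → s ≤ t → sg B s r i ≤ C) :
    |sg B t f i - sg A t f i| ≤ C * t := by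
  have hd : ∀ s, HasDerivAt (fun s => sg B s (sg A (t - s) f) i)
      (sg B s ((B - A) *ᵥ sg A (t - s) f) i) s := by
    intro s
    have hAs : ∀ j, HasDerivAt (fun s => sg A (t - s) f j) (-(A *ᵥ sg A (t - s) f) j) s := by
      intro j
      have h := (hasDerivAt_sg_apply A (t - s) f j).comp s ((hasDerivAt_id s).const_sub t)
      rw [mul_neg_one] at h
      exact h
    have := HasDerivAt.fun_sum (u := Finset.univ) fun j _ =>
      (hasDerivAt_exp_apply B s i j).mul (hAs j)
    have heq : sg B s ((B - A) *ᵥ sg A (t - s) f) i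
        = ∑ j, ((B * NormedSpace.exp (s • B)) i j * sg A (t - s) f j +
          NormedSpace.exp (s • B) i j * -(A *ᵥ sg A (t - s) f) j) := by
      rw [Finset.sum_add_distrib, (commute_exp_smul B s).eq, Matrix.sub_mulVec, sg_sub]
      simp only [mul_neg, Finset.sum_neg_distrib, ← sub_eq_add_neg, Pi.sub_apply]
      congr 1
      rw [sg, Matrix.mulVec_mulVec]; rfl
    rw [heq]
    exact this
  have hb : ∀ s ∈ Set.Ico (0 : ℝ) t, ‖sg B s ((B - A) *ᵥ sg A (t - s) f) i‖ ≤ C := by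
    intro s hs
    rw [Real.norm_eq_abs]
    refine (hB.sg_abs_le hs.1 _ i).trans (le_trans ?_ (hC s hs.1 hs.2.le))
    refine hB.sg_mono hs.1 (fun j => ?_) i
    have hts : 0 ≤ t - s := by linarith [hs.2]
    refine hr _ (fun k => hA.sg_nonneg hts h0 k) (fun k => ?_) j
    have := hA.sg_mono hts (g := fun _ => 1) h1 k
    rwa [hA.sg_const] at this
  have := norm_image_sub_le_of_norm_deriv_le_segment' (f := fun s => sg B s (sg A (t - s) f) i)
    (fun s _ => (hd s).hasDerivWithinAt) hb t ⟨ht, le_rfl⟩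
  simpa [sg_zero] using this

end Semigroup

/-- A reversible Markov chain whose moves are involutions indexed by `X`, given by a
reversible weight `w` and symmetric conductances `q`. -/
structure RevChain (Ω X : Type*) where
  w : Ω → ℝ
  w_pos : ∀ s, 0 < w s
  act : X → Ω → Ω
  act_act : ∀ x s, act x (act x s) = s
  q : Ω → X → ℝ
  q_nonneg : ∀ s x, 0 ≤ q s x
  q_act : ∀ s x, q (act x s) x = q s x

lemma sub_mul_log_sub_log_ge {a b : ℝ} (ha : 0 < a) (hb : 0 < b) :
    4 * (√a - √b) ^ 2 ≤ (a - b) * (Real.log a - Real.log b) := by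
  wlog hab : b ≤ a generalizing a b
  · have := this hb ha (le_of_not_ge hab)
    nlinarith
  obtain ⟨x, hx, rfl⟩ : ∃ x, 0 < x ∧ a = x ^ 2 := ⟨√a, Real.sqrt_pos.2 ha, (Real.sq_sqrt ha.le).symm⟩
  obtain ⟨y, hy, rfl⟩ : ∃ x, 0 < x ∧ b = x ^ 2 := ⟨√b, Real.sqrt_pos.2 hb, (Real.sq_sqrt hb.le).symm⟩
  have hxy : y ≤ x := le_of_sq_le_sq hab hx.le
  rw [Real.sqrt_sq hx.le, Real.sqrt_sq hy.le, Real.log_pow, Real.log_pow]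
  have h := Real.le_log_one_add_of_nonneg (x := x / y - 1) (by
    rw [sub_nonneg, le_div_iff₀ hy]; linarith)
  rw [add_sub_cancel, Real.log_div hx.ne' hy.ne',
    show 2 * (x / y - 1) / (x / y - 1 + 2) = 2 * (x - y) / (x + y) by
      have : x + y ≠ 0 := by positivity
      have h2 : x / y - 1 + 2 ≠ 0 := by
        have : 0 < x / y := by positivity
        linarith
      rw [div_eq_div_iff h2 this]
      field_simp
      ring, div_le_iff₀ (by positivity)] at h
  have h2 := mul_le_mul_of_nonneg_left h (sub_nonneg.2 hxy)
  push_cast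
  nlinarith

namespace RevChain

variable {Ω X : Type*} [Fintype Ω] [DecidableEq Ω] [Fintype X] (C : RevChain Ω X)

/-- The generator. -/
def gen : Matrix Ω Ω ℝ := fun i j =>
  (∑ x, C.q i x * ((if j = C.act x i then 1 else 0) - if j = i then 1 else 0)) / C.w i

/-- The Dirichlet form. -/
def dir (f : Ω → ℝ) : ℝ := (∑ i, ∑ x, C.q i x * (f (C.act x i) - f i) ^ 2) / 2

/-- The weighted inner product. -/
def ip (f g : Ω → ℝ) : ℝ := ∑ i, C.w i * f i * g i

lemma gen_mulVec (f : Ω → ℝ) (i : Ω) :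
    (C.gen *ᵥ f) i = (∑ x, C.q i x * (f (C.act x i) - f i)) / C.w i := by
  simp only [gen, Matrix.mulVec, dotProduct, div_mul_eq_mul_div, ← Finset.sum_div, Finset.sum_mul]
  rw [Finset.sum_comm]
  congr 1
  refine Finset.sum_congr rfl fun x _ => ?_
  simp_rw [mul_assoc, sub_mul, ite_mul, one_mul, zero_mul]
  rw [← Finset.mul_sum, Finset.sum_sub_distrib]
  simp

lemma isGen : IsGen C.gen where
  offdiag i j hij := by
    refine div_nonneg (Finset.sum_nonneg fun x _ => mul_nonneg (C.q_nonneg _ _) ?_) (C.w_pos i).le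
    rw [if_neg (Ne.symm hij)]
    split_ifs <;> norm_num
  mulVec_one := by
    ext i; simp [gen_mulVec]

lemma sum_act (F : Ω → X → ℝ) :
    ∑ i, ∑ x, F (C.act x i) x = ∑ i, ∑ x, F i x := by
  rw [Finset.sum_comm, Finset.sum_comm (f := F)]
  exact Finset.sum_congr rfl fun x _ =>
    Equiv.sum_comp (Function.Involutive.toPerm (C.act x) (C.act_act x)) (fun i => F i x)

lemma ip_gen (f g : Ω → ℝ) :
    C.ip f (C.gen *ᵥ g)
      = -(∑ i, ∑ x, C.q i x * ((f (C.act x i) - f i) * (g (C.act x i) - g i))) / 2 := by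
  have h1 : C.ip f (C.gen *ᵥ g) = ∑ i, ∑ x, C.q i x * (f i * (g (C.act x i) - g i)) := by
    refine Finset.sum_congr rfl fun i _ => ?_
    rw [gen_mulVec, mul_comm (C.w i), mul_assoc, mul_div_cancel₀ _ (C.w_pos i).ne', Finset.mul_sum]
    exact Finset.sum_congr rfl fun x _ => by ring
  have h2 : ∑ i, ∑ x, C.q i x * (f (C.act x i) * (g i - g (C.act x i)))
      = ∑ i, ∑ x, C.q i x * (f i * (g (C.act x i) - g i)) := by
    rw [← C.sum_act (fun i x => C.q i x * (f i * (g (C.act x i) - g i)))]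
    simp only [C.act_act, C.q_act]
  have h3 : ∑ i, ∑ x, C.q i x * ((f (C.act x i) - f i) * (g (C.act x i) - g i))
      = -(∑ i, ∑ x, C.q i x * (f (C.act x i) * (g i - g (C.act x i))))
        - ∑ i, ∑ x, C.q i x * (f i * (g (C.act x i) - g i)) := by
    simp only [← Finset.sum_neg_distrib, ← Finset.sum_sub_distrib]
    exact Finset.sum_congr rfl fun i _ => Finset.sum_congr rfl fun x _ => by ring
  rw [h3, h2, h1]; ring

lemma ip_gen_self (f : Ω → ℝ) : C.ip f (C.gen *ᵥ f) = -C.dir f := by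
  rw [ip_gen, dir, neg_div]
  simp only [sq]

lemma ip_comm (f g : Ω → ℝ) : C.ip f g = C.ip g f :=
  Finset.sum_congr rfl fun i _ => by ring

lemma ip_gen_comm (f g : Ω → ℝ) : C.ip f (C.gen *ᵥ g) = C.ip (C.gen *ᵥ f) g := by
  rw [C.ip_comm (C.gen *ᵥ f) g, ip_gen, ip_gen]
  simp only [mul_comm (f _ - f _)]

lemma hasDerivAt_ip {u v : ℝ → Ω → ℝ} {u' v' : Ω → ℝ} {t : ℝ} (hu : HasDerivAt u u' t)
    (hv : HasDerivAt v v' t) :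
    HasDerivAt (fun s => C.ip (u s) (v s)) (C.ip u' (v t) + C.ip (u t) v') t := by
  have := HasDerivAt.fun_sum (u := Finset.univ) fun i _ =>
    (((hasDerivAt_pi.1 hu i).const_mul (C.w i)).fun_mul (hasDerivAt_pi.1 hv i))
  rw [Finset.sum_add_distrib] at this
  exact this

lemma ip_neg_right (f g : Ω → ℝ) : C.ip f (-g) = -C.ip f g := by
  simp [ip]

lemma ip_add_right (f g h : Ω → ℝ) : C.ip f (g + h) = C.ip f g + C.ip f h := by
  simp [ip, mul_add, Finset.sum_add_distrib]

lemma ip_smul_right (c : ℝ) (f g : Ω → ℝ) : C.ip f (c • g) = c * C.ip f g := by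
  simp only [ip, Finset.mul_sum, Pi.smul_apply, smul_eq_mul]
  exact Finset.sum_congr rfl fun i _ => by ring

lemma ip_add_left (f g h : Ω → ℝ) : C.ip (f + g) h = C.ip f h + C.ip g h := by
  rw [ip_comm, ip_add_right, ip_comm, C.ip_comm g]

lemma ip_smul_left (c : ℝ) (f g : Ω → ℝ) : C.ip (c • f) g = c * C.ip f g := by
  rw [ip_comm, ip_smul_right, ip_comm]

lemma ip_self_nonneg (f : Ω → ℝ) : 0 ≤ C.ip f f :=
  Finset.sum_nonneg fun i _ => by
    rw [mul_assoc]; exact mul_nonneg (C.w_pos i).le (mul_self_nonneg _)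

lemma ip_sq_le (f g : Ω → ℝ) : C.ip f g ^ 2 ≤ C.ip f f * C.ip g g := by
  have h := Finset.sum_mul_sq_le_sq_mul_sq Finset.univ (fun i => √(C.w i) * f i)
    (fun i => √(C.w i) * g i)
  have hs : ∀ i, √(C.w i) * √(C.w i) = C.w i := fun i => Real.mul_self_sqrt (C.w_pos i).le
  have e : ∀ a b : Ω → ℝ, ∑ i, √(C.w i) * a i * (√(C.w i) * b i) = C.ip a b := fun a b =>
    Finset.sum_congr rfl fun i _ => by
      calc _ = √(C.w i) * √(C.w i) * a i * b i := by ring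
        _ = _ := by rw [hs i]
  simp only [sq (√(C.w _) * _), e] at h
  exact h

lemma dir_nonneg (f : Ω → ℝ) : 0 ≤ C.dir f :=
  div_nonneg (Finset.sum_nonneg fun i _ => Finset.sum_nonneg fun x _ =>
    mul_nonneg (C.q_nonneg i x) (sq_nonneg _)) two_pos.le

lemma ip_sg (t : ℝ) (f g : Ω → ℝ) : C.ip f (sg C.gen t g) = C.ip (sg C.gen t f) g := by
  have hd : ∀ s, HasDerivAt (fun s => C.ip (sg C.gen s f) (sg C.gen (t - s) g)) 0 s := by
    intro s
    have hA : HasDerivAt (fun s => sg C.gen (t - s) g) (-(C.gen *ᵥ sg C.gen (t - s) g)) s := by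
      have h := (hasDerivAt_sg C.gen (t - s) g).scomp s ((hasDerivAt_id s).const_sub t)
      rw [neg_one_smul] at h
      exact h
    have h := C.hasDerivAt_ip (hasDerivAt_sg C.gen s f) hA
    rwa [ip_neg_right, ip_gen_comm, add_neg_cancel] at h
  have := is_const_of_deriv_eq_zero (fun s => (hd s).differentiableAt) (fun s => (hd s).deriv) 0 t
  simpa [sg_zero] using this

lemma exp_reversible (t : ℝ) (i j : Ω) :
    C.w i * NormedSpace.exp (t • C.gen) i j = C.w j * NormedSpace.exp (t • C.gen) j i := by
  have h := C.ip_sg t (Pi.single i 1) (Pi.single j 1)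
  simp only [ip, sg, Matrix.mulVec_single_one] at h
  rw [Finset.sum_eq_single i, Finset.sum_eq_single j] at h
  · simpa using h
  all_goals simp +contextual

lemma ip_one_sg (t : ℝ) (f : Ω → ℝ) : C.ip 1 (sg C.gen t f) = C.ip 1 f := by
  rw [ip_sg, C.isGen.sg_one]

/-- Exponential decay on an invariant subspace with a spectral gap. -/
lemma ip_sg_self_le (V : Submodule ℝ (Ω → ℝ)) (hV : ∀ f ∈ V, C.gen *ᵥ f ∈ V) (l : ℝ)
    (hl : ∀ f ∈ V, l * C.ip f f ≤ C.dir f) {t : ℝ} (ht : 0 ≤ t) (f : Ω → ℝ) (hf : f ∈ V) :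
    C.ip (sg C.gen t f) (sg C.gen t f) ≤ Real.exp (-2 * l * t) * C.ip f f := by
  have hd : ∀ s, HasDerivAt (fun s => Real.exp (2 * l * s) * C.ip (sg C.gen s f) (sg C.gen s f))
      (Real.exp (2 * l * s) * (2 * l * C.ip (sg C.gen s f) (sg C.gen s f)
        - 2 * C.dir (sg C.gen s f))) s := by
    intro s
    have h1 := C.hasDerivAt_ip (hasDerivAt_sg C.gen s f) (hasDerivAt_sg C.gen s f)
    have h2 : HasDerivAt (fun s => Real.exp (2 * l * s)) (Real.exp (2 * l * s) * (2 * l)) s := by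
      have := ((hasDerivAt_id s).const_mul (2 * l)).exp
      simpa using this
    have h3 := h2.fun_mul h1
    refine h3.congr_deriv ?_
    rw [← ip_gen_comm, ip_gen_self]; ring
  have hanti : AntitoneOn (fun s => Real.exp (2 * l * s) * C.ip (sg C.gen s f) (sg C.gen s f))
      (Set.Ici 0) := by
    refine antitoneOn_of_deriv_nonpos (convex_Ici 0)
      (fun s _ => (hd s).continuousAt.continuousWithinAt)
      (fun s _ => (hd s).differentiableAt.differentiableWithinAt) fun s _ => ?_
    rw [(hd s).deriv]
    refine mul_nonpos_of_nonneg_of_nonpos (Real.exp_nonneg _) ?_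
    have := hl _ (sg_mem C.gen V hV s f hf)
    linarith
  have h := hanti (Set.mem_Ici.2 le_rfl) (Set.mem_Ici.2 ht) ht
  simp only [mul_zero, Real.exp_zero, one_mul, sg_zero] at h
  have e : Real.exp (-2 * l * t) * Real.exp (2 * l * t) = 1 := by
    rw [← Real.exp_add]; simp
  calc _ = Real.exp (-2 * l * t) * (Real.exp (2 * l * t)
        * C.ip (sg C.gen t f) (sg C.gen t f)) := by rw [← mul_assoc, e, one_mul]
    _ ≤ _ := mul_le_mul_of_nonneg_left h (Real.exp_nonneg _)

/-- Lower bound on autocorrelations. -/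
lemma exp_mul_ip_le_ip_sg (c : ℝ) {t : ℝ} (ht : 0 ≤ t) (f : Ω → ℝ) (hc : C.dir f = c * C.ip f f) :
    Real.exp (-c * t) * C.ip f f ≤ C.ip f (sg C.gen t f) := by
  have hE : ∀ s, HasDerivAt (fun s => Real.exp (c * s)) (Real.exp (c * s) * c) s := by
    intro s
    have := ((hasDerivAt_id s).const_mul c).exp
    simpa using this
  have hip : ∀ (g : Ω → ℝ) s, HasDerivAt (fun s => C.ip f (sg C.gen s g))
      (C.ip f (sg C.gen s (C.gen *ᵥ g))) s := by
    intro g s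
    have h := C.hasDerivAt_ip (hasDerivAt_const s f) (hasDerivAt_sg C.gen s g)
    rw [sg_comm] at h
    simpa [ip] using h
  have hd : ∀ (g : Ω → ℝ) s, HasDerivAt (fun s => Real.exp (c * s) * C.ip f (sg C.gen s g))
      (Real.exp (c * s) * C.ip f (sg C.gen s (C.gen *ᵥ g + c • g))) s := by
    intro g s
    refine ((hE s).fun_mul (hip g s)).congr_deriv ?_
    rw [sg_linear_add, sg_smul, ip_add_right, ip_smul_right]; ring
  set g1 := C.gen *ᵥ f + c • f with hg1
  have hsecond : ∀ s, 0 ≤ C.ip f (sg C.gen s (C.gen *ᵥ g1 + c • g1)) := by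
    intro s
    have e : C.ip f (sg C.gen s (C.gen *ᵥ g1 + c • g1)) = C.ip g1 (sg C.gen s g1) := by
      rw [sg_linear_add, ← sg_comm, ip_add_right, ip_gen_comm, sg_smul, ip_smul_right,
        ← ip_smul_left, ← ip_add_left]
    rw [e, show s = s / 2 + s / 2 by ring, sg_add, ip_sg]
    exact C.ip_self_nonneg _
  have hmono1 : Monotone (fun s => Real.exp (c * s) * C.ip f (sg C.gen s g1)) :=
    monotone_of_hasDerivAt_nonneg (hd g1) fun s => mul_nonneg (Real.exp_nonneg _) (hsecond s)
  have h0 : C.ip f (sg C.gen 0 g1) = 0 := by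
    rw [sg_zero, hg1, ip_add_right, ip_gen_self, ip_smul_right, hc]; ring
  have hmono : MonotoneOn (fun s => Real.exp (c * s) * C.ip f (sg C.gen s f)) (Set.Ici 0) := by
    refine monotoneOn_of_deriv_nonneg (convex_Ici 0)
      (fun s _ => (hd f s).continuousAt.continuousWithinAt)
      (fun s _ => (hd f s).differentiableAt.differentiableWithinAt) fun s hs => ?_
    rw [(hd f s).deriv]
    have hs0 : 0 ≤ s := by
      have := interior_subset hs
      simpa using this
    have := hmono1 hs0
    simp only [h0, mul_zero] at this
    exact this
  have h := hmono (Set.mem_Ici.2 le_rfl) (Set.mem_Ici.2 ht) ht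
  simp only [mul_zero, Real.exp_zero, one_mul, sg_zero] at h
  have e : Real.exp (-c * t) * Real.exp (c * t) = 1 := by
    rw [← Real.exp_add]; simp
  calc _ ≤ Real.exp (-c * t) * (Real.exp (c * t) * C.ip f (sg C.gen t f)) :=
        mul_le_mul_of_nonneg_left h (Real.exp_nonneg _)
    _ = _ := by rw [← mul_assoc, e, one_mul]

/-- Entropy dissipation. -/
lemma hasDerivAt_entropy (h : Ω → ℝ) (hpos : ∀ i, 0 < h i) {t : ℝ} (ht : 0 ≤ t) :
    ∃ d, HasDerivAt (fun s => ∑ i, C.w i * (sg C.gen s h i * Real.log (sg C.gen s h i))) d t ∧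
      d ≤ -4 * C.dir (fun i => √(sg C.gen t h i)) := by
  have hp : ∀ i, 0 < sg C.gen t h i := by
    intro i
    have hne : (Finset.univ : Finset Ω).Nonempty := ⟨i, Finset.mem_univ i⟩
    obtain ⟨k, -, hk⟩ := Finset.exists_min_image Finset.univ h hne
    have := C.isGen.sg_mono ht (f := fun _ => h k) (fun j => hk j (Finset.mem_univ j)) i
    rw [C.isGen.sg_const] at this
    exact (hpos k).trans_le this
  set u := sg C.gen t h with hu
  refine ⟨C.ip (fun i => Real.log (u i) + 1) (C.gen *ᵥ u), ?_, ?_⟩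
  · have := HasDerivAt.fun_sum (u := Finset.univ) fun i _ =>
      (((hasDerivAt_sg_apply C.gen t h i).fun_mul
        ((hasDerivAt_sg_apply C.gen t h i).log (hp i).ne')).const_mul (C.w i))
    refine this.congr_deriv (Finset.sum_congr rfl fun i _ => ?_)
    have := (hp i).ne'
    rw [← hu]
    field_simp
  · rw [ip_gen, dir]
    have key : ∑ i, ∑ x, C.q i x * (4 * (√(u (C.act x i)) - √(u i)) ^ 2) ≤
        ∑ i, ∑ x, C.q i x * ((Real.log (u (C.act x i)) + 1 - (Real.log (u i) + 1))
          * (u (C.act x i) - u i)) := by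
      refine Finset.sum_le_sum fun i _ => Finset.sum_le_sum fun x _ =>
        mul_le_mul_of_nonneg_left ?_ (C.q_nonneg i x)
      have := sub_mul_log_sub_log_ge (hp (C.act x i)) (hp i)
      linarith
    have e : ∑ i, ∑ x, C.q i x * (4 * (√(u (C.act x i)) - √(u i)) ^ 2)
        = 4 * ∑ i, ∑ x, C.q i x * (√(u (C.act x i)) - √(u i)) ^ 2 := by
      simp only [Finset.mul_sum]
      exact Finset.sum_congr rfl fun i _ => Finset.sum_congr rfl fun x _ => by ring
    rw [e] at key
    linarith

end RevChain

/-- The discrete torus. -/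
abbrev Tor (L : ℕ) := ZMod L × ZMod L

/-- Configurations, additively: `0` codes one spin value and `1` the other. -/
abbrev Cfg (L : ℕ) := Tor L → ZMod 2

section Model

variable {L : ℕ}

lemma cfg_two : (2 : Cfg L) = 0 := by
  ext p; exact (by decide : (2 : ZMod 2) = 0)

lemma zmod_two_ne_zero {a : ZMod 2} : a ≠ 0 ↔ a = 1 := by
  revert a; decide

/-- A single flipped spin. -/
def dl (p : Tor L) : Cfg L := Pi.single p 1

lemma dl_apply (p r : Tor L) : dl p r = if r = p then 1 else 0 := by
  simp [dl, Pi.single_apply]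

lemma dl_self (p : Tor L) : dl p p = 1 := by simp [dl_apply]

/-- The defect field of a configuration. -/
def bd : Cfg L →+ Cfg L where
  toFun s p := s p + s (p.1 - 1, p.2) + s (p.1, p.2 - 1) + s (p.1 - 1, p.2 - 1)
  map_zero' := by ext p; simp
  map_add' s t := by ext p; simp only [Pi.add_apply]; ring

lemma bd_apply (s : Cfg L) (p : Tor L) :
    bd s p = s p + s (p.1 - 1, p.2) + s (p.1, p.2 - 1) + s (p.1 - 1, p.2 - 1) := rfl

lemma bd_dl (x y : ZMod L) :
    bd (dl (x, y)) = dl (x, y) + dl (x + 1, y) + dl (x, y + 1) + dl (x + 1, y + 1) := by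
  ext ⟨u, v⟩
  simp only [bd_apply, Pi.add_apply, dl_apply, Prod.mk.injEq, sub_eq_iff_eq_add]

/-- A horizontal strip of `n` flipped spins. -/
def hs (x y : ZMod L) (n : ℕ) : Cfg L := ∑ i ∈ Finset.range n, dl (x + i, y)

/-- A vertical strip of `n` flipped spins. -/
def vs (x y : ZMod L) (n : ℕ) : Cfg L := ∑ i ∈ Finset.range n, dl (x, y + i)

/-- A rectangle of flipped spins. -/
def rect (x y : ZMod L) (a b : ℕ) : Cfg L := ∑ j ∈ Finset.range b, hs x (y + j) a

lemma bd_hs (x y : ZMod L) (n : ℕ) :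
    bd (hs x y n) = dl (x, y) + dl (x, y + 1) + dl (x + (n : ZMod L), y) + dl (x + (n : ZMod L), y + 1) := by
  have h2 := cfg_two (L := L)
  induction n with
  | zero => simp [hs]; grind
  | succ n ih =>
    rw [hs, Finset.sum_range_succ, map_add, ← hs, ih, bd_dl]
    push_cast
    rw [← add_assoc x]
    grind

lemma bd_vs (x y : ZMod L) (n : ℕ) :
    bd (vs x y n) = dl (x, y) + dl (x + 1, y) + dl (x, y + (n : ZMod L)) + dl (x + 1, y + (n : ZMod L)) := by
  have h2 := cfg_two (L := L)
  induction n with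
  | zero => simp [vs]; grind
  | succ n ih =>
    rw [vs, Finset.sum_range_succ, map_add, ← vs, ih, bd_dl]
    push_cast
    rw [← add_assoc y]
    grind

lemma bd_rect (x y : ZMod L) (a b : ℕ) :
    bd (rect x y a b) = dl (x, y) + dl (x + (a : ZMod L), y) + dl (x, y + (b : ZMod L))
      + dl (x + (a : ZMod L), y + (b : ZMod L)) := by
  have h2 := cfg_two (L := L)
  induction b with
  | zero => simp [rect]; grind
  | succ n ih =>
    rw [rect, Finset.sum_range_succ, map_add, ← rect, ih, bd_hs]
    push_cast
    rw [← add_assoc y]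
    grind

lemma hs_succ (x y : ZMod L) (n : ℕ) : hs x y (n + 1) = hs x y n + dl (x + (n : ZMod L), y) :=
  Finset.sum_range_succ _ _

lemma rect_succ (x y : ZMod L) (a b : ℕ) : rect x y a (b + 1) = rect x y a b + hs x (y + b) a :=
  Finset.sum_range_succ _ _

lemma cast_inj_of_lt {m n : ℕ} (hm : m < L) (hn : n < L) (h : (m : ZMod L) = n) : m = n := by
  rw [ZMod.natCast_eq_natCast_iff'] at h
  rwa [Nat.mod_eq_of_lt hm, Nat.mod_eq_of_lt hn] at h

lemma cast_ne_zero_of_lt {m : ℕ} (h0 : m ≠ 0) (hm : m < L) : (m : ZMod L) ≠ 0 := by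
  intro h
  exact h0 (cast_inj_of_lt hm (by omega) (by simpa using h))

variable [NeZero L]

/-- The number of nonzero sites. -/
def cnt (D : Cfg L) : ℕ := (Finset.univ.filter fun p => D p ≠ 0).card

lemma cnt_zero : cnt (0 : Cfg L) = 0 := by simp [cnt]

lemma cnt_eq_zero {D : Cfg L} : cnt D = 0 ↔ D = 0 := by
  rw [cnt, Finset.card_eq_zero, Finset.filter_eq_empty_iff]
  constructor
  · intro h; ext p; simpa using h (Finset.mem_univ p)
  · rintro rfl; simp

lemma cnt_add_dl_of_ne {D : Cfg L} {p : Tor L} (h : D p ≠ 0) : cnt (D + dl p) + 1 = cnt D := by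
  have e : (Finset.univ.filter fun r => D r ≠ 0)
      = insert p (Finset.univ.filter fun r => (D + dl p) r ≠ 0) := by
    ext r
    by_cases hr : r = p
    · subst hr; simp [h]
    · simp [hr, dl_apply]
  rw [cnt, cnt, e, Finset.card_insert_of_notMem]
  simp [dl_apply, zmod_two_ne_zero.1 h]
  decide

lemma cnt_add_dl_of_eq {D : Cfg L} {p : Tor L} (h : D p = 0) : cnt (D + dl p) = cnt D + 1 := by
  have : (D + dl p) p ≠ 0 := by simp [h, dl_apply]
  rw [← cnt_add_dl_of_ne this]
  have h2 := cfg_two (L := L)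
  rw [show D + dl p + dl p = D by grind]

lemma cnt_add_dl_le (D : Cfg L) (p : Tor L) : cnt (D + dl p) ≤ cnt D + 1 := by
  by_cases h : D p = 0
  · rw [cnt_add_dl_of_eq h]
  · have := cnt_add_dl_of_ne h; omega

/-- The number of defects. -/
def Nd (s : Cfg L) : ℕ := cnt (bd s)

lemma cnt_le (D : Cfg L) : cnt D ≤ L ^ 2 := by
  refine (Finset.card_filter_le _ _).trans ?_
  simp [Finset.card_univ, ZMod.card, sq]

lemma sum_bd_row (s : Cfg L) (y : ZMod L) : ∑ x, bd s (x, y) = 0 := by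
  have h : ∀ v, ∑ x, s (x - 1, v) = ∑ x, s (x, v) := fun v =>
    Equiv.sum_comp (Equiv.subRight (1 : ZMod L)) fun x => s (x, v)
  simp only [bd_apply, Finset.sum_add_distrib, h]
  grind

lemma sum_bd_col (s : Cfg L) (x : ZMod L) : ∑ y, bd s (x, y) = 0 := by
  have h : ∀ u, ∑ y, s (u, y - 1) = ∑ y, s (u, y) := fun u =>
    Equiv.sum_comp (Equiv.subRight (1 : ZMod L)) fun y => s (u, y)
  simp only [bd_apply, Finset.sum_add_distrib, h]
  grind

lemma exists_ne_of_sum_eq_zero {g : ZMod L → ZMod 2} (hg : ∑ x, g x = 0) {x : ZMod L}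
    (hx : g x ≠ 0) : ∃ n : ℕ, 1 ≤ n ∧ n < L ∧ g (x + n) ≠ 0 := by
  by_contra hc
  push Not at hc
  rw [Finset.sum_eq_single x] at hg
  · exact hx hg
  · intro y _ hyx
    have := hc (y - x).val (by
      rw [Nat.one_le_iff_ne_zero, Ne, ZMod.val_eq_zero, sub_eq_zero]; exact hyx) (ZMod.val_lt _)
    simpa using this
  · simp

/-- Horizontal distance from a defect to the next one. -/
def gapX (D : Cfg L) (z : Tor L) : ℕ := sInf {n : ℕ | 1 ≤ n ∧ D (z.1 + n, z.2) ≠ 0}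

/-- Vertical distance from a defect to the next one. -/
def gapY (D : Cfg L) (z : Tor L) : ℕ := sInf {n : ℕ | 1 ≤ n ∧ D (z.1, z.2 + n) ≠ 0}

lemma gapX_le {D : Cfg L} {z : Tor L} {n : ℕ} (hn : 1 ≤ n) (h : D (z.1 + n, z.2) ≠ 0) :
    gapX D z ≤ n := Nat.sInf_le ⟨hn, h⟩

lemma gapX_spec {s : Cfg L} {z : Tor L} (hz : bd s z ≠ 0) :
    1 ≤ gapX (bd s) z ∧ gapX (bd s) z < L ∧ bd s (z.1 + gapX (bd s) z, z.2) ≠ 0 := by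
  obtain ⟨n, h1, h2, h3⟩ := exists_ne_of_sum_eq_zero (sum_bd_row s z.2) (x := z.1) hz
  have hm := Nat.sInf_mem (s := {n : ℕ | 1 ≤ n ∧ bd s (z.1 + n, z.2) ≠ 0}) ⟨n, h1, h3⟩
  exact ⟨hm.1, (gapX_le h1 h3).trans_lt h2, hm.2⟩

lemma gapY_spec {s : Cfg L} {z : Tor L} (hz : bd s z ≠ 0) :
    1 ≤ gapY (bd s) z ∧ gapY (bd s) z < L ∧ bd s (z.1, z.2 + gapY (bd s) z) ≠ 0 := by
  obtain ⟨n, h1, h2, h3⟩ := exists_ne_of_sum_eq_zero (sum_bd_col s z.1) (x := z.2) hz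
  have hm := Nat.sInf_mem (s := {n : ℕ | 1 ≤ n ∧ bd s (z.1, z.2 + n) ≠ 0}) ⟨n, h1, h3⟩
  exact ⟨hm.1, (Nat.sInf_le (s := {n : ℕ | 1 ≤ n ∧ bd s (z.1, z.2 + n) ≠ 0}) ⟨h1, h3⟩).trans_lt h2,
    hm.2⟩

/-- The gaps of the defects are disjoint. -/
lemma sum_gapX_le (s : Cfg L) :
    ∑ z ∈ Finset.univ.filter (fun z => bd s z ≠ 0), gapX (bd s) z ≤ L ^ 2 := by
  have hcard : Fintype.card (Tor L) = L ^ 2 := by simp [ZMod.card, sq]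
  have hsig : ((Finset.univ.filter fun z => bd s z ≠ 0).sigma
      fun z => Finset.range (gapX (bd s) z)).card
      = ∑ z ∈ Finset.univ.filter (fun z => bd s z ≠ 0), gapX (bd s) z := by
    simp [Finset.card_sigma]
  rw [← hsig, ← hcard, ← Finset.card_univ]
  refine Finset.card_le_card_of_injOn (fun t => (t.1.1 + (t.2 : ZMod L), t.1.2))
    (fun _ _ => Finset.mem_coe.2 (Finset.mem_univ _)) ?_
  have key : ∀ (z z' : Tor L) (i i' : ℕ), bd s z ≠ 0 → i ≤ i' → i' < gapX (bd s) z' →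
      z.1 + (i : ZMod L) = z'.1 + (i' : ZMod L) → z.2 = z'.2 → i = i' := by
    intro z z' i i' hz hii hi' h1 h2
    by_contra hne
    have h3 : z'.1 + ((i' - i : ℕ) : ZMod L) = z.1 := by
      rw [Nat.cast_sub hii]; linear_combination -h1
    have h4 : gapX (bd s) z' ≤ i' - i := gapX_le (by omega) (by rw [h3, ← h2]; exact hz)
    omega
  rintro ⟨z, i⟩ ht ⟨z', i'⟩ ht' heq
  simp only [Finset.coe_sigma, Set.mem_sigma_iff, Finset.mem_coe, Finset.mem_filter,
    Finset.mem_univ, true_and, Finset.mem_range, Prod.mk.injEq] at ht ht' heq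
  have hi : i = i' := by
    rcases le_total i i' with h | h
    · exact key z z' i i' ht.1 h ht'.2 heq.1 heq.2
    · exact (key z' z i' i ht'.1 h ht.2 heq.1.symm heq.2.symm).symm
  subst hi
  have : z = z' := Prod.ext (by simpa using heq.1) heq.2
  subst this
  rfl

end Model

section Paths

variable {L : ℕ} [NeZero L]

/-- The unnormalized Gibbs weight. -/
def wt (β : ℝ) (s : Cfg L) : ℝ := Real.exp (-β * Nd s)

/-- The square plaquette dynamics. -/
def spm (L : ℕ) [NeZero L] (β : ℝ) : RevChain (Cfg L) (Tor L) where
  w := wt β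
  w_pos _ := Real.exp_pos _
  act x s := s + dl x
  act_act x s := by
    have h2 := cfg_two (L := L)
    grind
  q s x := Real.exp (-β * (max (Nd s) (Nd (s + dl x)) : ℕ))
  q_nonneg _ _ := (Real.exp_pos _).le
  q_act s x := by
    have h2 := cfg_two (L := L)
    rw [show s + dl x + dl x = s by grind, max_comm]

/-- The configurations along the canonical path that fills a rectangle row by row. -/
def pst (η : Cfg L) (z : Tor L) (a j n : ℕ) : Cfg L :=
  η + rect z.1 z.2 a j + hs z.1 (z.2 + j) n

lemma bd_pst (η : Cfg L) (x y : ZMod L) (a j n : ℕ) :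
    bd (pst η (x, y) a j n) = bd η + dl (x, y) + dl (x + (a : ZMod L), y)
      + dl (x + (a : ZMod L), y + (j : ZMod L)) + dl (x + (n : ZMod L), y + (j : ZMod L))
      + dl (x, y + (j : ZMod L) + 1) + dl (x + (n : ZMod L), y + (j : ZMod L) + 1) := by
  have h2 := cfg_two (L := L)
  rw [pst, map_add, map_add, bd_rect, bd_hs]
  grind

lemma pst_succ (η : Cfg L) (z : Tor L) (a j n : ℕ) :
    pst η z a j (n + 1) = pst η z a j n + dl (z.1 + (n : ZMod L), z.2 + (j : ZMod L)) := by
  rw [pst, hs_succ, pst, ← add_assoc]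

lemma pst_row (η : Cfg L) (z : Tor L) (a j : ℕ) : pst η z a j a = pst η z a (j + 1) 0 := by
  simp [pst, rect_succ, hs, add_assoc]

lemma pst_zero (η : Cfg L) (z : Tor L) (a : ℕ) : pst η z a 0 0 = η := by
  simp [pst, rect, hs]

lemma pst_end (η : Cfg L) (z : Tor L) (a b : ℕ) : pst η z a b 0 = η + rect z.1 z.2 a b := by
  simp [pst, hs]

lemma path_telescope (f : Cfg L → ℝ) (η : Cfg L) (z : Tor L) (a b : ℕ) :
    f η - f (η + rect z.1 z.2 a b) = ∑ j ∈ Finset.range b, ∑ n ∈ Finset.range a,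
      (f (pst η z a j n) - f (pst η z a j (n + 1))) := by
  simp only [Finset.sum_range_sub', pst_row]
  rw [pst_zero, pst_end]

lemma path_sq_le (f : Cfg L → ℝ) (η : Cfg L) (z : Tor L) (a b : ℕ) :
    (f η - f (η + rect z.1 z.2 a b)) ^ 2 ≤ a * b * ∑ j ∈ Finset.range b, ∑ n ∈ Finset.range a,
      (f (pst η z a j n) - f (pst η z a j (n + 1))) ^ 2 := by
  rw [path_telescope, ← Finset.sum_product', ← Finset.sum_product']
  refine (sq_sum_le_card_mul_sum_sq).trans (le_of_eq ?_)
  simp [Finset.card_product, mul_comm]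

lemma Nd_pst_le {η : Cfg L} {x y : ZMod L} {a : ℕ} (ha : 1 ≤ a) (haL : a < L)
    (h1 : bd η (x, y) ≠ 0) (h2 : bd η (x + (a : ZMod L), y) ≠ 0) (j n : ℕ) :
    Nd (pst η (x, y) a j n) ≤ Nd η + 2 := by
  have ne : x + (a : ZMod L) ≠ x := by simpa using cast_ne_zero_of_lt (by omega) haL
  have e1 := cnt_add_dl_of_ne h1
  have h3 : (bd η + dl (x, y)) (x + (a : ZMod L), y) ≠ 0 := by
    simpa [dl_apply, ne] using h2
  have e2 := cnt_add_dl_of_ne h3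
  rw [Nd, bd_pst]
  have c1 := cnt_add_dl_le (bd η + dl (x, y) + dl (x + (a : ZMod L), y)
      + dl (x + (a : ZMod L), y + (j : ZMod L)) + dl (x + (n : ZMod L), y + (j : ZMod L))
      + dl (x, y + (j : ZMod L) + 1)) (x + (n : ZMod L), y + (j : ZMod L) + 1)
  have c2 := cnt_add_dl_le (bd η + dl (x, y) + dl (x + (a : ZMod L), y)
      + dl (x + (a : ZMod L), y + (j : ZMod L)) + dl (x + (n : ZMod L), y + (j : ZMod L)))
      (x, y + (j : ZMod L) + 1)
  have c3 := cnt_add_dl_le (bd η + dl (x, y) + dl (x + (a : ZMod L), y)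
      + dl (x + (a : ZMod L), y + (j : ZMod L))) (x + (n : ZMod L), y + (j : ZMod L))
  have c4 := cnt_add_dl_le (bd η + dl (x, y) + dl (x + (a : ZMod L), y))
      (x + (a : ZMod L), y + (j : ZMod L))
  unfold Nd
  omega

lemma Nd_pst_le_of_good {η : Cfg L} {x y : ZMod L} {a : ℕ} (ha : 1 ≤ a) (haL : a < L)
    (h1 : bd η (x, y) ≠ 0) (h2 : bd η (x + (a : ZMod L), y) ≠ 0) {j : ℕ} (hj : j + 1 < L) (n : ℕ)
    (hg : bd η (x, y + (j : ZMod L) + 1) ≠ 0 ∨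
      (1 ≤ j ∧ bd η (x + (a : ZMod L), y + (j : ZMod L)) ≠ 0)) :
    Nd (pst η (x, y) a j n) ≤ Nd η := by
  have htwo := cfg_two (L := L)
  have ne : x + (a : ZMod L) ≠ x := by simpa using cast_ne_zero_of_lt (by omega) haL
  have e1 := cnt_add_dl_of_ne h1
  have h3 : (bd η + dl (x, y)) (x + (a : ZMod L), y) ≠ 0 := by
    simpa [dl_apply, ne] using h2
  have e2 := cnt_add_dl_of_ne h3
  rw [Nd, bd_pst]
  rcases hg with hg | ⟨hj1, hg⟩
  · have nj : y + (j : ZMod L) + 1 ≠ y := by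
      have := cast_ne_zero_of_lt (L := L) (m := j + 1) (by omega) hj
      push_cast at this
      rw [add_assoc]; simpa using this
    have h4 : (bd η + dl (x, y) + dl (x + (a : ZMod L), y)) (x, y + (j : ZMod L) + 1) ≠ 0 := by
      simpa [dl_apply, nj] using hg
    have e3 := cnt_add_dl_of_ne h4
    have c1 := cnt_add_dl_le (bd η + dl (x, y) + dl (x + (a : ZMod L), y)
      + dl (x, y + (j : ZMod L) + 1) + dl (x + (a : ZMod L), y + (j : ZMod L))
      + dl (x + (n : ZMod L), y + (j : ZMod L))) (x + (n : ZMod L), y + (j : ZMod L) + 1)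
    have c2 := cnt_add_dl_le (bd η + dl (x, y) + dl (x + (a : ZMod L), y)
      + dl (x, y + (j : ZMod L) + 1) + dl (x + (a : ZMod L), y + (j : ZMod L)))
      (x + (n : ZMod L), y + (j : ZMod L))
    have c3 := cnt_add_dl_le (bd η + dl (x, y) + dl (x + (a : ZMod L), y)
      + dl (x, y + (j : ZMod L) + 1)) (x + (a : ZMod L), y + (j : ZMod L))
    rw [show bd η + dl (x, y) + dl (x + (a : ZMod L), y)
      + dl (x + (a : ZMod L), y + (j : ZMod L)) + dl (x + (n : ZMod L), y + (j : ZMod L))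
      + dl (x, y + (j : ZMod L) + 1) + dl (x + (n : ZMod L), y + (j : ZMod L) + 1)
      = bd η + dl (x, y) + dl (x + (a : ZMod L), y)
      + dl (x, y + (j : ZMod L) + 1) + dl (x + (a : ZMod L), y + (j : ZMod L))
      + dl (x + (n : ZMod L), y + (j : ZMod L)) + dl (x + (n : ZMod L), y + (j : ZMod L) + 1) by abel]
    unfold Nd
    omega
  · have nj : y + (j : ZMod L) ≠ y := by
      simpa using cast_ne_zero_of_lt (L := L) (m := j) (by omega) (by omega)
    have h4 : (bd η + dl (x, y) + dl (x + (a : ZMod L), y))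
        (x + (a : ZMod L), y + (j : ZMod L)) ≠ 0 := by
      simpa [dl_apply, nj, ne] using hg
    have e3 := cnt_add_dl_of_ne h4
    have c1 := cnt_add_dl_le (bd η + dl (x, y) + dl (x + (a : ZMod L), y)
      + dl (x + (a : ZMod L), y + (j : ZMod L)) + dl (x + (n : ZMod L), y + (j : ZMod L))
      + dl (x, y + (j : ZMod L) + 1)) (x + (n : ZMod L), y + (j : ZMod L) + 1)
    have c2 := cnt_add_dl_le (bd η + dl (x, y) + dl (x + (a : ZMod L), y)
      + dl (x + (a : ZMod L), y + (j : ZMod L)) + dl (x + (n : ZMod L), y + (j : ZMod L)))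
      (x, y + (j : ZMod L) + 1)
    have c3 := cnt_add_dl_le (bd η + dl (x, y) + dl (x + (a : ZMod L), y)
      + dl (x + (a : ZMod L), y + (j : ZMod L))) (x + (n : ZMod L), y + (j : ZMod L))
    unfold Nd
    omega

lemma add_cast_eq_iff {x : ZMod L} {m n : ℕ} (hm : m < L) (hn : n < L) :
    x + (m : ZMod L) = x + (n : ZMod L) ↔ m = n :=
  ⟨fun h => cast_inj_of_lt hm hn (add_left_cancel h), fun h => by rw [h]⟩

lemma bd_pst_row_succ (η : Cfg L) (x y : ZMod L) {a j n m : ℕ} (hj : j + 1 < L) (hn : n < L)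
    (hm : m < L) :
    bd (pst η (x, y) a j n) (x + (m : ZMod L), y + (j : ZMod L) + 1)
      = bd η (x + (m : ZMod L), y + (j : ZMod L) + 1) + (if m = 0 then 1 else 0)
        + (if m = n then 1 else 0) := by
  have nj : y + (j : ZMod L) + 1 ≠ y := by
    have := cast_ne_zero_of_lt (L := L) (m := j + 1) (by omega) hj
    push_cast at this
    rw [add_assoc]; simpa using this
  have n1 : y + (j : ZMod L) + 1 ≠ y + (j : ZMod L) := by
    have := cast_ne_zero_of_lt (L := L) (m := 1) (by omega) (by omega)
    simpa using this
  have h0 : x + (m : ZMod L) = x ↔ m = 0 := by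
    have := add_cast_eq_iff (x := x) hm (show 0 < L by omega)
    simpa using this
  rw [bd_pst]
  simp only [Pi.add_apply, dl_apply, Prod.mk.injEq, nj, n1, and_false, if_false, add_zero, and_true,
    add_cast_eq_iff hm hn, h0]

lemma bd_pst_row_same (η : Cfg L) (x y : ZMod L) {a j n m : ℕ} (hj : j < L) (hL : 1 < L)
    (haL : a < L) (hnm : n < m) (hma : m ≤ a) :
    bd (pst η (x, y) a j n) (x + (m : ZMod L), y + (j : ZMod L))
      = bd η (x + (m : ZMod L), y + (j : ZMod L)) + (if j ≠ 0 ∧ m = a then 1 else 0) := by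
  have n1 : y + (j : ZMod L) ≠ y + (j : ZMod L) + 1 := by
    have := cast_ne_zero_of_lt (L := L) (m := 1) (by omega) (by omega)
    simpa using this
  have h0 : x + (m : ZMod L) ≠ x := by
    simpa using cast_ne_zero_of_lt (L := L) (m := m) (by omega) (by omega)
  have hj0 : y + (j : ZMod L) = y ↔ j = 0 := by
    have := add_cast_eq_iff (x := y) hj (show 0 < L by omega)
    simpa using this
  rw [bd_pst]
  simp only [Pi.add_apply, dl_apply, Prod.mk.injEq, n1, h0, and_false, false_and, if_false, add_zero,
    and_true, add_cast_eq_iff (show m < L by omega) haL,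
    add_cast_eq_iff (show m < L by omega) (show n < L by omega), hj0]
  by_cases h1 : m = a <;> by_cases h2 : j = 0 <;> simp [h1, h2, show m ≠ n by omega]
  all_goals (try subst h1); try simp [show m ≠ n by omega]
  rw [add_assoc, show (1 : ZMod 2) + 1 = 0 from rfl, add_zero]

lemma card_window_le (S : Finset ℕ) (m a κ : ℕ) (hκ : 1 ≤ κ) (hS : ∀ i ∈ S, m ≤ i ∧ i < m + a)
    (hgap : ∀ i ∈ S, ∀ i' ∈ S, i < i' → a ≤ κ * (i' - i)) : S.card ≤ κ := by
  rcases Nat.eq_zero_or_pos a with ha | ha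
  · have : S = ∅ := Finset.eq_empty_of_forall_notMem fun i hi => by have := hS i hi; omega
    simp [this]
  rw [← Finset.card_range κ]
  have hlt : ∀ i ∈ S, ∀ i' ∈ S, i < i' → κ * (i - m) / a < κ * (i' - m) / a := by
    intro i hi i' hi' hii
    have h := hgap i hi i' hi' hii
    have e : κ * (i' - m) = κ * (i - m) + κ * (i' - i) := by
      rw [← mul_add]; congr 1; have := hS i hi; omega
    calc κ * (i - m) / a < (κ * (i - m) + a) / a := by rw [Nat.add_div_right _ ha]; omega
      _ ≤ κ * (i' - m) / a := Nat.div_le_div_right (by omega)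
  refine Finset.card_le_card_of_injOn (fun i => κ * (i - m) / a) ?_ ?_
  · intro i hi
    have := hS i hi
    rw [Finset.coe_range, Set.mem_Iio, Nat.div_lt_iff_lt_mul ha]
    exact Nat.mul_lt_mul_of_pos_left (by omega) hκ
  · intro i hi i' hi' h
    rcases lt_trichotomy i i' with hl | hl | hl
    · exact absurd h (hlt i hi i' hi' hl).ne
    · exact hl
    · exact absurd h (hlt i' hi' i hi hl).ne'

lemma card_initial_le (T : Finset ℕ) (Q : ℕ → Prop) (k : ℕ) (hT : ∀ n ∈ T, Q n)
    (hk : ∀ n ∈ T, ((Finset.range (n + 1)).filter Q).card ≤ k) : T.card ≤ k := by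
  rcases T.eq_empty_or_nonempty with rfl | hne
  · simp
  refine le_trans (Finset.card_le_card fun n hn => ?_) (hk _ (T.max'_mem hne))
  simp only [Finset.mem_filter, Finset.mem_range]
  exact ⟨Nat.lt_succ_of_le (T.le_max' n hn), hT n hn⟩

end Paths

section Congestion

variable {L : ℕ} [NeZero L]

/-- The defect `z` is an admissible corner for `κ`-comparable gaps. -/
structure Adm (κ : ℕ) (η : Cfg L) (z : Tor L) : Prop where
  defect : bd η z ≠ 0
  gap : ∀ y, bd η y ≠ 0 → gapX (bd η) z ≤ κ * gapX (bd η) y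

/-- `(a, j, n)` indexes a step of the canonical path started at `η` with corner `z`. -/
structure Step (κ : ℕ) (η : Cfg L) (z : Tor L) (a j n : ℕ) : Prop where
  adm : Adm κ η z
  gapX_eq : gapX (bd η) z = a
  n_lt : n < a
  j_lt : j < gapY (bd η) z

/-- The step may raise the number of defects. -/
def Bad (η : Cfg L) (z : Tor L) (a j : ℕ) : Prop :=
  bd η (z.1, z.2 + (j : ZMod L) + 1) = 0 ∧
    (1 ≤ j → bd η (z.1 + (a : ZMod L), z.2 + (j : ZMod L)) = 0)

lemma Step.facts {κ : ℕ} {η : Cfg L} {z : Tor L} {a j n : ℕ} (h : Step κ η z a j n) :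
    1 ≤ a ∧ a < L ∧ j + 1 < L ∧ bd η (z.1 + (a : ZMod L), z.2) ≠ 0 := by
  have h1 := gapX_spec h.adm.defect
  have h2 := gapY_spec h.adm.defect
  have h3 := h.j_lt
  rw [h.gapX_eq] at h1
  exact ⟨h1.1, h1.2.1, by omega, h1.2.2⟩

lemma Step.card_row_le {κ : ℕ} {η : Cfg L} {z : Tor L} {a j n : ℕ} (hκ : 1 ≤ κ)
    (h : Step κ η z a j n)
    (v : ZMod L) (m : ℕ) :
    ((Finset.Ico m (m + a)).filter fun i : ℕ => bd η (z.1 + (i : ZMod L), v) ≠ 0).card ≤ κ := by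
  refine card_window_le _ m a κ hκ (fun i hi => ?_) fun i hi i' hi' hii => ?_
  · simpa using (Finset.mem_filter.1 hi).1
  · have h1 := (Finset.mem_filter.1 hi).2
    have h2 := (Finset.mem_filter.1 hi').2
    have h3 := h.adm.gap _ h1
    rw [h.gapX_eq] at h3
    refine h3.trans (Nat.mul_le_mul_left κ (gapX_le (by omega) ?_))
    simp only
    rw [Nat.cast_sub hii.le]
    convert h2 using 3
    ring

lemma Step.up {κ : ℕ} {η : Cfg L} {z : Tor L} {a j n : ℕ} (hκ : 1 ≤ κ) (h : Step κ η z a j n)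
    (hb : Bad η z a j) {ω : Cfg L} {u v : ZMod L} (hω : pst η z a j n = ω)
    (hu : z.1 + (n : ZMod L) = u) (hv : z.2 + (j : ZMod L) = v) :
    (n ≠ 0 → bd ω (u - (n : ZMod L), v + 1) ≠ 0) ∧
      ((Finset.range (n + 1)).filter fun m : ℕ => bd ω (u - (m : ZMod L), v + 1) ≠ 0).card
        ≤ κ + 2 := by
  obtain ⟨ha, haL, hj, h2⟩ := h.facts
  have hn := h.n_lt
  obtain ⟨x, y⟩ := z
  subst hω hu hv
  simp only at *
  constructor
  · intro hn0
    have := bd_pst_row_succ η x y (a := a) (j := j) (n := n) (m := 0) hj (by omega) (by omega)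
    have hb1 := hb.1
    simp only [Nat.cast_zero, add_zero, add_sub_cancel_right] at this hb1 ⊢
    rw [this, hb1]
    simp [Ne.symm hn0]
  · have hsub : ((Finset.range (n + 1)).filter fun m : ℕ =>
        bd (pst η (x, y) a j n) (x + (n : ZMod L) - (m : ZMod L), y + (j : ZMod L) + 1) ≠ 0)
        ⊆ (((Finset.Ico 0 (0 + a)).filter fun i : ℕ =>
          bd η (x + (i : ZMod L), y + (j : ZMod L) + 1) ≠ 0).image fun i => n - i) ∪ {0, n} := by
      intro m hm
      simp only [Finset.mem_filter, Finset.mem_range] at hm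
      have e : x + (n : ZMod L) - (m : ZMod L) = x + ((n - m : ℕ) : ZMod L) := by
        rw [Nat.cast_sub (by omega)]; ring
      rw [e, bd_pst_row_succ η x y hj (by omega) (by omega)] at hm
      simp only [Finset.mem_union, Finset.mem_image, Finset.mem_filter, Finset.mem_Ico,
        Finset.mem_insert, Finset.mem_singleton]
      by_cases hm0 : m = 0
      · exact Or.inr (Or.inl hm0)
      by_cases hmn : m = n
      · exact Or.inr (Or.inr hmn)
      left
      refine ⟨n - m, ⟨⟨by omega, by omega⟩, ?_⟩, by omega⟩
      have := hm.2
      rw [if_neg (by omega), if_neg (by omega)] at this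
      simpa using this
    refine (Finset.card_le_card hsub).trans ((Finset.card_union_le _ _).trans ?_)
    exact Nat.add_le_add (Finset.card_image_le.trans (h.card_row_le hκ _ 0)) Finset.card_le_two

lemma Step.right {κ : ℕ} {η : Cfg L} {z : Tor L} {a j n : ℕ} (hκ : 1 ≤ κ) (h : Step κ η z a j n)
    (hb : Bad η z a j) {ω : Cfg L} {u v : ZMod L} (hω : pst η z a j n = ω)
    (hu : z.1 + (n : ZMod L) = u) (hv : z.2 + (j : ZMod L) = v) :
    bd ω (u + ((a - n : ℕ) : ZMod L), v) ≠ 0 ∧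
      ((Finset.range (a - n + 1)).filter fun m : ℕ => m ≠ 0 ∧ bd ω (u + (m : ZMod L), v) ≠ 0).card
        ≤ κ + 1 := by
  obtain ⟨ha, haL, hj, h2⟩ := h.facts
  have hn := h.n_lt
  obtain ⟨x, y⟩ := z
  subst hω hu hv
  simp only at *
  constructor
  · have e : x + (n : ZMod L) + ((a - n : ℕ) : ZMod L) = x + (a : ZMod L) := by
      rw [Nat.cast_sub (by omega)]; ring
    rw [e, bd_pst_row_same η x y (by omega) (by omega) haL hn le_rfl]
    by_cases hj0 : j = 0
    · subst hj0; simpa using h2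
    · have := hb.2 (by omega)
      simp only at this
      rw [this]; simp [hj0]
  · have hsub : ((Finset.range (a - n + 1)).filter fun m : ℕ =>
        m ≠ 0 ∧ bd (pst η (x, y) a j n) (x + (n : ZMod L) + (m : ZMod L), y + (j : ZMod L)) ≠ 0)
        ⊆ (((Finset.Ico 1 (1 + a)).filter fun i : ℕ =>
          bd η (x + (i : ZMod L), y + (j : ZMod L)) ≠ 0).image fun i => i - n) ∪ {a - n} := by
      intro m hm
      simp only [Finset.mem_filter, Finset.mem_range] at hm
      have e : x + (n : ZMod L) + (m : ZMod L) = x + ((n + m : ℕ) : ZMod L) := by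
        push_cast; ring
      rw [e, bd_pst_row_same η x y (by omega) (by omega) haL (by omega) (by omega)] at hm
      simp only [Finset.mem_union, Finset.mem_image, Finset.mem_filter, Finset.mem_Ico,
        Finset.mem_singleton]
      by_cases hmn : m = a - n
      · exact Or.inr hmn
      left
      refine ⟨n + m, ⟨⟨by omega, by omega⟩, ?_⟩, by omega⟩
      have := hm.2.2
      rw [if_neg (by omega)] at this
      simpa using this
    refine (Finset.card_le_card hsub).trans ((Finset.card_union_le _ _).trans ?_)
    exact Nat.add_le_add (Finset.card_image_le.trans (h.card_row_le hκ _ 1)) (by simp)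

/-- For a fixed edge and row offset, few bad steps use the edge. -/
lemma card_bad_le {κ : ℕ} (hκ : 1 ≤ κ) (ω : Cfg L) (u v : ZMod L) (j : ℕ)
    (B : Finset (ℕ × ℕ))
    (hB : ∀ t ∈ B, ∃ η z, Step κ η z t.1 j t.2 ∧ Bad η z t.1 j ∧ pst η z t.1 j t.2 = ω ∧
      z.1 + (t.2 : ZMod L) = u ∧ z.2 + (j : ZMod L) = v) :
    B.card ≤ (κ + 3) ^ 2 := by
  have h1 : (B.image fun t => t.2).card ≤ κ + 3 := by
    have : (B.image fun t => t.2) ⊆ insert 0 ((B.image fun t => t.2).filter fun n => n ≠ 0) := by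
      intro n hn
      by_cases h0 : n = 0
      · simp [h0]
      · exact Finset.mem_insert_of_mem (Finset.mem_filter.2 ⟨hn, h0⟩)
    refine (Finset.card_le_card this).trans ((Finset.card_insert_le _ _).trans
      (Nat.add_le_add_right (card_initial_le _
      (fun m : ℕ => bd ω (u - (m : ZMod L), v + 1) ≠ 0) (κ + 2) ?_ ?_) 1))
    all_goals
      intro n hn
      obtain ⟨hn, hn0⟩ := Finset.mem_filter.1 hn
      obtain ⟨t, ht, rfl⟩ := Finset.mem_image.1 hn
      obtain ⟨η, z, hs, hb, e1, e2, e3⟩ := hB t ht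
    · exact (hs.up hκ hb e1 e2 e3).1 hn0
    · convert (hs.up hκ hb e1 e2 e3).2
  have h2 : (B.image fun t => t.1 - t.2).card ≤ κ + 1 := by
    refine card_initial_le _ (fun m : ℕ => m ≠ 0 ∧ bd ω (u + (m : ZMod L), v) ≠ 0) (κ + 1) ?_ ?_
    all_goals
      intro n hn
      obtain ⟨t, ht, rfl⟩ := Finset.mem_image.1 hn
      obtain ⟨η, z, hs, hb, e1, e2, e3⟩ := hB t ht
    · exact ⟨by have := hs.n_lt; omega, (hs.right hκ hb e1 e2 e3).1⟩
    · convert (hs.right hκ hb e1 e2 e3).2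
  calc B.card ≤ ((B.image fun t => t.2) ×ˢ (B.image fun t => t.1 - t.2)).card := by
        refine Finset.card_le_card_of_injOn (fun t => (t.2, t.1 - t.2)) (fun t ht => ?_) ?_
        · exact Finset.mem_coe.2 (Finset.mem_product.2
            ⟨Finset.mem_image_of_mem _ ht, Finset.mem_image_of_mem _ ht⟩)
        · intro t ht t' ht' h
          obtain ⟨_, _, hs, _⟩ := hB t ht
          obtain ⟨_, _, hs', _⟩ := hB t' ht'
          have h1 := hs.n_lt
          have h2 := hs'.n_lt
          simp only [Prod.mk.injEq] at h
          exact Prod.ext (by omega) h.1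
    _ ≤ (κ + 3) * (κ + 1) := by
        rw [Finset.card_product]; exact Nat.mul_le_mul h1 h2
    _ ≤ _ := by nlinarith

/-- The change of variables from (start, corner) to (current configuration, current site). -/
def pstEquiv (a j n : ℕ) : Cfg L × Tor L ≃ Cfg L × Tor L where
  toFun t := (pst t.1 t.2 a j n, (t.2.1 + (n : ZMod L), t.2.2 + (j : ZMod L)))
  invFun t := (pst t.1 (t.2.1 - (n : ZMod L), t.2.2 - (j : ZMod L)) a j n,
    (t.2.1 - (n : ZMod L), t.2.2 - (j : ZMod L)))
  left_inv t := by
    have h2 := cfg_two (L := L)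
    ext1
    · simp only [add_sub_cancel_right, pst]; grind
    · simp
  right_inv t := by
    have h2 := cfg_two (L := L)
    ext1
    · simp only [pst]; grind
    · simp

lemma Step.wt_le {β : ℝ} (hβ : 0 ≤ β) {κ : ℕ} {η : Cfg L} {z : Tor L} {a j n : ℕ}
    (h : Step κ η z a j n) :
    wt β η ≤ (1 + if Bad η z a j then Real.exp (2 * β) else 0) *
      (spm L β).q (pst η z a j n) (z.1 + (n : ZMod L), z.2 + (j : ZMod L)) := by
  obtain ⟨ha, haL, hj, h2⟩ := h.facts
  obtain ⟨x, y⟩ := z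
  have e : (spm L β).q (pst η (x, y) a j n) (x + (n : ZMod L), y + (j : ZMod L))
      = Real.exp (-β * (max (Nd (pst η (x, y) a j n)) (Nd (pst η (x, y) a j (n + 1))) : ℕ)) := by
    rw [pst_succ]; rfl
  simp only
  rw [e, wt]
  split_ifs with hb
  · have hm : max (Nd (pst η (x, y) a j n)) (Nd (pst η (x, y) a j (n + 1))) ≤ Nd η + 2 :=
      max_le (Nd_pst_le ha haL h.adm.defect h2 j n) (Nd_pst_le ha haL h.adm.defect h2 j (n + 1))
    have hm' : ((max (Nd (pst η (x, y) a j n)) (Nd (pst η (x, y) a j (n + 1))) : ℕ) : ℝ)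
      ≤ Nd η + 2 := by exact_mod_cast hm
    calc Real.exp (-β * Nd η) ≤ Real.exp (2 * β) * Real.exp (-β *
          (max (Nd (pst η (x, y) a j n)) (Nd (pst η (x, y) a j (n + 1))) : ℕ)) := by
          rw [← Real.exp_add]; apply Real.exp_le_exp.2; nlinarith
      _ ≤ _ := by
          rw [add_mul, one_mul]
          linarith [Real.exp_pos (-β *
            (max (Nd (pst η (x, y) a j n)) (Nd (pst η (x, y) a j (n + 1))) : ℕ))]
  · have hg : bd η (x, y + (j : ZMod L) + 1) ≠ 0 ∨
      (1 ≤ j ∧ bd η (x + (a : ZMod L), y + (j : ZMod L)) ≠ 0) := by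
      simp only [Bad] at hb
      tauto
    have hm : max (Nd (pst η (x, y) a j n)) (Nd (pst η (x, y) a j (n + 1))) ≤ Nd η :=
      max_le (Nd_pst_le_of_good ha haL h.adm.defect h2 hj n hg)
        (Nd_pst_le_of_good ha haL h.adm.defect h2 hj (n + 1) hg)
    have hm' : ((max (Nd (pst η (x, y) a j n)) (Nd (pst η (x, y) a j (n + 1))) : ℕ) : ℝ)
      ≤ Nd η := by exact_mod_cast hm
    rw [add_zero, one_mul]
    apply Real.exp_le_exp.2; nlinarith

end Congestion

section Hardy

variable {L : ℕ} [NeZero L]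

/-- The rectangle spanned by a defect and its two neighbouring defects. -/
def drect (η : Cfg L) (z : Tor L) : Cfg L := rect z.1 z.2 (gapX (bd η) z) (gapY (bd η) z)

lemma path_term_le {β M : ℝ} {κ : ℕ} (hM : 0 ≤ M) (θ : Cfg L → Tor L → ℝ)
    (hθ0 : ∀ η z, 0 ≤ θ η z)
    (hθ : ∀ η z, θ η z ≠ 0 → Adm κ η z ∧ θ η z * gapX (bd η) z ≤ M) (f : Cfg L → ℝ)
    (η : Cfg L) (z : Tor L) :
    wt β η * θ η z * (f η - f (η + drect η z)) ^ 2 ≤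
      M * L * ∑ a ∈ Finset.range L, ∑ j ∈ Finset.range L, ∑ n ∈ Finset.range L,
        if Step κ η z a j n then wt β η * (f (pst η z a j (n + 1)) - f (pst η z a j n)) ^ 2
        else 0 := by
  have hw : 0 < wt β η := Real.exp_pos _
  have hnn : ∀ a j n, 0 ≤ (if Step κ η z a j n then
      wt β η * (f (pst η z a j (n + 1)) - f (pst η z a j n)) ^ 2 else 0) := by
    intro a j n; split_ifs <;> positivity
  by_cases h0 : θ η z = 0
  · rw [h0, mul_zero, zero_mul]
    exact mul_nonneg (by positivity) (Finset.sum_nonneg fun a _ => Finset.sum_nonneg fun j _ =>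
      Finset.sum_nonneg fun n _ => hnn a j n)
  obtain ⟨hadm, hle⟩ := hθ η z h0
  have ha := gapX_spec hadm.defect
  have hb := gapY_spec hadm.defect
  set a := gapX (bd η) z with hadef
  set b := gapY (bd η) z with hbdef
  have h1 := path_sq_le f η z a b
  have h2 : ∑ j ∈ Finset.range b, ∑ n ∈ Finset.range a,
      wt β η * (f (pst η z a j n) - f (pst η z a j (n + 1))) ^ 2 ≤
      ∑ a ∈ Finset.range L, ∑ j ∈ Finset.range L, ∑ n ∈ Finset.range L,
        if Step κ η z a j n then wt β η * (f (pst η z a j (n + 1)) - f (pst η z a j n)) ^ 2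
        else 0 := by
    refine le_trans ?_ (Finset.single_le_sum (f := fun a => ∑ j ∈ Finset.range L,
      ∑ n ∈ Finset.range L, if Step κ η z a j n then
        wt β η * (f (pst η z a j (n + 1)) - f (pst η z a j n)) ^ 2 else 0)
      (fun a _ => Finset.sum_nonneg fun j _ => Finset.sum_nonneg fun n _ => hnn a j n)
      (Finset.mem_range.2 ha.2.1))
    refine le_trans ?_ (Finset.sum_le_sum_of_subset_of_nonneg
      (Finset.range_subset_range.2 hb.2.1.le)
      (fun j _ _ => Finset.sum_nonneg fun n _ => hnn a j n))
    refine Finset.sum_le_sum fun j hj => ?_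
    refine le_trans ?_ (Finset.sum_le_sum_of_subset_of_nonneg
      (Finset.range_subset_range.2 ha.2.1.le) (fun n _ _ => hnn a j n))
    refine Finset.sum_le_sum fun n hn => ?_
    rw [if_pos ⟨hadm, rfl, Finset.mem_range.1 hn, Finset.mem_range.1 hj⟩]
    exact le_of_eq (by ring)
  simp only [← Finset.mul_sum] at h2
  set S := ∑ j ∈ Finset.range b, ∑ n ∈ Finset.range a,
      (f (pst η z a j n) - f (pst η z a j (n + 1))) ^ 2 with hS
  have hS0 : 0 ≤ S := Finset.sum_nonneg fun j _ => Finset.sum_nonneg fun n _ => sq_nonneg _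
  have hbL : (b : ℝ) ≤ L := by exact_mod_cast hb.2.1.le
  calc wt β η * θ η z * (f η - f (η + drect η z)) ^ 2
      ≤ wt β η * θ η z * (a * b * S) :=
        mul_le_mul_of_nonneg_left h1 (mul_nonneg hw.le (hθ0 η z))
    _ = (θ η z * a) * b * (wt β η * S) := by ring
    _ ≤ M * L * (wt β η * S) := by
        refine mul_le_mul_of_nonneg_right (mul_le_mul hle hbL (by positivity) hM) (by positivity)
    _ ≤ _ := mul_le_mul_of_nonneg_left h2 (by positivity)

lemma congestion_le {β : ℝ} (hβ : 0 ≤ β) {κ : ℕ} (hκ : 1 ≤ κ) (f : Cfg L → ℝ) (t : Cfg L × Tor L) :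
    (∑ a ∈ Finset.range L, ∑ j ∈ Finset.range L, ∑ n ∈ Finset.range L,
      if Step κ ((pstEquiv a j n).symm t).1 ((pstEquiv a j n).symm t).2 a j n then
        wt β ((pstEquiv a j n).symm t).1 *
          (f (pst ((pstEquiv a j n).symm t).1 ((pstEquiv a j n).symm t).2 a j (n + 1)) -
           f (pst ((pstEquiv a j n).symm t).1 ((pstEquiv a j n).symm t).2 a j n)) ^ 2
      else 0) ≤ ((L : ℝ) ^ 3 + L * (κ + 3) ^ 2 * Real.exp (2 * β)) *
        ((spm L β).q t.1 t.2 * (f (t.1 + dl t.2) - f t.1) ^ 2) := by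
  set Y := (spm L β).q t.1 t.2 * (f (t.1 + dl t.2) - f t.1) ^ 2 with hY
  have hY0 : 0 ≤ Y := mul_nonneg ((spm L β).q_nonneg _ _) (sq_nonneg _)
  set P : ℕ → ℕ → ℕ → Prop := fun a j n =>
    Step κ ((pstEquiv a j n).symm t).1 ((pstEquiv a j n).symm t).2 a j n ∧
    Bad ((pstEquiv a j n).symm t).1 ((pstEquiv a j n).symm t).2 a j with hP
  have hfix : ∀ a j n, pst ((pstEquiv a j n).symm t).1 ((pstEquiv a j n).symm t).2 a j n = t.1 ∧
      (((pstEquiv a j n).symm t).2.1 + (n : ZMod L), ((pstEquiv a j n).symm t).2.2 + (j : ZMod L))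
        = t.2 := by
    intro a j n
    have := (pstEquiv a j n).apply_symm_apply t
    exact ⟨congrArg Prod.fst this, congrArg Prod.snd this⟩
  have hterm : ∀ a j n, (if Step κ ((pstEquiv a j n).symm t).1 ((pstEquiv a j n).symm t).2 a j n then
        wt β ((pstEquiv a j n).symm t).1 *
          (f (pst ((pstEquiv a j n).symm t).1 ((pstEquiv a j n).symm t).2 a j (n + 1)) -
           f (pst ((pstEquiv a j n).symm t).1 ((pstEquiv a j n).symm t).2 a j n)) ^ 2
      else 0) ≤ (1 + Real.exp (2 * β) * if P a j n then 1 else 0) * Y := by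
    intro a j n
    split_ifs with h1 h2 h2
    · have := h1.wt_le hβ
      rw [if_pos h2.2, (hfix a j n).1, (hfix a j n).2] at this
      rw [pst_succ, (hfix a j n).1, (hfix a j n).2, hY, ← mul_assoc, mul_one]
      exact mul_le_mul_of_nonneg_right this (sq_nonneg _)
    · have := h1.wt_le hβ
      rw [if_neg (fun h => h2 ⟨h1, h⟩), (hfix a j n).1, (hfix a j n).2] at this
      rw [pst_succ, (hfix a j n).1, (hfix a j n).2, hY, ← mul_assoc, mul_zero]
      exact mul_le_mul_of_nonneg_right this (sq_nonneg _)
    · exact absurd h2.1 h1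
    · simpa using hY0
  have hcount : ∀ j, ∑ a ∈ Finset.range L, ∑ n ∈ Finset.range L, (if P a j n then (1 : ℝ) else 0)
      ≤ (κ + 3) ^ 2 := by
    intro j
    rw [← Finset.sum_product' (Finset.range L) (Finset.range L)
      (fun a n => if P a j n then (1 : ℝ) else 0), Finset.sum_boole]
    have := card_bad_le hκ t.1 t.2.1 t.2.2 j
      ((Finset.range L ×ˢ Finset.range L).filter fun x => P x.1 j x.2) (by
        intro x hx
        have hx2 := (Finset.mem_filter.1 hx).2
        have hf := hfix x.1 j x.2
        exact ⟨_, _, hx2.1, hx2.2, hf.1, congrArg Prod.fst hf.2, congrArg Prod.snd hf.2⟩)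
    exact_mod_cast this
  calc _ ≤ ∑ a ∈ Finset.range L, ∑ j ∈ Finset.range L, ∑ n ∈ Finset.range L,
        (1 + Real.exp (2 * β) * if P a j n then 1 else 0) * Y :=
        Finset.sum_le_sum fun a _ => Finset.sum_le_sum fun j _ => Finset.sum_le_sum fun n _ =>
          hterm a j n
    _ = ((L : ℝ) ^ 3 + Real.exp (2 * β) * ∑ j ∈ Finset.range L, ∑ a ∈ Finset.range L,
          ∑ n ∈ Finset.range L, (if P a j n then (1 : ℝ) else 0)) * Y := by
        simp only [← Finset.sum_mul, Finset.sum_add_distrib, ← Finset.mul_sum]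
        rw [Finset.sum_comm (s := Finset.range L) (t := Finset.range L)
          (f := fun a j => ∑ n ∈ Finset.range L, (if P a j n then (1 : ℝ) else 0))]
        simp only [Finset.sum_const, Finset.card_range, nsmul_eq_mul, mul_one]
        ring
    _ ≤ _ := by
        refine mul_le_mul_of_nonneg_right ?_ hY0
        have := Finset.sum_le_sum fun j (_ : j ∈ Finset.range L) => hcount j
        rw [Finset.sum_const, Finset.card_range, nsmul_eq_mul] at this
        have h3 := mul_le_mul_of_nonneg_left this (Real.exp_nonneg (2 * β))
        linarith

/-- Canonical path comparison. -/
lemma path_bound {β M : ℝ} (hβ : 0 ≤ β) {κ : ℕ} (hκ : 1 ≤ κ) (hM : 0 ≤ M)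
    (θ : Cfg L → Tor L → ℝ) (hθ0 : ∀ η z, 0 ≤ θ η z)
    (hθ : ∀ η z, θ η z ≠ 0 → Adm κ η z ∧ θ η z * gapX (bd η) z ≤ M) (f : Cfg L → ℝ) :
    ∑ η, ∑ z, wt β η * θ η z * (f η - f (η + drect η z)) ^ 2 ≤
      M * L * ((L : ℝ) ^ 3 + L * (κ + 3) ^ 2 * Real.exp (2 * β)) * (2 * (spm L β).dir f) := by
  have hdir : 2 * (spm L β).dir f
      = ∑ t : Cfg L × Tor L, (spm L β).q t.1 t.2 * (f (t.1 + dl t.2) - f t.1) ^ 2 := by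
    rw [RevChain.dir, mul_div_cancel₀ _ two_ne_zero, Fintype.sum_prod_type]
    rfl
  rw [← Fintype.sum_prod_type'
    (f := fun η z => wt β η * θ η z * (f η - f (η + drect η z)) ^ 2)]
  calc _ ≤ ∑ t : Cfg L × Tor L, M * L * ∑ a ∈ Finset.range L, ∑ j ∈ Finset.range L,
        ∑ n ∈ Finset.range L, (if Step κ t.1 t.2 a j n then
          wt β t.1 * (f (pst t.1 t.2 a j (n + 1)) - f (pst t.1 t.2 a j n)) ^ 2 else 0) :=
        Finset.sum_le_sum fun t _ => path_term_le hM θ hθ0 hθ f t.1 t.2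
    _ = M * L * ∑ t : Cfg L × Tor L, ∑ a ∈ Finset.range L, ∑ j ∈ Finset.range L,
        ∑ n ∈ Finset.range L, (if Step κ ((pstEquiv a j n).symm t).1 ((pstEquiv a j n).symm t).2 a j n
          then wt β ((pstEquiv a j n).symm t).1 *
          (f (pst ((pstEquiv a j n).symm t).1 ((pstEquiv a j n).symm t).2 a j (n + 1)) -
           f (pst ((pstEquiv a j n).symm t).1 ((pstEquiv a j n).symm t).2 a j n)) ^ 2
          else 0) := by
        rw [← Finset.mul_sum]
        congr 1
        rw [Finset.sum_comm, Finset.sum_comm (s := (Finset.univ : Finset (Cfg L × Tor L)))]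
        refine Finset.sum_congr rfl fun a _ => ?_
        rw [Finset.sum_comm, Finset.sum_comm (s := (Finset.univ : Finset (Cfg L × Tor L)))]
        refine Finset.sum_congr rfl fun j _ => ?_
        rw [Finset.sum_comm, Finset.sum_comm (s := (Finset.univ : Finset (Cfg L × Tor L)))]
        refine Finset.sum_congr rfl fun n _ => ?_
        exact (Equiv.sum_comp (pstEquiv a j n).symm (fun t : Cfg L × Tor L =>
          if Step κ t.1 t.2 a j n then
          wt β t.1 * (f (pst t.1 t.2 a j (n + 1)) - f (pst t.1 t.2 a j n)) ^ 2 else 0)).symm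
    _ ≤ M * L * ∑ t : Cfg L × Tor L, ((L : ℝ) ^ 3 + L * (κ + 3) ^ 2 * Real.exp (2 * β)) *
        ((spm L β).q t.1 t.2 * (f (t.1 + dl t.2) - f t.1) ^ 2) :=
        mul_le_mul_of_nonneg_left (Finset.sum_le_sum fun t _ => congestion_le hβ hκ f t)
          (by positivity)
    _ = _ := by rw [← Finset.mul_sum, ← hdir]; ring

lemma Nd_add_rect {ζ : Cfg L} {x y : ZMod L} {a b : ℕ} (ha : 1 ≤ a) (haL : a < L) (hb : 1 ≤ b)
    (hbL : b < L) (h1 : bd (ζ + rect x y a b) (x, y) ≠ 0)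
    (h2 : bd (ζ + rect x y a b) (x + (a : ZMod L), y) ≠ 0)
    (h3 : bd (ζ + rect x y a b) (x, y + (b : ZMod L)) ≠ 0) :
    Nd ζ + 2 ≤ Nd (ζ + rect x y a b) ∧
      (bd ζ (x + (a : ZMod L), y + (b : ZMod L)) = 0 → Nd ζ + 4 ≤ Nd (ζ + rect x y a b)) := by
  have htwo := cfg_two (L := L)
  have na : x + (a : ZMod L) ≠ x := by simpa using cast_ne_zero_of_lt (by omega) haL
  have nb : y + (b : ZMod L) ≠ y := by simpa using cast_ne_zero_of_lt (by omega) hbL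
  have hbd : bd ζ = bd (ζ + rect x y a b) + dl (x, y) + dl (x + (a : ZMod L), y)
      + dl (x, y + (b : ZMod L)) + dl (x + (a : ZMod L), y + (b : ZMod L)) := by
    rw [map_add, bd_rect]; grind
  have e1 := cnt_add_dl_of_ne h1
  have e2 := cnt_add_dl_of_ne (D := bd (ζ + rect x y a b) + dl (x, y)) (p := (x + (a : ZMod L), y))
    (by simpa [dl_apply, na] using h2)
  have e3 := cnt_add_dl_of_ne (D := bd (ζ + rect x y a b) + dl (x, y) + dl (x + (a : ZMod L), y))
    (p := (x, y + (b : ZMod L))) (by simpa [dl_apply, nb] using h3)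
  unfold Nd
  rw [hbd]
  constructor
  · have := cnt_add_dl_le (bd (ζ + rect x y a b) + dl (x, y) + dl (x + (a : ZMod L), y)
      + dl (x, y + (b : ZMod L))) (x + (a : ZMod L), y + (b : ZMod L))
    omega
  · intro h0
    have := cnt_add_dl_of_ne (D := bd (ζ + rect x y a b) + dl (x, y) + dl (x + (a : ZMod L), y)
      + dl (x, y + (b : ZMod L))) (p := (x + (a : ZMod L), y + (b : ZMod L))) (by
        rw [Pi.add_apply, dl_self] at h0
        intro h; rw [h] at h0; simp at h0)
    omega

end Hardy

section Children

variable {L : ℕ} [NeZero L]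

/-- The total weight of the configurations whose rectangle flip is a given one. -/
lemma children_bound {β M : ℝ} (hβ : 0 ≤ β) (hM : 0 ≤ M) (θ : Cfg L → Tor L → ℝ)
    (hθ : ∀ η z, θ η z ≤ if bd η z ≠ 0 then M else 0) (g : Cfg L → ℝ)
    (hg : ∀ η, 0 ≤ g η) :
    ∑ η, ∑ z, wt β η * θ η z * g (η + drect η z) ≤
      M * ∑ ζ, wt β ζ * g ζ *
        (Nd ζ * (L : ℝ) ^ 2 * Real.exp (-(2 * β)) + (L : ℝ) ^ 4 * Real.exp (-(4 * β))) := by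
  set V : Cfg L → Tor L → ℕ → ℕ → Prop := fun η z a b =>
    bd η z ≠ 0 ∧ gapX (bd η) z = a ∧ gapY (bd η) z = b with hV
  have hwp : ∀ η : Cfg L, 0 < wt β η := fun η => Real.exp_pos _
  have h1 : ∀ η z, wt β η * θ η z * g (η + drect η z) ≤ M * ∑ a ∈ Finset.range L,
      ∑ b ∈ Finset.range L, if V η z a b then wt β η * g (η + rect z.1 z.2 a b) else 0 := by
    intro η z
    have hnn : ∀ a b, 0 ≤ if V η z a b then wt β η * g (η + rect z.1 z.2 a b) else 0 := by
      intro a b; split_ifs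
      · exact mul_nonneg (hwp η).le (hg _)
      · exact le_rfl
    have hsum0 : 0 ≤ ∑ a ∈ Finset.range L,
      ∑ b ∈ Finset.range L, if V η z a b then wt β η * g (η + rect z.1 z.2 a b) else 0 :=
      Finset.sum_nonneg fun a _ => Finset.sum_nonneg fun b _ => hnn a b
    have hθz := hθ η z
    by_cases hz : bd η z ≠ 0
    · rw [if_pos hz] at hθz
      have ha := gapX_spec hz
      have hb := gapY_spec hz
      calc wt β η * θ η z * g (η + drect η z) = θ η z * (wt β η * g (η + drect η z)) := by ring
        _ ≤ M * (wt β η * g (η + drect η z)) :=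
          mul_le_mul_of_nonneg_right hθz (mul_nonneg (hwp η).le (hg _))
        _ ≤ _ := by
          refine mul_le_mul_of_nonneg_left ?_ hM
          refine le_trans ?_ (Finset.single_le_sum (fun a _ => Finset.sum_nonneg fun b _ => hnn a b)
            (Finset.mem_range.2 ha.2.1))
          refine le_trans ?_ (Finset.single_le_sum (fun b _ => hnn _ b)
            (Finset.mem_range.2 hb.2.1))
          rw [if_pos ⟨hz, rfl, rfl⟩]; rfl
    · rw [if_neg hz] at hθz
      refine le_trans ?_ (mul_nonneg hM hsum0)
      have := mul_nonneg (hwp η).le (hg (η + drect η z))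
      nlinarith
  have h2 : ∀ (ζ : Cfg L) (z : Tor L) a b, (if V (ζ + rect z.1 z.2 a b) z a b then
      wt β (ζ + rect z.1 z.2 a b) * g ζ else 0) ≤ wt β ζ * g ζ *
        ((if bd ζ (z.1 + (a : ZMod L), z.2 + (b : ZMod L)) ≠ 0 then 1 else 0)
          * Real.exp (-(2 * β)) + Real.exp (-(4 * β))) := by
    intro ζ z a b
    have hp2 := Real.exp_pos (-(2 * β))
    have hp4 := Real.exp_pos (-(4 * β))
    have hwg := mul_nonneg (hwp ζ).le (hg ζ)
    have hkey : V (ζ + rect z.1 z.2 a b) z a b → _ := fun hv => by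
      obtain ⟨hz, ea, eb⟩ := hv
      have ga := gapX_spec hz
      have gb := gapY_spec hz
      rw [ea] at ga
      rw [eb] at gb
      exact Nd_add_rect ga.1 ga.2.1 gb.1 gb.2.1 hz ga.2.2 gb.2.2
    split_ifs with hv hc hc
    · have hN := (hkey hv).1
      have : wt β (ζ + rect z.1 z.2 a b) ≤ wt β ζ * Real.exp (-(2 * β)) := by
        rw [wt, wt, ← Real.exp_add, Real.exp_le_exp]
        have : (Nd ζ : ℝ) + 2 ≤ Nd (ζ + rect z.1 z.2 a b) := by exact_mod_cast hN
        nlinarith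
      have := mul_le_mul_of_nonneg_right this (hg ζ)
      nlinarith
    · have hN := (hkey hv).2 (by simpa using hc)
      have : wt β (ζ + rect z.1 z.2 a b) ≤ wt β ζ * Real.exp (-(4 * β)) := by
        rw [wt, wt, ← Real.exp_add, Real.exp_le_exp]
        have : (Nd ζ : ℝ) + 4 ≤ Nd (ζ + rect z.1 z.2 a b) := by exact_mod_cast hN
        nlinarith
      have := mul_le_mul_of_nonneg_right this (hg ζ)
      nlinarith
    · positivity
    · positivity
  have hrr : ∀ (ζ : Cfg L) (z : Tor L) a b,
      ζ + rect z.1 z.2 a b + rect z.1 z.2 a b = ζ := by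
    intro ζ z a b
    have := cfg_two (L := L)
    grind
  have hsw : ∀ (z : Tor L) a b, (∑ η, if V η z a b then wt β η * g (η + rect z.1 z.2 a b) else 0)
      = ∑ ζ, if V (ζ + rect z.1 z.2 a b) z a b then wt β (ζ + rect z.1 z.2 a b) * g ζ else 0 := by
    intro z a b
    rw [← Equiv.sum_comp (Equiv.addRight (rect z.1 z.2 a b))]
    refine Finset.sum_congr rfl fun ζ _ => ?_
    simp only [Equiv.coe_addRight, hrr]
  have hcn : ∀ (ζ : Cfg L) (a b : ℕ),
      ∑ z : Tor L, (if bd ζ (z.1 + (a : ZMod L), z.2 + (b : ZMod L)) ≠ 0 then (1 : ℝ) else 0)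
        = Nd ζ := by
    intro ζ a b
    have := Equiv.sum_comp (Equiv.addRight ((a : ZMod L), (b : ZMod L)) : Tor L ≃ Tor L)
      (fun z => if bd ζ z ≠ 0 then (1 : ℝ) else 0)
    rw [Nd, cnt, Finset.card_filter]
    push_cast
    rw [← this]
    rfl
  calc ∑ η, ∑ z, wt β η * θ η z * g (η + drect η z)
      ≤ ∑ η, ∑ z, M * ∑ a ∈ Finset.range L, ∑ b ∈ Finset.range L,
          if V η z a b then wt β η * g (η + rect z.1 z.2 a b) else 0 :=
        Finset.sum_le_sum fun η _ => Finset.sum_le_sum fun z _ => h1 η z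
    _ = M * ∑ a ∈ Finset.range L, ∑ b ∈ Finset.range L, ∑ z, ∑ η,
          if V η z a b then wt β η * g (η + rect z.1 z.2 a b) else 0 := by
        simp only [← Finset.mul_sum]
        congr 1
        rw [Finset.sum_comm]
        rw [Finset.sum_congr rfl fun z _ => Finset.sum_comm.trans
          (Finset.sum_congr rfl fun a _ => Finset.sum_comm), Finset.sum_comm]
        exact Finset.sum_congr rfl fun a _ => Finset.sum_comm
    _ ≤ M * ∑ a ∈ Finset.range L, ∑ b ∈ Finset.range L, ∑ z : Tor L, ∑ ζ, wt β ζ * g ζ *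
        ((if bd ζ (z.1 + (a : ZMod L), z.2 + (b : ZMod L)) ≠ 0 then 1 else 0)
          * Real.exp (-(2 * β)) + Real.exp (-(4 * β))) := by
        refine mul_le_mul_of_nonneg_left ?_ hM
        refine Finset.sum_le_sum fun a _ => Finset.sum_le_sum fun b _ =>
          Finset.sum_le_sum fun z _ => ?_
        rw [hsw]
        exact Finset.sum_le_sum fun ζ _ => h2 ζ z a b
    _ = M * ∑ a ∈ Finset.range L, ∑ b ∈ Finset.range L, ∑ ζ, wt β ζ * g ζ *
        (Nd ζ * Real.exp (-(2 * β)) + (L : ℝ) ^ 2 * Real.exp (-(4 * β))) := by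
        congr 1
        refine Finset.sum_congr rfl fun a _ => Finset.sum_congr rfl fun b _ => ?_
        rw [Finset.sum_comm]
        refine Finset.sum_congr rfl fun ζ _ => ?_
        rw [← Finset.mul_sum, Finset.sum_add_distrib, ← Finset.sum_mul, hcn]
        simp [ZMod.card, sq]
    _ = _ := by
        rw [Finset.sum_const, Finset.sum_const, Finset.card_range, smul_smul, nsmul_eq_mul,
          Finset.mul_sum]
        congr 1
        refine Finset.sum_congr rfl fun ζ _ => ?_
        push_cast
        ring

end Children

section HardyInequality

variable {L : ℕ} [NeZero L]

lemma Nd_pos {η : Cfg L} {z : Tor L} (h : bd η z ≠ 0) : 1 ≤ Nd η :=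
  Finset.card_pos.2 ⟨z, by simpa using h⟩

/-- A defect with the smallest gap, when that gap is short compared with the density. -/
def ShortGap (K : ℕ) (η : Cfg L) (z : Tor L) : Prop :=
  Adm 1 η z ∧ Nd η * gapX (bd η) z * K ≤ L ^ 2

/-- The weights of the corners of configurations having a short gap. -/
def shortWeight (K : ℕ) (η : Cfg L) (z : Tor L) : ℝ :=
  if h : ∃ z, ShortGap K η z then (if z = h.choose then (Nd η : ℝ) else 0) else 0

/-- The weights of the corners of configurations having only comparable gaps. -/
def longWeight (K : ℕ) (η : Cfg L) (z : Tor L) : ℝ :=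
  if (¬ ∃ z, ShortGap K η z) ∧ bd η z ≠ 0 ∧ gapX (bd η) z * Nd η ≤ 2 * L ^ 2 then 2 else 0

lemma shortWeight_nonneg (K : ℕ) (η : Cfg L) (z : Tor L) : 0 ≤ shortWeight K η z := by
  unfold shortWeight; split_ifs <;> positivity

lemma longWeight_nonneg (K : ℕ) (η : Cfg L) (z : Tor L) : 0 ≤ longWeight K η z := by
  unfold longWeight; split_ifs <;> positivity

lemma shortWeight_spec {K : ℕ} {η : Cfg L} {z : Tor L} (h : shortWeight K η z ≠ 0) :
    shortWeight K η z = Nd η ∧ ShortGap K η z := by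
  unfold shortWeight at *
  split_ifs at * with h1 h2
  · subst h2; exact ⟨rfl, h1.choose_spec⟩
  · simp at h
  · simp at h

lemma longWeight_adm {K : ℕ} {η : Cfg L} {z : Tor L} (h : longWeight K η z ≠ 0) :
    longWeight K η z = 2 ∧ Adm (2 * K) η z ∧ ¬ ∃ z, ShortGap K η z := by
  unfold longWeight at *
  split_ifs at * with h1
  swap
  · simp at h
  obtain ⟨h1, h2, h3⟩ := h1
  refine ⟨rfl, ⟨h2, fun z' hz' => ?_⟩, h1⟩
  obtain ⟨m, hm, hmin⟩ := Finset.exists_min_image (Finset.univ.filter fun z => bd η z ≠ 0)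
    (gapX (bd η)) ⟨z, by simpa using h2⟩
  simp only [Finset.mem_filter, Finset.mem_univ, true_and] at hm hmin
  have h4 : ¬ (Nd η * gapX (bd η) m * K ≤ L ^ 2) := fun hc =>
    h1 ⟨m, ⟨hm, fun z hz => by simpa using hmin z hz⟩, hc⟩
  have h5 := hmin z' hz'
  have hN := Nd_pos h2
  have h6 : gapX (bd η) z * Nd η ≤ (2 * K * gapX (bd η) m) * Nd η := by nlinarith
  have h7 := Nat.le_of_mul_le_mul_right h6 hN
  exact h7.trans (Nat.mul_le_mul_left _ h5)

lemma Nd_le_sum_longWeight {K : ℕ} {η : Cfg L} (h : ¬ ∃ z, ShortGap K η z) :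
    (Nd η : ℝ) ≤ ∑ z, longWeight K η z := by
  set A := Finset.univ.filter fun z => bd η z ≠ 0
  set B := A.filter fun z => gapX (bd η) z * Nd η ≤ 2 * L ^ 2 with hB
  set B' := A.filter fun z => ¬ gapX (bd η) z * Nd η ≤ 2 * L ^ 2
  have hA : Nd η = A.card := rfl
  have hs : B.card + B'.card = A.card := Finset.card_filter_add_card_filter_not _
  have hL : 0 < L ^ 2 := pow_pos (NeZero.pos L) 2
  have hB' : B'.card * (2 * L ^ 2) ≤ Nd η * L ^ 2 := by
    calc B'.card * (2 * L ^ 2) = ∑ z ∈ B', 2 * L ^ 2 := by simp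
      _ ≤ ∑ z ∈ B', gapX (bd η) z * Nd η := Finset.sum_le_sum fun z hz =>
        (not_le.1 (Finset.mem_filter.1 hz).2).le
      _ ≤ ∑ z ∈ A, gapX (bd η) z * Nd η := Finset.sum_le_sum_of_subset (Finset.filter_subset _ _)
      _ = Nd η * ∑ z ∈ A, gapX (bd η) z := by rw [← Finset.sum_mul, mul_comm]
      _ ≤ _ := Nat.mul_le_mul_left _ (sum_gapX_le η)
  have h1 : 2 * B'.card ≤ Nd η := by
    refine Nat.le_of_mul_le_mul_right (c := L ^ 2) ?_ hL
    linarith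
  have h2 : ∑ z, longWeight K η z = 2 * B.card := by
    unfold longWeight
    rw [← Finset.sum_filter, Finset.sum_const, nsmul_eq_mul, mul_comm]
    congr 3
    rw [hB, Finset.filter_filter]
    exact Finset.filter_congr fun z _ => by simp only [h, not_false_eq_true, true_and]
  rw [h2]
  have : Nd η ≤ 2 * B.card := by omega
  exact_mod_cast this

lemma Nd_le_sum_weight (K : ℕ) (η : Cfg L) :
    (Nd η : ℝ) ≤ ∑ z, (shortWeight K η z + longWeight K η z) := by
  rw [Finset.sum_add_distrib]
  by_cases h : ∃ z, ShortGap K η z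
  · have : ∑ z, shortWeight K η z = Nd η := by
      unfold shortWeight
      simp [h]
    have := Finset.sum_nonneg fun z (_ : z ∈ Finset.univ) => longWeight_nonneg K η z
    linarith
  · have := Nd_le_sum_longWeight h
    have := Finset.sum_nonneg fun z (_ : z ∈ Finset.univ) => shortWeight_nonneg K η z
    linarith

lemma weight_le {K : ℕ} (hK : 1 ≤ K) (hKL : 2 * K ≤ L ^ 2) (η : Cfg L) (z : Tor L) :
    shortWeight K η z + longWeight K η z ≤ if bd η z ≠ 0 then (L : ℝ) ^ 2 / K else 0 := by
  have hK' : (0 : ℝ) < K := by exact_mod_cast hK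
  by_cases h : shortWeight K η z = 0
  · rw [h, zero_add]
    by_cases h' : longWeight K η z = 0
    · rw [h']; split_ifs <;> positivity
    · obtain ⟨e, ha, -⟩ := longWeight_adm h'
      rw [e, if_pos ha.defect, le_div_iff₀ hK']
      exact_mod_cast hKL
  · obtain ⟨e, ha, hle⟩ := shortWeight_spec h
    have h' : longWeight K η z = 0 := by
      by_contra h'
      exact (longWeight_adm h').2.2 ⟨z, ha, hle⟩
    rw [h', add_zero, e, if_pos ha.defect, le_div_iff₀ hK']
    have h1 := (gapX_spec ha.defect).1
    have : Nd η * K ≤ L ^ 2 := by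
      refine le_trans ?_ hle
      calc Nd η * K = Nd η * 1 * K := by ring
        _ ≤ _ := by gcongr
    exact_mod_cast this

/-- The constant in the comparison of rectangle flips with single spin flips. -/
def pathConst (L : ℕ) (β : ℝ) (K : ℕ) : ℝ :=
  (L : ℝ) ^ 2 / K * L * ((L : ℝ) ^ 3 + L * 16 * Real.exp (2 * β)) +
    2 * L * L * ((L : ℝ) ^ 3 + L * (2 * K + 3) ^ 2 * Real.exp (2 * β))

lemma sum_weight_sq_sub_le {β : ℝ} (hβ : 0 ≤ β) {K : ℕ} (hK : 1 ≤ K) (f : Cfg L → ℝ) :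
    ∑ η, ∑ z, wt β η * (shortWeight K η z + longWeight K η z) * (f η - f (η + drect η z)) ^ 2 ≤
      pathConst L β K * (2 * (spm L β).dir f) := by
  have hK' : (0 : ℝ) < K := by exact_mod_cast hK
  have h1 := path_bound hβ (κ := 1) le_rfl (M := (L : ℝ) ^ 2 / K) (by positivity)
    (shortWeight K) (shortWeight_nonneg K) (fun η z hz => by
      obtain ⟨e, ha, hle⟩ := shortWeight_spec hz
      refine ⟨ha, ?_⟩
      rw [e, le_div_iff₀ hK']
      exact_mod_cast hle) f
  have h2 := path_bound hβ (κ := 2 * K) (by omega) (M := 2 * L) (by positivity)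
    (longWeight K) (longWeight_nonneg K) (fun η z hz => by
      obtain ⟨e, ha, -⟩ := longWeight_adm hz
      refine ⟨ha, ?_⟩
      rw [e]
      have := (gapX_spec ha.defect).2.1.le
      gcongr) f
  calc _ = ∑ η, ∑ z, wt β η * shortWeight K η z * (f η - f (η + drect η z)) ^ 2
        + ∑ η, ∑ z, wt β η * longWeight K η z * (f η - f (η + drect η z)) ^ 2 := by
        simp only [← Finset.sum_add_distrib]
        exact Finset.sum_congr rfl fun η _ => Finset.sum_congr rfl fun z _ => by ring
    _ ≤ _ := add_le_add h1 h2
    _ = _ := by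
        unfold pathConst
        push_cast
        ring

lemma sum_weight_children_le {β : ℝ} (hβ : 0 ≤ β) {K : ℕ} (hK : 1 ≤ K) (hKL : 2 * K ≤ L ^ 2)
    (hL : (L : ℝ) ^ 2 ≤ Real.exp β) (g : Cfg L → ℝ) (hg : ∀ η, 0 ≤ g η) :
    ∑ η, ∑ z, wt β η * (shortWeight K η z + longWeight K η z) * g (η + drect η z) ≤
      (∑ ζ, wt β ζ * g ζ * (Nd ζ + Real.exp (-β))) / K := by
  have hK' : (0 : ℝ) < K := by exact_mod_cast hK
  have e1 : Real.exp (2 * β) = Real.exp β ^ 2 := by rw [← Real.exp_nat_mul]; norm_num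
  have e2 : Real.exp (4 * β) = Real.exp β ^ 4 := by rw [← Real.exp_nat_mul]; norm_num
  have hp := Real.exp_pos β
  have hb1 : (L : ℝ) ^ 4 * Real.exp (-(2 * β)) ≤ 1 := by
    rw [Real.exp_neg, e1, ← div_eq_mul_inv, div_le_one (by positivity)]
    calc (L : ℝ) ^ 4 = ((L : ℝ) ^ 2) ^ 2 := by ring
      _ ≤ _ := by gcongr
  have hb2 : (L : ℝ) ^ 6 * Real.exp (-(4 * β)) ≤ Real.exp (-β) := by
    rw [Real.exp_neg, Real.exp_neg, e2, ← div_eq_mul_inv, div_le_iff₀ (by positivity)]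
    calc (L : ℝ) ^ 6 = ((L : ℝ) ^ 2) ^ 3 := by ring
      _ ≤ Real.exp β ^ 3 := by gcongr
      _ = _ := by field_simp
  refine (children_bound hβ (M := (L : ℝ) ^ 2 / K) (by positivity) _ (weight_le hK hKL) g
    hg).trans ?_
  rw [div_mul_eq_mul_div, Finset.mul_sum]
  refine div_le_div_of_nonneg_right (Finset.sum_le_sum fun ζ _ => ?_) hK'.le
  have hw : 0 ≤ wt β ζ * g ζ := mul_nonneg (Real.exp_pos _).le (hg ζ)
  calc (L : ℝ) ^ 2 * (wt β ζ * g ζ *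
        (Nd ζ * (L : ℝ) ^ 2 * Real.exp (-(2 * β)) + (L : ℝ) ^ 4 * Real.exp (-(4 * β))))
      = wt β ζ * g ζ * (Nd ζ * ((L : ℝ) ^ 4 * Real.exp (-(2 * β)))
        + (L : ℝ) ^ 6 * Real.exp (-(4 * β))) := by ring
    _ ≤ wt β ζ * g ζ * (Nd ζ * 1 + Real.exp (-β)) := by gcongr
    _ = _ := by ring

/-- The mean number of defects is small. -/
lemma sum_wt_Nd_le {β : ℝ} (hβ : 0 ≤ β) {K : ℕ} (hK : 2 ≤ K) (hKL : 2 * K ≤ L ^ 2)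
    (hL : (L : ℝ) ^ 2 ≤ Real.exp β) :
    ∑ η : Cfg L, wt β η * Nd η ≤ Real.exp (-β) * ∑ η : Cfg L, wt β η := by
  have hK' : (2 : ℝ) ≤ K := by exact_mod_cast hK
  have h1 := sum_weight_children_le hβ (by omega) hKL hL (fun _ : Cfg L => 1) (fun _ => zero_le_one)
  have h2 : ∑ η : Cfg L, wt β η * Nd η ≤
      ∑ η : Cfg L, ∑ z, wt β η * (shortWeight K η z + longWeight K η z) * 1 := by
    refine Finset.sum_le_sum fun η _ => ?_
    simp only [mul_one, ← Finset.mul_sum]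
    exact mul_le_mul_of_nonneg_left (Nd_le_sum_weight K η) (Real.exp_pos _).le
  have h3 : ∑ ζ : Cfg L, wt β ζ * 1 * (Nd ζ + Real.exp (-β))
      = ∑ η : Cfg L, wt β η * Nd η + Real.exp (-β) * ∑ η : Cfg L, wt β η := by
    rw [Finset.mul_sum, ← Finset.sum_add_distrib]
    exact Finset.sum_congr rfl fun _ _ => by ring
  rw [h3] at h1
  have h4 := h2.trans h1
  rw [le_div_iff₀ (by positivity)] at h4
  have h5 : 0 ≤ ∑ η : Cfg L, wt β η * Nd η :=
    Finset.sum_nonneg fun η _ => mul_nonneg (Real.exp_pos _).le (Nat.cast_nonneg _)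
  nlinarith

/-- A weighted Poincaré inequality for functions that are constant on the ground states. -/
lemma sum_wt_Nd_sq_le {β : ℝ} (hβ : 0 ≤ β) {K : ℕ} (hK : 8 ≤ K) (hKL : 2 * K ≤ L ^ 2)
    (hL : (L : ℝ) ^ 2 ≤ Real.exp β) (f : Cfg L → ℝ) (c : ℝ) (hf : ∀ η, bd η = 0 → f η = c) :
    ∑ η : Cfg L, wt β η * Nd η * (f η - c) ^ 2 ≤ 8 * pathConst L β K * (spm L β).dir f := by
  have hK' : (8 : ℝ) ≤ K := by exact_mod_cast hK
  have h1 := sum_weight_children_le hβ (by omega) hKL hL (fun η => (f η - c) ^ 2)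
    (fun _ => sq_nonneg _)
  have h2 := sum_weight_sq_sub_le hβ (K := K) (by omega) f
  have h3 : ∑ η : Cfg L, wt β η * Nd η * (f η - c) ^ 2 ≤
      2 * ∑ η, ∑ z, wt β η * (shortWeight K η z + longWeight K η z)
          * (f (η + drect η z) - c) ^ 2 +
        2 * ∑ η, ∑ z, wt β η * (shortWeight K η z + longWeight K η z)
          * (f η - f (η + drect η z)) ^ 2 := by
    simp only [Finset.mul_sum, ← Finset.sum_add_distrib]
    refine Finset.sum_le_sum fun η _ => ?_
    have hw : 0 < wt β η := Real.exp_pos _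
    calc wt β η * Nd η * (f η - c) ^ 2 = Nd η * (wt β η * (f η - c) ^ 2) := by ring
      _ ≤ (∑ z, (shortWeight K η z + longWeight K η z)) * (wt β η * (f η - c) ^ 2) :=
        mul_le_mul_of_nonneg_right (Nd_le_sum_weight K η) (by positivity)
      _ ≤ _ := by
        rw [Finset.sum_mul]
        refine Finset.sum_le_sum fun z _ => ?_
        have hθ := mul_nonneg hw.le (add_nonneg (shortWeight_nonneg K η z)
          (longWeight_nonneg K η z))
        have := mul_le_mul_of_nonneg_left (show (f η - c) ^ 2 ≤ 2 * (f (η + drect η z) - c) ^ 2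
          + 2 * (f η - f (η + drect η z)) ^ 2 by
            nlinarith [sq_nonneg ((f (η + drect η z) - c) - (f η - f (η + drect η z)))]) hθ
        linarith
  have h4 : ∑ ζ : Cfg L, wt β ζ * (f ζ - c) ^ 2 * (Nd ζ + Real.exp (-β))
      ≤ 2 * ∑ η : Cfg L, wt β η * Nd η * (f η - c) ^ 2 := by
    rw [Finset.mul_sum]
    refine Finset.sum_le_sum fun ζ _ => ?_
    have hw : 0 < wt β ζ := Real.exp_pos _
    by_cases hz : bd ζ = 0
    · rw [hf ζ hz]; simp
    · have hN : 1 ≤ Nd ζ := Nat.one_le_iff_ne_zero.2 fun h => hz (cnt_eq_zero.1 h)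
      have hN' : (1 : ℝ) ≤ Nd ζ := by exact_mod_cast hN
      have he : Real.exp (-β) ≤ 1 := Real.exp_le_one_iff.2 (by linarith)
      have := mul_le_mul_of_nonneg_left (show (Nd ζ : ℝ) + Real.exp (-β) ≤ 2 * Nd ζ by linarith)
        (show 0 ≤ wt β ζ * (f ζ - c) ^ 2 by positivity)
      linarith
  set S := ∑ η : Cfg L, wt β η * Nd η * (f η - c) ^ 2
  have hS : 0 ≤ S := Finset.sum_nonneg fun η _ =>
    mul_nonneg (mul_nonneg (Real.exp_pos _).le (Nat.cast_nonneg _)) (sq_nonneg _)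
  have h5 : (∑ ζ : Cfg L, wt β ζ * (f ζ - c) ^ 2 * (Nd ζ + Real.exp (-β))) / K ≤ S / 4 := by
    rw [div_le_div_iff₀ (by positivity) (by norm_num)]
    nlinarith
  linarith

end HardyInequality

section Gauge

variable {L : ℕ}

/-- Functions multiplied by `c` under translation by `τ`. -/
def twist (τ : Cfg L) (c : ℝ) : Submodule ℝ (Cfg L → ℝ) where
  carrier := {f | ∀ s, f (s + τ) = c * f s}
  add_mem' {f g} hf hg s := by simp [hf s, hg s]; ring
  zero_mem' s := by simp
  smul_mem' a f hf s := by simp [hf s]; ring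

lemma mem_twist {τ : Cfg L} {c : ℝ} {f : Cfg L → ℝ} :
    f ∈ twist τ c ↔ ∀ s, f (s + τ) = c * f s := Iff.rfl

variable [NeZero L]

/-- Translation invariance of a chain. -/
structure RevChain.Inv (C : RevChain (Cfg L) (Tor L)) (τ : Cfg L) : Prop where
  act : ∀ x s, C.act x (s + τ) = C.act x s + τ
  q : ∀ s x, C.q (s + τ) x = C.q s x
  w : ∀ s, C.w (s + τ) = C.w s

lemma RevChain.Inv.gen_mem {C : RevChain (Cfg L) (Tor L)} {τ : Cfg L} (h : C.Inv τ) {c : ℝ}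
    {f : Cfg L → ℝ} (hf : f ∈ twist τ c) : C.gen *ᵥ f ∈ twist τ c := by
  intro s
  rw [C.gen_mulVec, C.gen_mulVec, h.w, mul_div_assoc', Finset.mul_sum]
  congr 1
  refine Finset.sum_congr rfl fun x _ => ?_
  rw [h.act, h.q, hf, hf]
  ring

lemma RevChain.Inv.sg_mem {C : RevChain (Cfg L) (Tor L)} {τ : Cfg L} (h : C.Inv τ) {c : ℝ}
    {f : Cfg L → ℝ} (hf : f ∈ twist τ c) (t : ℝ) : sg C.gen t f ∈ twist τ c :=
  _root_.sg_mem C.gen _ (fun _ hg => h.gen_mem hg) t f hf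

/-- The ground states. -/
def GS (L : ℕ) [NeZero L] : Finset (Cfg L) := Finset.univ.filter fun s => bd s = 0

lemma mem_GS {s : Cfg L} : s ∈ GS L ↔ bd s = 0 := by simp [GS]

lemma zero_mem_GS : (0 : Cfg L) ∈ GS L := mem_GS.2 (map_zero _)

lemma card_GS_pos : (0 : ℝ) < (GS L).card := by
  exact_mod_cast Finset.card_pos.2 ⟨0, zero_mem_GS⟩

lemma Nd_add_of_bd_eq_zero {τ : Cfg L} (hτ : bd τ = 0) (s : Cfg L) : Nd (s + τ) = Nd s := by
  simp [Nd, hτ]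

lemma wt_add_of_bd_eq_zero {τ : Cfg L} (hτ : bd τ = 0) (β : ℝ) (s : Cfg L) :
    wt β (s + τ) = wt β s := by
  simp [wt, Nd_add_of_bd_eq_zero hτ]

lemma wt_of_bd_eq_zero {s : Cfg L} (hs : bd s = 0) (β : ℝ) : wt β s = 1 := by
  simp [wt, Nd, hs, cnt_zero]

lemma spm_inv (β : ℝ) {τ : Cfg L} (hτ : bd τ = 0) : (spm L β).Inv τ where
  act x s := by simp only [spm]; abel
  q s x := by
    simp only [spm]
    rw [show s + τ + dl x = s + dl x + τ by abel, Nd_add_of_bd_eq_zero hτ,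
      Nd_add_of_bd_eq_zero hτ]
  w s := wt_add_of_bd_eq_zero hτ β s

/-- The partition function. -/
def Zp (L : ℕ) [NeZero L] (β : ℝ) : ℝ := ∑ η : Cfg L, wt β η

lemma Zp_pos (β : ℝ) : 0 < Zp L β :=
  Finset.sum_pos (fun _ _ => Real.exp_pos _) ⟨0, Finset.mem_univ _⟩

lemma card_GS_le_Zp (β : ℝ) : ((GS L).card : ℝ) ≤ Zp L β := by
  calc ((GS L).card : ℝ) = ∑ s ∈ GS L, wt β s := by
        rw [Finset.sum_congr rfl fun s hs => wt_of_bd_eq_zero (mem_GS.1 hs) β]; simp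
    _ ≤ _ := Finset.sum_le_sum_of_subset_of_nonneg (Finset.subset_univ _)
        fun _ _ _ => (Real.exp_pos _).le

/-- The indicator of not being a ground state. -/
def exc (η : Cfg L) : ℝ := if bd η = 0 then 0 else 1

lemma sum_wt_exc (β : ℝ) : ∑ η : Cfg L, wt β η * exc η = Zp L β - (GS L).card := by
  have h : ∀ η : Cfg L, wt β η * exc η = wt β η - if bd η = 0 then 1 else 0 := by
    intro η
    unfold exc
    split_ifs with h
    · rw [wt_of_bd_eq_zero h]; simp
    · simp
  simp only [h, Finset.sum_sub_distrib, Zp, GS, Finset.card_filter]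
  push_cast
  rfl

/-- Constants for which the estimates below hold. -/
structure Params (L : ℕ) (β : ℝ) (K : ℕ) : Prop where
  one_le : 1 ≤ β
  eight_le : 8 ≤ K
  two_mul_le : 2 * K ≤ L ^ 2
  sq_le : (L : ℝ) ^ 2 ≤ Real.exp β

lemma Params.sum_wt_exc_le {β : ℝ} {K : ℕ} (h : Params L β K) :
    ∑ η : Cfg L, wt β η * exc η ≤ Real.exp (-β) * Zp L β := by
  refine le_trans (Finset.sum_le_sum fun η _ => ?_) (sum_wt_Nd_le (by linarith [h.one_le])
    (by linarith [h.eight_le]) h.two_mul_le h.sq_le)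
  refine mul_le_mul_of_nonneg_left ?_ (Real.exp_pos _).le
  unfold exc
  split_ifs with h0
  · positivity
  · exact_mod_cast Nat.one_le_iff_ne_zero.2 fun h => h0 (cnt_eq_zero.1 h)

lemma Params.exp_neg_le {β : ℝ} {K : ℕ} (h : Params L β K) : Real.exp (-β) ≤ 1 / 2 := by
  have := Real.add_one_le_exp β
  rw [Real.exp_neg, ← one_div]
  exact one_div_le_one_div_of_le (by norm_num) (by linarith [h.one_le])

lemma Params.Zp_le {β : ℝ} {K : ℕ} (h : Params L β K) : Zp L β ≤ 2 * (GS L).card := by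
  have h1 := h.sum_wt_exc_le
  rw [sum_wt_exc] at h1
  have := mul_le_mul_of_nonneg_right h.exp_neg_le (Zp_pos (L := L) β).le
  linarith

lemma Params.pathConst_pos {β : ℝ} {K : ℕ} (h : Params L β K) : 0 < pathConst L β K := by
  have : (0 : ℝ) < L := by exact_mod_cast NeZero.pos L
  have := h.eight_le
  have : (0 : ℝ) < K := by exact_mod_cast (by omega)
  unfold pathConst
  positivity

lemma sub_exp_le_mul_log {x : ℝ} (hx : 0 < x) (c : ℝ) :
    c * x - Real.exp (c - 1) ≤ x * Real.log x := by
  have h := Real.add_one_le_exp (c - 1 - Real.log x)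
  rw [Real.exp_sub, Real.exp_log hx] at h
  rw [le_div_iff₀ hx] at h
  linarith

end Gauge

section Entropy

variable {L : ℕ} [NeZero L] {β : ℝ} {K : ℕ}

/-- A positive gauge invariant probability density. -/
structure Density (L : ℕ) [NeZero L] (β : ℝ) (h : Cfg L → ℝ) : Prop where
  pos : ∀ η, 0 < h η
  inv : ∀ τ, bd τ = 0 → h ∈ twist τ 1
  sum : ∑ η, wt β η * h η = Zp L β

lemma Density.sg {h : Cfg L → ℝ} (hd : Density L β h) {t : ℝ} (ht : 0 ≤ t) :
    Density L β (sg (spm L β).gen t h) where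
  pos i := by
    obtain ⟨k, -, hk⟩ := Finset.exists_min_image Finset.univ h ⟨i, Finset.mem_univ i⟩
    have := (spm L β).isGen.sg_mono ht (f := fun _ => h k) (fun j => hk j (Finset.mem_univ j)) i
    rw [(spm L β).isGen.sg_const] at this
    exact (hd.pos k).trans_le this
  inv τ hτ := (spm_inv β hτ).sg_mem (hd.inv τ hτ) t
  sum := by
    have := (spm L β).ip_one_sg t h
    simp only [RevChain.ip, Pi.one_apply, mul_one] at this
    exact this.trans hd.sum

lemma sum_orbit (g : Cfg L → ℝ) (hg : ∀ τ, bd τ = 0 → g ∈ twist τ 1) (η : Cfg L) :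
    ∑ ω, (if bd (ω + η) = 0 then g ω else 0) = (GS L).card * g η := by
  have h2 := cfg_two (L := L)
  rw [← Equiv.sum_comp (Equiv.addRight η), Finset.sum_congr rfl (g := fun τ =>
    if bd τ = 0 then g η else 0), ← Finset.sum_filter, Finset.sum_const, nsmul_eq_mul]
  · rfl
  · intro τ _
    simp only [Equiv.coe_addRight, show τ + η + η = τ by grind]
    split_ifs with h
    · rw [add_comm, hg τ h, one_mul]
    · rfl

lemma Density.le {h : Cfg L → ℝ} (hd : Density L β h) (hP : Params L β K) (η : Cfg L) :
    h η ≤ 2 * Real.exp (β * Nd η) := by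
  have h1 := sum_orbit (fun ω => wt β ω * h ω) (fun τ hτ s => by
    simp only [one_mul]
    rw [wt_add_of_bd_eq_zero hτ, hd.inv τ hτ, one_mul]) η
  have h2 : ((GS L).card : ℝ) * (wt β η * h η) ≤ Zp L β := by
    rw [← h1, ← hd.sum]
    refine Finset.sum_le_sum fun ω _ => ?_
    split_ifs
    · exact le_rfl
    · exact mul_nonneg (Real.exp_pos _).le (hd.pos ω).le
  have h3 : wt β η * h η ≤ 2 := by
    have := h2.trans hP.Zp_le
    rw [mul_comm] at this
    exact le_of_mul_le_mul_right this card_GS_pos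
  have e : Real.exp (β * Nd η) * wt β η = 1 := by
    rw [wt, ← Real.exp_add]; simp
  calc h η = Real.exp (β * Nd η) * (wt β η * h η) := by rw [← mul_assoc, e, one_mul]
    _ ≤ Real.exp (β * Nd η) * 2 := by gcongr
    _ = _ := mul_comm _ _

/-- The unnormalised entropy. -/
def ent (β : ℝ) (h : Cfg L → ℝ) : ℝ := ∑ η, wt β η * (h η * Real.log (h η))

lemma Density.log_le {h : Cfg L → ℝ} (hd : Density L β h) (hP : Params L β K) (η : Cfg L) :
    Real.log (h η) ≤ β * Nd η + 1 := by
  have h1 := Real.log_le_log (hd.pos η) (hd.le hP η)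
  rw [Real.log_mul (by norm_num) (Real.exp_pos _).ne', Real.log_exp] at h1
  have := Real.log_two_lt_d9
  linarith

lemma Density.ent_le {h : Cfg L → ℝ} (hd : Density L β h) (hP : Params L β K) :
    ent β h ≤ β * ∑ η, wt β η * Nd η * h η + Zp L β := by
  rw [← hd.sum, Finset.mul_sum, ← Finset.sum_add_distrib]
  refine Finset.sum_le_sum fun η _ => ?_
  have := mul_le_mul_of_nonneg_left (hd.log_le hP η)
    (mul_nonneg (Real.exp_pos (-β * Nd η)).le (hd.pos η).le)
  rw [← wt] at this
  linarith

lemma Density.ent_le_sq {h : Cfg L → ℝ} (hd : Density L β h) (hP : Params L β K) :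
    ent β h ≤ (β * L ^ 2 + 1) * Zp L β := by
  refine (hd.ent_le hP).trans ?_
  have h1 : ∑ η, wt β η * Nd η * h η ≤ (L : ℝ) ^ 2 * Zp L β := by
    rw [← hd.sum, Finset.mul_sum]
    refine Finset.sum_le_sum fun η _ => ?_
    have hN : (Nd η : ℝ) ≤ (L : ℝ) ^ 2 := by exact_mod_cast cnt_le (bd η)
    have := mul_le_mul_of_nonneg_left hN
      (mul_nonneg (Real.exp_pos (-β * Nd η)).le (hd.pos η).le)
    rw [← wt] at this
    linarith
  have := mul_le_mul_of_nonneg_left h1 (show 0 ≤ β by linarith [hP.one_le])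
  linarith

lemma Density.ent_le_dir {h : Cfg L → ℝ} (hd : Density L β h) (hP : Params L β K) :
    ent β h ≤ 16 * β * pathConst L β K * (spm L β).dir (fun η => √(h η)) + 5 * Zp L β := by
  have hβ := hP.one_le
  have h0 : ∀ η, bd η = 0 → √(h η) = √(h 0) := fun η hη => by
    have := hd.inv η hη 0
    rw [zero_add, one_mul] at this
    rw [this]
  have h1 := sum_wt_Nd_sq_le (by linarith) hP.eight_le hP.two_mul_le hP.sq_le
    (fun η => √(h η)) _ h0
  have h2 := sum_wt_Nd_le (L := L) (by linarith) (by linarith [hP.eight_le]) hP.two_mul_le hP.sq_le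
  have h3 : h 0 ≤ 2 := by simpa [Nd, cnt_zero] using hd.le hP 0
  have h4 : ∑ η, wt β η * Nd η * h η ≤ 2 * ∑ η, wt β η * Nd η * (√(h η) - √(h 0)) ^ 2
      + 4 * ∑ η : Cfg L, wt β η * Nd η := by
    simp only [Finset.mul_sum, ← Finset.sum_add_distrib]
    refine Finset.sum_le_sum fun η _ => ?_
    have hw : 0 ≤ wt β η * Nd η := mul_nonneg (Real.exp_pos _).le (Nat.cast_nonneg _)
    have e1 := Real.sq_sqrt (hd.pos η).le
    have e2 := Real.sq_sqrt (hd.pos 0).le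
    have : h η ≤ 2 * (√(h η) - √(h 0)) ^ 2 + 4 := by
      nlinarith [sq_nonneg (√(h η) - 2 * √(h 0))]
    have := mul_le_mul_of_nonneg_left this hw
    linarith
  have h5 : β * Real.exp (-β) ≤ 1 := by
    rw [Real.exp_neg, ← div_eq_mul_inv, div_le_one (Real.exp_pos _)]
    linarith [Real.add_one_le_exp β]
  have h6 : ∑ η, wt β η * Nd η * h η ≤ 16 * pathConst L β K * (spm L β).dir (fun η => √(h η))
      + 4 * (Real.exp (-β) * Zp L β) := by
    unfold Zp
    linarith
  have h7 := mul_le_mul_of_nonneg_left h6 (show 0 ≤ β by linarith)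
  have h8 := mul_le_mul_of_nonneg_right h5 (Zp_pos (L := L) β).le
  have := hd.ent_le hP
  linarith

lemma Density.ent_sg_le {h : Cfg L → ℝ} (hd : Density L β h) (hP : Params L β K) {s : ℝ}
    (hs : 4 * β * pathConst L β K * Real.log (β * L ^ 2 + 1) ≤ s) :
    ent β (_root_.sg (spm L β).gen s h) ≤ 6 * Zp L β := by
  have hβ := hP.one_le
  have hpc := hP.pathConst_pos
  set c := 4 * β * pathConst L β K with hc
  have hc0 : 0 < c := by positivity
  have hlog : 0 ≤ Real.log (β * L ^ 2 + 1) := Real.log_nonneg (by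
    have : 0 ≤ β * (L : ℝ) ^ 2 := by positivity
    linarith)
  have hs0 : 0 ≤ s := le_trans (by positivity) hs
  set G : ℝ → ℝ := fun t => ent β (_root_.sg (spm L β).gen t h) with hG
  have hder : ∀ t, 0 ≤ t → ∃ d, HasDerivAt G d t ∧ d ≤ -(G t - 5 * Zp L β) / c := by
    intro t ht
    obtain ⟨d, h1, h2⟩ := (spm L β).hasDerivAt_entropy h hd.pos ht
    refine ⟨d, h1, h2.trans ?_⟩
    have h3 := (hd.sg ht).ent_le_dir hP
    rw [le_div_iff₀ hc0]
    simp only [hG]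
    rw [hc]
    linarith
  have hder' : ∀ t, 0 ≤ t → ∃ d, HasDerivAt (fun t => Real.exp (t / c) * (G t - 5 * Zp L β)) d t
      ∧ d ≤ 0 := by
    intro t ht
    obtain ⟨d, h1, h2⟩ := hder t ht
    refine ⟨_, ((((hasDerivAt_id t).div_const c).exp).mul (h1.sub_const (5 * Zp L β))), ?_⟩
    have hp := Real.exp_pos (t / c)
    have : d + (G t - 5 * Zp L β) / c ≤ 0 := by
      rw [neg_div] at h2; linarith
    have := mul_nonpos_of_nonneg_of_nonpos hp.le this
    simp only [id]
    calc _ = Real.exp (t / c) * (d + (G t - 5 * Zp L β) / c) := by ring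
      _ ≤ 0 := this
  have hanti : AntitoneOn (fun t => Real.exp (t / c) * (G t - 5 * Zp L β)) (Set.Icc 0 s) := by
    refine antitoneOn_of_deriv_nonpos (convex_Icc 0 s) ?_ ?_ ?_
    · intro t ht
      obtain ⟨d, h1, -⟩ := hder' t ht.1
      exact h1.continuousAt.continuousWithinAt
    · intro t ht
      rw [interior_Icc] at ht
      obtain ⟨d, h1, -⟩ := hder' t ht.1.le
      exact h1.differentiableAt.differentiableWithinAt
    · intro t ht
      rw [interior_Icc] at ht
      obtain ⟨d, h1, h2⟩ := hder' t ht.1.le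
      rw [h1.deriv]
      exact h2
  have hfin := hanti ⟨le_rfl, hs0⟩ ⟨hs0, le_rfl⟩ hs0
  simp only [zero_div, Real.exp_zero, one_mul] at hfin
  have hG0 : G 0 ≤ (β * L ^ 2 + 1) * Zp L β := by
    simp only [hG, sg_zero]
    exact hd.ent_le_sq hP
  have hZ := Zp_pos (L := L) β
  have hexp : β * L ^ 2 + 1 ≤ Real.exp (s / c) := by
    rw [← Real.log_le_iff_le_exp (by positivity), le_div_iff₀ hc0]
    linarith
  by_contra hcon
  have h1 : Zp L β < G s - 5 * Zp L β := by simp only [hG]; linarith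
  have h2 : Real.exp (s / c) * Zp L β < Real.exp (s / c) * (G s - 5 * Zp L β) := by gcongr
  have h3 : (β * L ^ 2 + 1) * Zp L β ≤ Real.exp (s / c) * Zp L β := by gcongr
  linarith

lemma Density.mass_exc_le {h : Cfg L → ℝ} (hd : Density L β h) (hP : Params L β K)
    (he : ent β h ≤ 6 * Zp L β) : β * ∑ η, wt β η * h η * exc η ≤ 8 * Zp L β := by
  have h1 : β * (∑ η, wt β η * h η * exc η) - Real.exp β * (∑ η : Cfg L, wt β η * exc η) - Zp L β
      ≤ ent β h := by
    rw [Zp, Finset.mul_sum, Finset.mul_sum, ← Finset.sum_sub_distrib, ← Finset.sum_sub_distrib]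
    refine Finset.sum_le_sum fun η _ => ?_
    have hw : 0 < wt β η := Real.exp_pos _
    unfold exc
    split_ifs with h0
    · have h2 := sub_exp_le_mul_log (hd.pos η) 0
      have h3 : Real.exp (0 - 1) ≤ 1 := Real.exp_le_one_iff.2 (by norm_num)
      have := mul_le_mul_of_nonneg_left (show -1 ≤ h η * Real.log (h η) by linarith) hw.le
      linarith
    · have h2 := sub_exp_le_mul_log (hd.pos η) β
      have h3 : Real.exp (β - 1) ≤ Real.exp β := Real.exp_le_exp.2 (by linarith)
      have := mul_le_mul_of_nonneg_left
        (show β * h η - Real.exp β ≤ h η * Real.log (h η) by linarith) hw.le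
      linarith
  have h2 := mul_le_mul_of_nonneg_left hP.sum_wt_exc_le (Real.exp_pos β).le
  rw [← mul_assoc, ← Real.exp_add, add_neg_cancel, Real.exp_zero, one_mul] at h2
  linarith

/-- From any starting point the dynamics reaches the ground states quickly. -/
theorem hit_ground (hP : Params L β K) {s : ℝ}
    (hs : 4 * β * pathConst L β K * Real.log (β * L ^ 2 + 1) ≤ s) (σ : Cfg L) :
    sg (spm L β).gen s exc σ ≤ 16 / β := by
  have hβ := hP.one_le
  have hpc := hP.pathConst_pos
  have hlog : 0 ≤ Real.log (β * L ^ 2 + 1) := Real.log_nonneg (by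
    have : 0 ≤ β * (L : ℝ) ^ 2 := by positivity
    linarith)
  have hs0 : 0 ≤ s := le_trans (by positivity) hs
  have hZ := Zp_pos (L := L) β
  have hG := card_GS_pos (L := L)
  have hw : 0 < wt β σ := Real.exp_pos _
  set a : ℝ := Zp L β / (wt β σ * (GS L).card) with ha
  have ha0 : 0 < a := by positivity
  have hinv : ∀ τ : Cfg L, bd τ = 0 → ∀ η, bd (η + τ + σ) = bd (η + σ) := by
    intro τ hτ η
    simp [hτ]
  set h : Cfg L → ℝ := fun η => ((if bd (η + σ) = 0 then a else 0) + 1) / 2 with hh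
  have hwσ : ∑ η, wt β η * (if bd (η + σ) = 0 then a else 0) = Zp L β := by
    have := sum_orbit (fun η => wt β η * a) (fun τ hτ η => by
      simp only [one_mul]; rw [wt_add_of_bd_eq_zero hτ]) σ
    simp only [mul_ite, mul_zero]
    rw [this, ha]
    field_simp
  have hd : Density L β h := by
    refine ⟨fun η => ?_, fun τ hτ η => ?_, ?_⟩
    · simp only [hh]; split_ifs <;> positivity
    · simp only [hh, one_mul, hinv τ hτ]
    · have : ∀ η, wt β η * h η = (wt β η * (if bd (η + σ) = 0 then a else 0) + wt β η) / 2 := by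
        intro η; simp only [hh]; ring
      simp only [this, ← Finset.sum_div, Finset.sum_add_distrib, hwσ]
      rw [← Zp]; ring
  have hm := (hd.sg hs0).mass_exc_le hP (hd.ent_sg_le hP hs)
  have hrev : ∑ η, wt β η * sg (spm L β).gen s h η * exc η
      = ∑ η, wt β η * h η * sg (spm L β).gen s exc η := ((spm L β).ip_sg s h exc).symm
  rw [hrev] at hm
  set u := sg (spm L β).gen s exc with hu
  have hu0 : ∀ η, 0 ≤ u η := (spm L β).isGen.sg_nonneg hs0 fun η => by unfold exc; split_ifs <;> simp
  have huinv : ∀ τ, bd τ = 0 → u ∈ twist τ 1 := fun τ hτ =>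
    (spm_inv β hτ).sg_mem (fun η => by simp [exc, hτ]) s
  have hlow : Zp L β * u σ / 2 ≤ ∑ η, wt β η * h η * u η := by
    have := sum_orbit (fun η => wt β η * a * u η) (fun τ hτ η => by
      simp only [one_mul]; rw [wt_add_of_bd_eq_zero hτ, huinv τ hτ, one_mul]) σ
    have e : (GS L).card * (wt β σ * a * u σ) = Zp L β * u σ := by
      rw [ha]; field_simp
    rw [← e, ← this, Finset.sum_div]
    refine Finset.sum_le_sum fun η _ => ?_
    simp only [hh]
    have h1 : 0 ≤ wt β η * u η := mul_nonneg (Real.exp_pos _).le (hu0 η)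
    split_ifs <;> linarith
  rw [le_div_iff₀ (by linarith)]
  have h3 := mul_le_mul_of_nonneg_left hlow (show 0 ≤ β by linarith)
  refine le_of_mul_le_mul_left (a := Zp L β) ?_ hZ
  linarith

end Entropy

section Strips

variable {L : ℕ}

/-- The two coordinate directions. -/
def dirv (o : Bool) : Tor L := if o then (1, 0) else (0, 1)

/-- A strip of `n` flipped spins. -/
def str (o : Bool) (p : Tor L) (n : ℕ) : Cfg L := ∑ k ∈ Finset.range n, dl (p + (k : ZMod L) • dirv o)

lemma str_succ (o : Bool) (p : Tor L) (n : ℕ) :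
    str o p (n + 1) = str o p n + dl (p + (n : ZMod L) • dirv o) := Finset.sum_range_succ _ _

lemma str_zero (o : Bool) (p : Tor L) : str o p 0 = 0 := rfl

lemma add_smul_true (p : Tor L) (c : ZMod L) : p + c • dirv true = (p.1 + c, p.2) := by
  ext <;> simp [dirv]

lemma add_smul_false (p : Tor L) (c : ZMod L) : p + c • dirv false = (p.1, p.2 + c) := by
  ext <;> simp [dirv]

lemma sub_smul_true (p : Tor L) (c : ZMod L) : p - c • dirv true = (p.1 - c, p.2) := by
  ext <;> simp [dirv]

lemma sub_smul_false (p : Tor L) (c : ZMod L) : p - c • dirv false = (p.1, p.2 - c) := by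
  ext <;> simp [dirv]

lemma str_true (p : Tor L) (n : ℕ) : str true p n = hs p.1 p.2 n := by
  simp only [str, add_smul_true, hs]

lemma str_false (p : Tor L) (n : ℕ) : str false p n = vs p.1 p.2 n := by
  simp only [str, add_smul_false, vs]

/-- The spin flip at `x` extends a strip by one site in a positive direction. -/
def Grows (ω : Cfg L) (x : Tor L) : Prop :=
  ∃ (o : Bool) (n : ℕ), n < L ∧ bd (ω + str o (x - (n : ZMod L) • dirv o) n) = 0

/-- The spin flip at `x` extends or shortens a strip. -/
def Edge (ω : Cfg L) (x : Tor L) : Prop := Grows ω x ∨ Grows (ω + dl x) x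

/-- Ground states with at most one flipped strip. -/
def IsStrip (ω : Cfg L) : Prop := ∃ (o : Bool) (p : Tor L) (n : ℕ), n ≤ L ∧ bd (ω + str o p n) = 0

lemma cfg_add_self (s : Cfg L) : s + s = 0 := by
  have := cfg_two (L := L)
  grind

lemma cfg_add_add_self (s t : Cfg L) : s + t + t = s := by
  have := cfg_two (L := L)
  grind

lemma Edge.symm {ω : Cfg L} {x : Tor L} (h : Edge ω x) : Edge (ω + dl x) x := by
  unfold Edge at *
  rw [cfg_add_add_self]
  exact h.symm

lemma Grows.isStrip {ω : Cfg L} {x : Tor L} (h : Grows ω x) : IsStrip ω ∧ IsStrip (ω + dl x) := by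
  obtain ⟨o, n, hn, h⟩ := h
  refine ⟨⟨o, _, n, hn.le, h⟩, ⟨o, x - (n : ZMod L) • dirv o, n + 1, hn, ?_⟩⟩
  rw [str_succ, sub_add_cancel]
  convert h using 2
  have := cfg_two (L := L)
  grind

lemma Edge.isStrip {ω : Cfg L} {x : Tor L} (h : Edge ω x) : IsStrip ω ∧ IsStrip (ω + dl x) := by
  rcases h with h | h
  · exact h.isStrip
  · have := h.isStrip
    rw [cfg_add_add_self] at this
    exact this.symm

lemma Grows.add {τ : Cfg L} (hτ : bd τ = 0) (ω : Cfg L) (x : Tor L) : Grows (ω + τ) x ↔ Grows ω x := by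
  simp [Grows, hτ]

lemma Edge.add {τ : Cfg L} (hτ : bd τ = 0) (ω : Cfg L) (x : Tor L) : Edge (ω + τ) x ↔ Edge ω x := by
  unfold Edge
  rw [add_right_comm, Grows.add hτ, Grows.add hτ]

lemma IsStrip.add {τ : Cfg L} (hτ : bd τ = 0) (ω : Cfg L) : IsStrip (ω + τ) ↔ IsStrip ω := by
  simp [IsStrip, hτ]

lemma isStrip_of_bd_eq_zero {ω : Cfg L} (h : bd ω = 0) : IsStrip ω :=
  ⟨true, 0, 0, Nat.zero_le _, by simpa [str_zero] using h⟩

/-- The dynamics restricted to the growth and the shrinking of one strip. -/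
def stripChain (L : ℕ) [NeZero L] (β : ℝ) : RevChain (Cfg L) (Tor L) where
  w := wt β
  w_pos _ := Real.exp_pos _
  act x s := s + dl x
  act_act x s := cfg_add_add_self s _
  q s x := if Edge s x then Real.exp (-(4 * β)) else 0
  q_nonneg s x := by split_ifs <;> positivity
  q_act s x := by
    have : Edge (s + dl x) x ↔ Edge s x := ⟨fun h => by
      have := h.symm
      rwa [cfg_add_add_self] at this, Edge.symm⟩
    simp only [this]

lemma stripChain_inv [NeZero L] (β : ℝ) {τ : Cfg L} (hτ : bd τ = 0) : (stripChain L β).Inv τ where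
  act x s := by simp only [stripChain]; abel
  q s x := by simp only [stripChain, Edge.add hτ]
  w s := wt_add_of_bd_eq_zero hτ β s

/-- The defects on the plaquettes around a site. -/
def blk (D : Cfg L) (x : Tor L) : ZMod 2 × ZMod 2 × ZMod 2 × ZMod 2 :=
  (D (x.1, x.2), D (x.1 + 1, x.2), D (x.1, x.2 + 1), D (x.1 + 1, x.2 + 1))

lemma eq_bd_of_bd_add_eq_zero {ω s : Cfg L} (h : bd (ω + s) = 0) : bd ω = bd s := by
  have := cfg_two (L := L)
  rw [map_add] at h
  grind

lemma one_ne_zero_of_two_le (hL : 2 ≤ L) : (1 : ZMod L) ≠ 0 := by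
  have := cast_ne_zero_of_lt (L := L) (m := 1) one_ne_zero (by omega)
  simpa using this

lemma cast_add_one_ne_zero {n : ℕ} (hn : n + 1 < L) : (n : ZMod L) + 1 ≠ 0 := by
  have := cast_ne_zero_of_lt (L := L) (m := n + 1) (by omega) hn
  simpa using this

lemma blk_hs {n : ℕ} (h1 : 1 ≤ n) (hn : n + 1 < L) (x : Tor L) :
    blk (bd (hs (x.1 - (n : ZMod L)) x.2 n)) x = (1, 0, 1, 0) := by
  obtain ⟨u, v⟩ := x
  have e1 := one_ne_zero_of_two_le (L := L) (by omega)
  have e2 := cast_ne_zero_of_lt (L := L) (m := n) (by omega) (by omega)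
  have e3 := cast_add_one_ne_zero hn
  have e4 : u + 1 ≠ u - n := fun h => e3 (by linear_combination h)
  have e5 : u ≠ u - n := fun h => e2 (by linear_combination h)
  simp [blk, bd_hs, dl_apply, e1, e2, e4, e5]

lemma blk_vs {n : ℕ} (h1 : 1 ≤ n) (hn : n + 1 < L) (x : Tor L) :
    blk (bd (vs x.1 (x.2 - (n : ZMod L)) n)) x = (1, 1, 0, 0) := by
  obtain ⟨u, v⟩ := x
  have e1 := one_ne_zero_of_two_le (L := L) (by omega)
  have e2 := cast_ne_zero_of_lt (L := L) (m := n) (by omega) (by omega)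
  have e3 := cast_add_one_ne_zero hn
  have e4 : v + 1 ≠ v - n := fun h => e3 (by linear_combination h)
  have e5 : v ≠ v - n := fun h => e2 (by linear_combination h)
  simp [blk, bd_vs, dl_apply, e1, e2, e4, e5]

lemma cast_pred (hL : 1 ≤ L) : ((L - 1 : ℕ) : ZMod L) = -1 := by
  rw [Nat.cast_sub hL]; simp

lemma bd_str_pred (hL : 1 ≤ L) (o : Bool) (x : Tor L) :
    bd (str o (x - ((L - 1 : ℕ) : ZMod L) • dirv o) (L - 1)) = bd (dl x) := by
  have h : bd (str o (x - ((L - 1 : ℕ) : ZMod L) • dirv o) (L - 1)) =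
    dl (x.1, x.2) + dl (x.1 + 1, x.2) + dl (x.1, x.2 + 1) + dl (x.1 + 1, x.2 + 1) := by
    cases o
    · simp only [str_false, bd_vs, sub_smul_false, cast_pred hL, sub_neg_eq_add, add_neg_cancel_right]
      abel
    · simp only [str_true, bd_hs, sub_smul_true, cast_pred hL, sub_neg_eq_add, add_neg_cancel_right]
      abel
  rw [h, ← bd_dl]

lemma blk_bd_dl (hL : 2 ≤ L) (x : Tor L) : blk (bd (dl x)) x = (1, 1, 1, 1) := by
  have e1 := one_ne_zero_of_two_le hL
  obtain ⟨u, v⟩ := x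
  rw [bd_dl]
  simp [blk, dl_apply, e1]

lemma blk_add (D D' : Cfg L) (x : Tor L) : blk (D + D') x = blk D x + blk D' x := rfl

/-- Resistances along a strip. -/
def res (L n : ℕ) : ℝ := if n = 0 ∨ n = L - 1 then 1 / 4 else 1

lemma res_pos (n : ℕ) : 0 < res L n := by unfold res; split_ifs <;> norm_num

/-- Indicator that flipping a given strip leads to a ground state. -/
def hit (o : Bool) (ω : Cfg L) (x : Tor L) (n : ℕ) : ℝ :=
  if bd (ω + str o (x - (n : ZMod L) • dirv o) n) = 0 then 1 else 0

lemma hit_zero_le (o : Bool) (ω : Cfg L) (x : Tor L) :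
    hit o ω x 0 ≤ if blk (bd ω) x = 0 then 1 else 0 := by
  unfold hit
  split_ifs with h1 h2
  · exact le_rfl
  · exact absurd (by rw [eq_bd_of_bd_add_eq_zero h1, str_zero]; rfl) h2
  · norm_num
  · norm_num

lemma hit_pred_le (hL : 2 ≤ L) (o : Bool) (ω : Cfg L) (x : Tor L) :
    hit o ω x (L - 1) ≤ if blk (bd ω) x = (1, 1, 1, 1) then 1 else 0 := by
  unfold hit
  split_ifs with h1 h2
  · exact le_rfl
  · exact absurd (by rw [eq_bd_of_bd_add_eq_zero h1, bd_str_pred (by omega), blk_bd_dl hL]) h2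
  · norm_num
  · norm_num

lemma sum_hit_le {o : Bool} {ω : Cfg L} {x : Tor L} {c : ZMod 2 × ZMod 2 × ZMod 2 × ZMod 2}
    (hc : ∀ n, 1 ≤ n → n + 1 < L →
      blk (bd (str o (x - (n : ZMod L) • dirv o) n)) x = c)
    (hinj : ∀ n n', 1 ≤ n → n + 1 < L → 1 ≤ n' → n' + 1 < L →
      bd (str o (x - (n : ZMod L) • dirv o) n) = bd (str o (x - (n' : ZMod L) • dirv o) n') →
      n = n') :
    ∑ n ∈ Finset.Ico 1 (L - 1), hit o ω x n ≤ if blk (bd ω) x = c then 1 else 0 := by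
  unfold hit
  rw [← Finset.sum_filter, Finset.sum_const, nsmul_eq_mul, mul_one]
  split_ifs with h
  · rw [Nat.cast_le_one, Finset.card_le_one]
    intro n hn n' hn'
    simp only [Finset.mem_filter, Finset.mem_Ico] at hn hn'
    refine hinj n n' (by omega) (by omega) (by omega) (by omega) ?_
    rw [← eq_bd_of_bd_add_eq_zero hn.2, ← eq_bd_of_bd_add_eq_zero hn'.2]
  · rw [Finset.filter_eq_empty_iff.2]
    · simp
    intro n hn h0
    simp only [Finset.mem_Ico] at hn
    exact h (by rw [eq_bd_of_bd_add_eq_zero h0]; exact hc n (by omega) (by omega))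

lemma sum_hit_true_le (ω : Cfg L) (x : Tor L) :
    ∑ n ∈ Finset.Ico 1 (L - 1), hit true ω x n ≤
      if blk (bd ω) x = (1, 0, 1, 0) then 1 else 0 := by
  refine sum_hit_le (fun n h1 hn => ?_) fun n n' h1 hn h1' hn' h => ?_
  · rw [str_true, sub_smul_true]; exact blk_hs h1 hn x
  · by_contra hne
    have e1 := one_ne_zero_of_two_le (L := L) (by omega)
    have e2 := cast_ne_zero_of_lt (L := L) (m := n) (by omega) (by omega)
    have e3 : (n : ZMod L) ≠ n' := fun h => hne (cast_inj_of_lt (by omega) (by omega) h)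
    have := congrFun h (x.1 - n, x.2)
    rw [str_true, sub_smul_true, str_true, sub_smul_true] at this
    simp [bd_hs, dl_apply, e1, e2, e3] at this

lemma sum_hit_false_le (ω : Cfg L) (x : Tor L) :
    ∑ n ∈ Finset.Ico 1 (L - 1), hit false ω x n ≤
      if blk (bd ω) x = (1, 1, 0, 0) then 1 else 0 := by
  refine sum_hit_le (fun n h1 hn => ?_) fun n n' h1 hn h1' hn' h => ?_
  · rw [str_false, sub_smul_false]; exact blk_vs h1 hn x
  · by_contra hne
    have e1 := one_ne_zero_of_two_le (L := L) (by omega)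
    have e2 := cast_ne_zero_of_lt (L := L) (m := n) (by omega) (by omega)
    have e3 : (n : ZMod L) ≠ n' := fun h => hne (cast_inj_of_lt (by omega) (by omega) h)
    have := congrFun h (x.1, x.2 - n)
    rw [str_false, sub_smul_false, str_false, sub_smul_false] at this
    simp [bd_vs, dl_apply, e1, e2, e3] at this

lemma sum_range_res (hL : 2 ≤ L) (g : ℕ → ℝ) :
    ∑ n ∈ Finset.range L, res L n * g n
      = g 0 / 4 + g (L - 1) / 4 + ∑ n ∈ Finset.Ico 1 (L - 1), g n := by
  obtain ⟨m, rfl⟩ : ∃ m, L = m + 2 := ⟨L - 2, by omega⟩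
  rw [Finset.sum_range_succ, Finset.range_eq_Ico, Finset.sum_eq_sum_Ico_succ_bot (by omega)]
  rw [Finset.sum_congr rfl (g := g)]
  · simp [res]; ring
  · intro n hn
    simp only [Finset.mem_Ico] at hn
    rw [res, if_neg (by omega), one_mul]

/-- Every edge is used by few strips. -/
lemma sum_res_hit_le (hL : 2 ≤ L) (ω : Cfg L) (x : Tor L) :
    ∑ o, ∑ n ∈ Finset.range L, res L n * (hit o ω x n + hit o (ω + dl x) x n)
      ≤ if Edge ω x then 1 else 0 := by
  by_cases hE : Edge ω x
  swap
  · rw [if_neg hE]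
    refine (Finset.sum_eq_zero fun o _ => Finset.sum_eq_zero fun n hn => ?_).le
    have hn' := Finset.mem_range.1 hn
    rw [hit, hit, if_neg fun h => hE (Or.inl ⟨o, n, hn', h⟩),
      if_neg fun h => hE (Or.inr ⟨o, n, hn', h⟩)]
    simp
  rw [if_pos hE]
  simp only [sum_range_res hL, Fintype.sum_bool, Finset.sum_add_distrib]
  have hb : blk (bd (ω + dl x)) x = blk (bd ω) x + (1, 1, 1, 1) := by
    rw [map_add, blk_add, blk_bd_dl hL]
  have a1 := hit_zero_le true ω x
  have a2 := hit_zero_le false ω x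
  have a3 := hit_zero_le true (ω + dl x) x
  have a4 := hit_zero_le false (ω + dl x) x
  have b1 := hit_pred_le hL true ω x
  have b2 := hit_pred_le hL false ω x
  have b3 := hit_pred_le hL true (ω + dl x) x
  have b4 := hit_pred_le hL false (ω + dl x) x
  have c1 := sum_hit_true_le ω x
  have c2 := sum_hit_false_le ω x
  have c3 := sum_hit_true_le (ω + dl x) x
  have c4 := sum_hit_false_le (ω + dl x) x
  rw [hb] at a3 a4 b3 b4 c3 c4
  generalize blk (bd ω) x = c at *
  have key : (if c = 0 then (1 : ℝ) else 0) / 2 + (if c = (1, 1, 1, 1) then 1 else 0) / 2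
      + (if c + (1, 1, 1, 1) = 0 then 1 else 0) / 2
      + (if c + (1, 1, 1, 1) = (1, 1, 1, 1) then 1 else 0) / 2
      + (if c = (1, 0, 1, 0) then 1 else 0) + (if c = (1, 1, 0, 0) then 1 else 0)
      + (if c + (1, 1, 1, 1) = (1, 0, 1, 0) then 1 else 0)
      + (if c + (1, 1, 1, 1) = (1, 1, 0, 0) then 1 else 0) ≤ 1 := by
    clear * -
    obtain ⟨c1, c2, c3, c4⟩ := c
    have h01 : ∀ a : ZMod 2, a = 0 ∨ a = 1 := by decide
    rcases h01 c1 with rfl | rfl <;> rcases h01 c2 with rfl | rfl <;>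
      rcases h01 c3 with rfl | rfl <;> rcases h01 c4 with rfl | rfl <;>
      simp [Prod.ext_iff, show (1 : ZMod 2) + 1 = 0 from rfl] <;> norm_num
  linarith

end Strips

section StripForms

variable {L : ℕ} [NeZero L]

lemma sum_ite_bd_add (η : Cfg L) (g : Cfg L → ℝ) :
    ∑ ω, (if bd (ω + η) = 0 then g ω else 0) = ∑ σ ∈ GS L, g (σ + η) := by
  rw [← Equiv.sum_comp (Equiv.addRight η), GS, Finset.sum_filter]
  refine Finset.sum_congr rfl fun σ _ => ?_
  simp only [Equiv.coe_addRight, cfg_add_add_self]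

/-- The sum of a function over all strips of length `n`, by position and ground state. -/
def lineSum (F : Bool → Tor L → Cfg L → ℝ) : ℝ := ∑ o, ∑ p, ∑ σ ∈ GS L, F o p σ

lemma lineSum_mono {F G : Bool → Tor L → Cfg L → ℝ} (h : ∀ o p, ∀ σ ∈ GS L, F o p σ ≤ G o p σ) :
    lineSum F ≤ lineSum G :=
  Finset.sum_le_sum fun o _ => Finset.sum_le_sum fun p _ => Finset.sum_le_sum (h o p)

lemma lineSum_add (F G : Bool → Tor L → Cfg L → ℝ) :
    lineSum (fun o p σ => F o p σ + G o p σ) = lineSum F + lineSum G := by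
  simp only [lineSum, Finset.sum_add_distrib]

lemma lineSum_mul (c : ℝ) (F : Bool → Tor L → Cfg L → ℝ) :
    lineSum (fun o p σ => c * F o p σ) = c * lineSum F := by
  simp only [lineSum, Finset.mul_sum]

lemma lineSum_fst (a : Bool → Tor L → ℝ) (g : Cfg L → ℝ) :
    lineSum (fun o p σ => a o p * g σ) = (∑ o, ∑ p, a o p) * ∑ σ ∈ GS L, g σ := by
  simp only [lineSum, Finset.sum_mul, ← Finset.mul_sum]

lemma lineSum_const (g : Cfg L → ℝ) :
    lineSum (fun _ _ σ => g σ) = 2 * (L : ℝ) ^ 2 * ∑ σ ∈ GS L, g σ := by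
  have := lineSum_fst (L := L) (fun _ _ => 1) g
  simp only [one_mul] at this
  rw [this]
  congr 1
  simp [Finset.card_univ, ZMod.card]
  ring

lemma sum_hit_eq (o : Bool) (n : ℕ) (f : Cfg L → ℝ) :
    ∑ ω, ∑ x, hit o ω x n * (f (ω + dl x) - f ω) ^ 2
      = ∑ p, ∑ σ ∈ GS L, (f (σ + str o p (n + 1)) - f (σ + str o p n)) ^ 2 := by
  rw [Finset.sum_comm, ← Equiv.sum_comp (Equiv.addRight ((n : ZMod L) • dirv (L := L) o))]
  refine Finset.sum_congr rfl fun p _ => ?_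
  simp only [hit, ite_mul, one_mul, zero_mul, Equiv.coe_addRight, add_sub_cancel_right]
  rw [sum_ite_bd_add]
  refine Finset.sum_congr rfl fun σ _ => ?_
  rw [str_succ, add_assoc σ]

/-- The energy of a function along a strip. -/
def lineEnergy (f : Cfg L → ℝ) (o : Bool) (p : Tor L) (σ : Cfg L) : ℝ :=
  ∑ n ∈ Finset.range L, res L n * (f (σ + str o p (n + 1)) - f (σ + str o p n)) ^ 2

lemma lineEnergy_nonneg (f : Cfg L → ℝ) (o : Bool) (p : Tor L) (σ : Cfg L) :
    0 ≤ lineEnergy f o p σ :=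
  Finset.sum_nonneg fun n _ => mul_nonneg (res_pos n).le (sq_nonneg _)

lemma sum_strip_weights (β : ℝ) (a : ℕ → ℝ) (f : Cfg L → ℝ) :
    (∑ ω, ∑ x, (∑ o, ∑ n ∈ Finset.range L, a n * (hit o ω x n + hit o (ω + dl x) x n)) *
      (f (ω + dl x) - f ω) ^ 2) / 2
      = lineSum (fun o p σ => ∑ n ∈ Finset.range L,
          a n * (f (σ + str o p (n + 1)) - f (σ + str o p n)) ^ 2) := by
  have hs : ∀ o n, ∑ ω, ∑ x, hit o (ω + dl x) x n * (f (ω + dl x) - f ω) ^ 2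
      = ∑ ω, ∑ x, hit o ω x n * (f (ω + dl x) - f ω) ^ 2 := by
    intro o n
    rw [← (stripChain L β).sum_act]
    refine Finset.sum_congr rfl fun ω _ => Finset.sum_congr rfl fun x _ => ?_
    simp only [stripChain, cfg_add_add_self]
    ring
  have h1 : ∑ ω, ∑ x, (∑ o, ∑ n ∈ Finset.range L, a n * (hit o ω x n + hit o (ω + dl x) x n)) *
      (f (ω + dl x) - f ω) ^ 2
      = ∑ o, ∑ n ∈ Finset.range L, a n * (∑ ω, ∑ x, hit o ω x n * (f (ω + dl x) - f ω) ^ 2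
        + ∑ ω, ∑ x, hit o (ω + dl x) x n * (f (ω + dl x) - f ω) ^ 2) := by
    simp only [Finset.sum_mul, ← Finset.sum_add_distrib, Finset.mul_sum]
    calc _ = ∑ ω : Cfg L, ∑ o, ∑ x, ∑ n ∈ Finset.range L, _ :=
          Finset.sum_congr rfl fun ω _ => Finset.sum_comm
      _ = ∑ o, ∑ ω : Cfg L, ∑ x, ∑ n ∈ Finset.range L, _ := Finset.sum_comm
      _ = ∑ o, ∑ ω : Cfg L, ∑ n ∈ Finset.range L, ∑ x, _ :=
          Finset.sum_congr rfl fun o _ => Finset.sum_congr rfl fun ω _ => Finset.sum_comm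
      _ = ∑ o, ∑ n ∈ Finset.range L, ∑ ω : Cfg L, ∑ x, _ :=
          Finset.sum_congr rfl fun o _ => Finset.sum_comm
      _ = _ := by
          refine Finset.sum_congr rfl fun o _ => Finset.sum_congr rfl fun n _ =>
            Finset.sum_congr rfl fun ω _ => Finset.sum_congr rfl fun x _ => ?_
          ring
  rw [h1]
  simp only [hs, sum_hit_eq, lineSum]
  rw [Finset.sum_div]
  refine Finset.sum_congr rfl fun o _ => ?_
  simp only [← two_mul]
  rw [Finset.sum_div]
  calc _ = ∑ n ∈ Finset.range L, ∑ p, ∑ σ ∈ GS L,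
        a n * (f (σ + str o p (n + 1)) - f (σ + str o p n)) ^ 2 := by
        refine Finset.sum_congr rfl fun n _ => ?_
        simp only [← Finset.mul_sum]
        ring
    _ = ∑ p, ∑ n ∈ Finset.range L, ∑ σ ∈ GS L, _ := Finset.sum_comm
    _ = _ := Finset.sum_congr rfl fun p _ => Finset.sum_comm

lemma stripChain_dir (β : ℝ) (f : Cfg L → ℝ) :
    (stripChain L β).dir f = Real.exp (-(4 * β)) *
      ((∑ ω, ∑ x, (if Edge ω x then 1 else 0) * (f (ω + dl x) - f ω) ^ 2) / 2) := by
  rw [RevChain.dir, ← mul_div_assoc]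
  simp only [stripChain, Finset.mul_sum]
  congr 1
  refine Finset.sum_congr rfl fun ω _ => Finset.sum_congr rfl fun x _ => ?_
  split_ifs <;> ring

lemma lineEnergy_le_dir (hL : 2 ≤ L) (β : ℝ) (f : Cfg L → ℝ) :
    Real.exp (-(4 * β)) * lineSum (lineEnergy f) ≤ (stripChain L β).dir f := by
  rw [stripChain_dir]
  refine mul_le_mul_of_nonneg_left ?_ (Real.exp_pos _).le
  unfold lineEnergy
  rw [← sum_strip_weights β (res L)]
  refine div_le_div_of_nonneg_right (Finset.sum_le_sum fun ω _ => Finset.sum_le_sum fun x _ => ?_)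
    two_pos.le
  exact mul_le_mul_of_nonneg_right (sum_res_hit_le hL ω x) (sq_nonneg _)

lemma hit_nonneg (o : Bool) (ω : Cfg L) (x : Tor L) (n : ℕ) : 0 ≤ hit o ω x n := by
  unfold hit; split_ifs <;> norm_num

lemma dir_le_lineSum (β : ℝ) (f : Cfg L → ℝ) :
    (stripChain L β).dir f ≤ Real.exp (-(4 * β)) * lineSum (fun o p σ => ∑ n ∈ Finset.range L,
          (f (σ + str o p (n + 1)) - f (σ + str o p n)) ^ 2) := by
  rw [stripChain_dir]
  refine mul_le_mul_of_nonneg_left ?_ (Real.exp_pos _).le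
  have := sum_strip_weights β (fun _ => 1) f
  simp only [one_mul] at this
  rw [← this]
  refine div_le_div_of_nonneg_right (Finset.sum_le_sum fun ω _ => Finset.sum_le_sum fun x _ => ?_)
    two_pos.le
  refine mul_le_mul_of_nonneg_right ?_ (sq_nonneg _)
  have hge : ∀ o, ∀ n < L, hit o ω x n + hit o (ω + dl x) x n ≤
      ∑ o, ∑ n ∈ Finset.range L, (hit o ω x n + hit o (ω + dl x) x n) := by
    intro o n hn
    refine (Finset.single_le_sum (f := fun n => hit o ω x n + hit o (ω + dl x) x n)
      (fun n _ => add_nonneg (hit_nonneg _ _ _ _) (hit_nonneg _ _ _ _)) (Finset.mem_range.2 hn)).trans ?_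
    exact Finset.single_le_sum (f := fun o => ∑ n ∈ Finset.range L,
      (hit o ω x n + hit o (ω + dl x) x n)) (fun o _ => Finset.sum_nonneg fun n _ =>
        add_nonneg (hit_nonneg _ _ _ _) (hit_nonneg _ _ _ _)) (Finset.mem_univ o)
  split_ifs with hE
  · rcases hE with ⟨o, n, hn, h⟩ | ⟨o, n, hn, h⟩
    · refine le_trans ?_ (hge o n hn)
      rw [hit, if_pos h]
      linarith [hit_nonneg o (ω + dl x) x n]
    · refine le_trans ?_ (hge o n hn)
      have : hit o (ω + dl x) x n = 1 := if_pos h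
      rw [this]
      linarith [hit_nonneg o ω x n]
  · exact Finset.sum_nonneg fun o _ => Finset.sum_nonneg fun n _ =>
        add_nonneg (hit_nonneg _ _ _ _) (hit_nonneg _ _ _ _)

lemma sq_sub_le_res (hL : 2 ≤ L) (u : ℕ → ℝ) {m : ℕ} (hm : m ≤ L) :
    (u m - u 0) ^ 2 ≤ (L + 6) * ∑ n ∈ Finset.range L, res L n * (u (n + 1) - u n) ^ 2 := by
  have h1 : ∑ n ∈ Finset.range L, (res L n)⁻¹ = L + 6 := by
    have h := sum_range_res hL (fun n => (res L n)⁻¹ ^ 2)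
    have e : ∀ n, res L n * (res L n)⁻¹ ^ 2 = (res L n)⁻¹ := fun n => by
      have := (res_pos (L := L) n).ne'
      field_simp
    simp only [e] at h
    rw [h]
    have e2 : ∀ n ∈ Finset.Ico 1 (L - 1), (res L n)⁻¹ ^ 2 = 1 := by
      intro n hn
      rw [Finset.mem_Ico] at hn
      rw [res, if_neg (by omega)]
      norm_num
    rw [Finset.sum_congr rfl e2]
    simp only [res, true_or, or_true, if_true, Finset.sum_const, Nat.card_Ico, nsmul_eq_mul, mul_one]
    rw [Nat.sub_sub, Nat.cast_sub hL]
    norm_num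
    ring
  have h2 : u m - u 0 = ∑ n ∈ Finset.range m, (u (n + 1) - u n) := (Finset.sum_range_sub u m).symm
  have hsub : Finset.range m ⊆ Finset.range L := Finset.range_subset_range.2 hm
  rw [h2]
  have h3 := Finset.sum_mul_sq_le_sq_mul_sq (Finset.range m) (fun n => (√(res L n))⁻¹)
    (fun n => √(res L n) * (u (n + 1) - u n))
  have hs : ∀ n, √(res L n) ^ 2 = res L n := fun n => Real.sq_sqrt (res_pos n).le
  have hne : ∀ n, √(res L n) ≠ 0 := fun n => (Real.sqrt_pos.2 (res_pos n)).ne'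
  simp only [inv_mul_cancel_left₀ (hne _), mul_pow, inv_pow, hs] at h3
  refine h3.trans (mul_le_mul ?_ ?_ ?_ (by positivity))
  · rw [← h1]
    exact Finset.sum_le_sum_of_subset_of_nonneg hsub fun n _ _ => (inv_pos.2 (res_pos n)).le
  · exact Finset.sum_le_sum_of_subset_of_nonneg hsub
      fun n _ _ => mul_nonneg (res_pos n).le (sq_nonneg _)
  · exact Finset.sum_nonneg fun n _ => mul_nonneg (res_pos n).le (sq_nonneg _)

lemma sq_str_sub_le (hL : 2 ≤ L) (f : Cfg L → ℝ) (o : Bool) (p : Tor L) (σ : Cfg L) {m : ℕ}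
    (hm : m ≤ L) :
    (f (σ + str o p m) - f σ) ^ 2 ≤ (L + 6) * lineEnergy f o p σ := by
  have := sq_sub_le_res hL (fun n => f (σ + str o p n)) hm
  simpa only [str_zero, add_zero, lineEnergy] using this

lemma sum_range_cast {M : Type*} [AddCommMonoid M] (F : ZMod L → M) :
    ∑ k ∈ Finset.range L, F k = ∑ z, F z := by
  refine Finset.sum_bij (fun k _ => (k : ZMod L)) (fun _ _ => Finset.mem_univ _) ?_ ?_ ?_
  · intro a ha b hb h
    exact cast_inj_of_lt (Finset.mem_range.1 ha) (Finset.mem_range.1 hb) h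
  · intro z _
    exact ⟨z.val, Finset.mem_range.2 (ZMod.val_lt z), by simp⟩
  · intros; rfl

/-- The generators of the ground states: full columns and full rows. -/
def lineCfg : ZMod L ⊕ ZMod L → Cfg L
  | .inl a => fun p => if p.1 = a then 1 else 0
  | .inr b => fun p => if p.2 = b then 1 else 0

lemma bd_lineCfg (i : ZMod L ⊕ ZMod L) : bd (lineCfg i) = 0 := by
  ext p
  cases i <;> simp only [bd_apply, lineCfg, Pi.zero_apply] <;> grind

/-- The line through a point in a direction. -/
def lineIdx (o : Bool) (p : Tor L) : ZMod L ⊕ ZMod L := if o then .inr p.2 else .inl p.1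

lemma str_self (o : Bool) (p : Tor L) : str o p L = lineCfg (lineIdx o p) := by
  rw [str, sum_range_cast (fun z => dl (p + z • dirv o))]
  ext ⟨u, v⟩
  obtain ⟨a, b⟩ := p
  rw [Finset.sum_apply]
  cases o
  · simp only [add_smul_false, dl_apply, lineIdx, lineCfg, Prod.mk.injEq, Bool.false_eq_true, if_false]
    rw [Finset.sum_eq_single (v - b)]
    · simp
    · intro z _ hz
      rw [if_neg fun h => hz (by rw [h.2]; ring)]
    · simp
  · simp only [add_smul_true, dl_apply, lineIdx, lineCfg, Prod.mk.injEq, if_true]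
    rw [Finset.sum_eq_single (u - a)]
    · simp
    · intro z _ hz
      rw [if_neg fun h => hz (by rw [h.1]; ring)]
    · simp

lemma sum_strip_le (g : Cfg L → ℝ) (hg : ∀ ω, 0 ≤ g ω) :
    ∑ ω, (if IsStrip ω ∧ bd ω ≠ 0 then g ω else 0)
      ≤ lineSum (fun o p σ => ∑ n ∈ Finset.Ico 1 L, g (σ + str o p n)) := by
  have h1 : lineSum (fun o p σ => ∑ n ∈ Finset.Ico 1 L, g (σ + str o p n))
      = ∑ ω, ∑ o, ∑ p, ∑ n ∈ Finset.Ico 1 L, if bd (ω + str o p n) = 0 then g ω else 0 := by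
    refine Eq.trans (Finset.sum_congr rfl fun o _ => ?_) Finset.sum_comm
    refine Eq.trans (Finset.sum_congr rfl fun p _ => ?_) Finset.sum_comm
    refine Eq.trans ?_ Finset.sum_comm
    refine Eq.trans Finset.sum_comm ?_
    exact Finset.sum_congr rfl fun n _ => (sum_ite_bd_add _ _).symm
  rw [h1]
  refine Finset.sum_le_sum fun ω _ => ?_
  have hnn : ∀ o p n, 0 ≤ if bd (ω + str o p n) = 0 then g ω else 0 := by
    intro o p n; split_ifs
    · exact hg ω
    · exact le_rfl
  split_ifs with h
  · obtain ⟨⟨o, p, n, hn, h0⟩, hne⟩ := h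
    have hn0 : n ≠ 0 := by
      rintro rfl
      exact hne (by simpa [str_zero] using h0)
    have hnL : n ≠ L := by
      rintro rfl
      rw [map_add, str_self, bd_lineCfg, add_zero] at h0
      exact hne h0
    calc g ω = if bd (ω + str o p n) = 0 then g ω else 0 := (if_pos h0).symm
      _ ≤ ∑ n ∈ Finset.Ico 1 L, if bd (ω + str o p n) = 0 then g ω else 0 :=
          Finset.single_le_sum (f := fun n => if bd (ω + str o p n) = 0 then g ω else 0)
            (fun n _ => hnn o p n) (Finset.mem_Ico.2 ⟨by omega, by omega⟩)
      _ ≤ ∑ p, ∑ n ∈ Finset.Ico 1 L, if bd (ω + str o p n) = 0 then g ω else 0 :=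
          Finset.single_le_sum (f := fun p => ∑ n ∈ Finset.Ico 1 L,
            if bd (ω + str o p n) = 0 then g ω else 0)
            (fun p _ => Finset.sum_nonneg fun n _ => hnn o p n) (Finset.mem_univ p)
      _ ≤ _ := Finset.single_le_sum (f := fun o => ∑ p, ∑ n ∈ Finset.Ico 1 L,
            if bd (ω + str o p n) = 0 then g ω else 0)
            (fun o _ => Finset.sum_nonneg fun p _ => Finset.sum_nonneg fun n _ => hnn o p n)
            (Finset.mem_univ o)
  · exact Finset.sum_nonneg fun o _ => Finset.sum_nonneg fun p _ => Finset.sum_nonneg fun n _ => hnn o p n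

end StripForms

section Sectors

variable {L : ℕ}

/-- The point with given coordinates along and across a direction. -/
def pt (o : Bool) (a b : ZMod L) : Tor L := if o then (a, b) else (b, a)

lemma exists_eq_pt (o : Bool) (x : Tor L) : ∃ a b, x = pt o a b := by
  cases o
  · exact ⟨x.2, x.1, rfl⟩
  · exact ⟨x.1, x.2, rfl⟩

lemma pt_inj {o : Bool} {a b a' b' : ZMod L} : pt o a b = pt o a' b' ↔ a = a' ∧ b = b' := by
  cases o <;> simp [pt, and_comm]

lemma pt_sub_smul (o : Bool) (a b c : ZMod L) : pt o a b - c • dirv o = pt o (a - c) b := by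
  cases o <;> simp [pt, dirv]

lemma bd_str_pt (o : Bool) (a b : ZMod L) (n : ℕ) :
    bd (str o (pt o a b) n) = dl (pt o a b) + dl (pt o a (b + 1)) + dl (pt o (a + (n : ZMod L)) b)
      + dl (pt o (a + (n : ZMod L)) (b + 1)) := by
  cases o
  · simp [str_false, bd_vs, pt]
  · simp [str_true, bd_hs, pt]

lemma bd_dl_pt (o : Bool) (a b : ZMod L) :
    bd (dl (pt o a b)) = dl (pt o a b) + dl (pt o (a + 1) b) + dl (pt o a (b + 1))
      + dl (pt o (a + 1) (b + 1)) := by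
  cases o
  · simp [bd_dl, pt]; abel
  · simp [bd_dl, pt]

variable [NeZero L]

lemma cnt_bd_str (o : Bool) (p : Tor L) {n : ℕ} (h1 : 1 ≤ n) (hn : n < L) :
    cnt (bd (str o p n)) = 4 := by
  obtain ⟨a, b, rfl⟩ := exists_eq_pt o p
  have e1 := one_ne_zero_of_two_le (L := L) (by omega)
  have e2 := cast_ne_zero_of_lt (L := L) (m := n) (by omega) hn
  rw [bd_str_pt, cnt_add_dl_of_eq, cnt_add_dl_of_eq, cnt_add_dl_of_eq, ← zero_add (dl (pt o a b)),
    cnt_add_dl_of_eq, cnt_zero]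
  · rfl
  all_goals simp [dl_apply, pt_inj, e1, e2]

lemma Nd_add_str {σ : Cfg L} (hσ : bd σ = 0) (o : Bool) (p : Tor L) {n : ℕ} (h1 : 1 ≤ n)
    (hn : n < L) : Nd (σ + str o p n) = 4 := by
  rw [Nd, map_add, hσ, zero_add, cnt_bd_str o p h1 hn]

lemma wt_add_str {σ : Cfg L} (hσ : bd σ = 0) (β : ℝ) (o : Bool) (p : Tor L) {n : ℕ} (h1 : 1 ≤ n)
    (hn : n < L) : wt β (σ + str o p n) = Real.exp (-(4 * β)) := by
  rw [wt, Nd_add_str hσ o p h1 hn]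
  congr 1
  push_cast
  ring

lemma sum_wt_strip_le (β : ℝ) (g : Cfg L → ℝ) (hg : ∀ ω, 0 ≤ g ω) :
    ∑ ω, (if IsStrip ω ∧ bd ω ≠ 0 then wt β ω * g ω else 0) ≤ Real.exp (-(4 * β)) *
      lineSum (fun o p σ => ∑ n ∈ Finset.Ico 1 L, g (σ + str o p n)) := by
  refine (sum_strip_le _ fun ω => mul_nonneg (Real.exp_pos _).le (hg ω)).trans (le_of_eq ?_)
  rw [← lineSum_mul]
  refine Finset.sum_congr rfl fun o _ => Finset.sum_congr rfl fun p _ =>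
    Finset.sum_congr rfl fun σ hσ => ?_
  refine Eq.trans (Finset.sum_congr rfl fun n hn => ?_) (Finset.mul_sum _ _ _).symm
  rw [Finset.mem_Ico] at hn
  exact congrArg (· * g (σ + str o p n)) (wt_add_str (mem_GS.1 hσ) β o p hn.1 hn.2)

lemma sum_wt_strip_const_le (β : ℝ) {c : ℝ} (hc : 0 ≤ c) :
    ∑ ω : Cfg L, (if IsStrip ω ∧ bd ω ≠ 0 then wt β ω * c else 0)
      ≤ 2 * (L : ℝ) ^ 3 * Real.exp (-(4 * β)) * c * (GS L).card := by
  refine (sum_wt_strip_le β (fun _ => c) fun _ => hc).trans ?_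
  rw [lineSum_const]
  simp only [Finset.sum_const, Nat.card_Ico, nsmul_eq_mul]
  have h : ((L - 1 : ℕ) : ℝ) ≤ L := by exact_mod_cast Nat.sub_le L 1
  have := mul_le_mul_of_nonneg_left h (show 0 ≤ 2 * (L : ℝ) ^ 2 * Real.exp (-(4 * β)) * c * (GS L).card by
    positivity)
  linarith

/-- Functions on strips with a given character under the ground states. -/
def sector (X : Finset (ZMod L ⊕ ZMod L)) : Submodule ℝ (Cfg L → ℝ) where
  carrier := {f | (∀ ω, ¬IsStrip ω → f ω = 0) ∧
    ∀ i, f ∈ twist (lineCfg i) (if i ∈ X then -1 else 1)}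
  add_mem' {f g} hf hg := ⟨fun ω h => by simp [hf.1 ω h, hg.1 ω h],
    fun i => add_mem (hf.2 i) (hg.2 i)⟩
  zero_mem' := ⟨fun _ _ => rfl, fun i => zero_mem _⟩
  smul_mem' c f hf := ⟨fun ω h => by simp [hf.1 ω h], fun i => Submodule.smul_mem _ c (hf.2 i)⟩

lemma stripChain_gen_of_not_isStrip (β : ℝ) (f : Cfg L → ℝ) {ω : Cfg L} (h : ¬IsStrip ω) :
    ((stripChain L β).gen *ᵥ f) ω = 0 := by
  rw [RevChain.gen_mulVec]
  rw [Finset.sum_eq_zero, zero_div]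
  intro x _
  have : ¬Edge ω x := fun hE => h hE.isStrip.1
  simp [stripChain, this]

lemma sector_gen_mem (β : ℝ) {X : Finset (ZMod L ⊕ ZMod L)} {f : Cfg L → ℝ} (hf : f ∈ sector X) :
    (stripChain L β).gen *ᵥ f ∈ sector X :=
  ⟨fun _ h => stripChain_gen_of_not_isStrip β f h,
    fun i => (stripChain_inv β (bd_lineCfg i)).gen_mem (hf.2 i)⟩

/-- The lower bound for the decay rate per twisted line. -/
def rate (L : ℕ) (β : ℝ) : ℝ :=
  ((1 + 4 * (L : ℝ) ^ 3 * Real.exp (-(4 * β))) * (L + 6) / (4 * L * Real.exp (-(4 * β)))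
    + 4 * (L : ℝ) ^ 2 * (L + 6))⁻¹

lemma rate_pos (β : ℝ) : 0 < rate L β := by
  have : (0 : ℝ) < L := by exact_mod_cast NeZero.pos L
  unfold rate
  positivity

lemma ip_strip_le (β : ℝ) {f : Cfg L → ℝ} (hf : ∀ ω, ¬IsStrip ω → f ω = 0) :
    (stripChain L β).ip f f ≤ ∑ σ ∈ GS L, f σ ^ 2 + Real.exp (-(4 * β)) *
      lineSum (fun o p σ => ∑ n ∈ Finset.Ico 1 L, f (σ + str o p n) ^ 2) := by
  refine le_trans (le_of_eq ?_) (add_le_add_right (sum_wt_strip_le β (fun ω => f ω ^ 2) fun ω => sq_nonneg _) _)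
  rw [GS, Finset.sum_filter, ← Finset.sum_add_distrib]
  refine Finset.sum_congr rfl fun ω _ => ?_
  by_cases h : bd ω = 0
  · simp only [stripChain, h, ne_eq, not_true_eq_false, and_false, if_true, if_false, add_zero]
    rw [wt_of_bd_eq_zero h]
    ring
  · by_cases hS : IsStrip ω
    · simp only [stripChain, h, ne_eq, not_false_eq_true, hS, and_self, if_true, if_false, zero_add]
      ring
    · simp [stripChain, h, hS, hf ω hS]

lemma sum_lineIdx (X : Finset (ZMod L ⊕ ZMod L)) :
    ∑ o, ∑ p : Tor L, (if lineIdx o p ∈ X then (1 : ℝ) else 0) = L * X.card := by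
  have h : ((X.card : ℕ) : ℝ) = ∑ i, if i ∈ X then (1 : ℝ) else 0 := by simp
  rw [h, Fintype.sum_sum_type, Fintype.sum_bool]
  rw [Fintype.sum_prod_type, Fintype.sum_prod_type_right]
  have e1 : ∀ x : ZMod L, ∑ y : ZMod L, (if lineIdx true (x, y) ∈ X then (1 : ℝ) else 0)
      = ∑ y : ZMod L, if Sum.inr y ∈ X then (1 : ℝ) else 0 := fun x => by simp [lineIdx]
  have e2 : ∀ y : ZMod L, ∑ x : ZMod L, (if lineIdx false (x, y) ∈ X then (1 : ℝ) else 0)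
      = ∑ x : ZMod L, if Sum.inl x ∈ X then (1 : ℝ) else 0 := fun x => by simp [lineIdx]
  simp only [e1, e2]
  rw [Finset.sum_const, Finset.sum_const, Finset.card_univ, ZMod.card, nsmul_eq_mul, nsmul_eq_mul]
  ring

/-- The spectral gap of the strip dynamics in a sector. -/
lemma sector_gap (hL : 2 ≤ L) (β : ℝ) {X : Finset (ZMod L ⊕ ZMod L)} {f : Cfg L → ℝ}
    (hf : f ∈ sector X) :
    X.card * rate L β * (stripChain L β).ip f f ≤ (stripChain L β).dir f := by
  have hL0 : (0 : ℝ) < L := by exact_mod_cast NeZero.pos L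
  set e := Real.exp (-(4 * β)) with he
  have he0 : 0 < e := Real.exp_pos _
  set D := (stripChain L β).dir f
  set U := ∑ σ ∈ GS L, f σ ^ 2 with hU
  have hU0 : 0 ≤ U := Finset.sum_nonneg fun _ _ => sq_nonneg _
  set E := lineSum (lineEnergy f) with hE
  have hD : e * E ≤ D := lineEnergy_le_dir hL β f
  have h1 : (stripChain L β).ip f f ≤ U + e * (L * (4 * (L : ℝ) ^ 2 * U + 2 * (L + 6) * E)) := by
    refine (ip_strip_le β hf.1).trans (add_le_add_right (mul_le_mul_of_nonneg_left ?_ he0.le) _)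
    calc _ ≤ lineSum (fun o p σ => (2 * L) * f σ ^ 2 + (2 * L * (L + 6)) * lineEnergy f o p σ) := by
          refine lineSum_mono fun o p σ _ => ?_
          calc _ ≤ ∑ n ∈ Finset.Ico 1 L, (2 * f σ ^ 2 + 2 * ((L + 6) * lineEnergy f o p σ)) := by
                refine Finset.sum_le_sum fun n hn => ?_
                rw [Finset.mem_Ico] at hn
                have := sq_str_sub_le hL f o p σ hn.2.le
                nlinarith [sq_nonneg (f (σ + str o p n) - 2 * f σ)]
            _ ≤ L * (2 * f σ ^ 2 + 2 * ((L + 6) * lineEnergy f o p σ)) := by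
                rw [Finset.sum_const, nsmul_eq_mul, Nat.card_Ico]
                have := lineEnergy_nonneg f o p σ
                refine mul_le_mul_of_nonneg_right ?_ (by positivity)
                exact_mod_cast Nat.sub_le L 1
            _ = _ := by ring
      _ = _ := by
          rw [lineSum_add, lineSum_mul, lineSum_mul, lineSum_const]
          ring
  have h2 : 4 * L * X.card * U ≤ (L + 6) * E := by
    calc _ = lineSum (fun o p σ => (if lineIdx o p ∈ X then 1 else 0) * (4 * f σ ^ 2)) := by
          rw [lineSum_fst, sum_lineIdx, ← Finset.mul_sum]
          ring
      _ ≤ lineSum (fun o p σ => (L + 6) * lineEnergy f o p σ) := by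
          refine lineSum_mono fun o p σ _ => ?_
          split_ifs with h
          · have h3 := sq_str_sub_le hL f o p σ le_rfl
            rw [str_self, hf.2, if_pos h] at h3
            linarith
          · have := lineEnergy_nonneg f o p σ
            rw [zero_mul]
            positivity
      _ = _ := by rw [lineSum_mul]
  have hk : (X.card : ℝ) ≤ 2 * L := by
    have : X.card ≤ L + L := by
      refine (Finset.card_le_univ X).trans (le_of_eq ?_)
      simp [ZMod.card]
    have : (X.card : ℝ) ≤ L + L := by exact_mod_cast this
    linarith
  have hD0 : 0 ≤ D := RevChain.dir_nonneg _ _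
  have hr := rate_pos (L := L) β
  rw [mul_assoc, mul_comm (rate L β), ← mul_assoc, rate, ← he, ← div_eq_mul_inv, div_le_iff₀ (by positivity)]
  have h3 : X.card * U ≤ D * ((L + 6) / (4 * L * e)) := by
    rw [mul_div_assoc', le_div_iff₀ (by positivity)]
    nlinarith
  calc X.card * (stripChain L β).ip f f
      ≤ X.card * (U + e * (L * (4 * (L : ℝ) ^ 2 * U + 2 * (L + 6) * E))) :=
        mul_le_mul_of_nonneg_left h1 (Nat.cast_nonneg _)
    _ = (1 + 4 * (L : ℝ) ^ 3 * e) * (X.card * U) + X.card * (2 * L * (L + 6) * (e * E)) := by ring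
    _ ≤ (1 + 4 * (L : ℝ) ^ 3 * e) * (D * ((L + 6) / (4 * L * e)))
        + 2 * L * (2 * L * (L + 6) * D) := by
        have hE0 : 0 ≤ E := Finset.sum_nonneg fun o _ => Finset.sum_nonneg fun p _ =>
          Finset.sum_nonneg fun σ _ => lineEnergy_nonneg f o p σ
        gcongr
    _ = _ := by ring

lemma sector_decay (hL : 2 ≤ L) (β : ℝ) {X : Finset (ZMod L ⊕ ZMod L)} {f : Cfg L → ℝ}
    (hf : f ∈ sector X) {t : ℝ} (ht : 0 ≤ t) :
    (stripChain L β).ip (sg (stripChain L β).gen t f) (sg (stripChain L β).gen t f)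
      ≤ Real.exp (-2 * (X.card * rate L β) * t) * (stripChain L β).ip f f :=
  (stripChain L β).ip_sg_self_le (sector X) (fun _ h => sector_gen_mem β h) _
    (fun _ h => sector_gap hL β h) ht f hf

lemma sector_sg_mem (β : ℝ) {X : Finset (ZMod L ⊕ ZMod L)} {f : Cfg L → ℝ} (hf : f ∈ sector X)
    (t : ℝ) : sg (stripChain L β).gen t f ∈ sector X :=
  sg_mem _ (sector X) (fun _ h => sector_gen_mem β h) t f hf

lemma sector_ip_eq_zero (β : ℝ) {X Y : Finset (ZMod L ⊕ ZMod L)} (hXY : X ≠ Y) {f g : Cfg L → ℝ}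
    (hf : f ∈ sector X) (hg : g ∈ sector Y) : (stripChain L β).ip f g = 0 := by
  obtain ⟨i, hi⟩ : ∃ i, ¬(i ∈ X ↔ i ∈ Y) := by
    by_contra! h
    exact hXY (Finset.ext h)
  have h1 : (stripChain L β).ip f g = -(stripChain L β).ip f g := by
    conv_lhs => rw [RevChain.ip, ← Equiv.sum_comp (Equiv.addRight (lineCfg i))]
    rw [RevChain.ip, ← Finset.sum_neg_distrib]
    refine Finset.sum_congr rfl fun ω _ => ?_
    simp only [Equiv.coe_addRight]
    rw [(stripChain_inv β (bd_lineCfg i)).w, hf.2 i, hg.2 i]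
    split_ifs with h3 h4 h4
    · exact absurd (iff_of_true h3 h4) hi
    · ring
    · ring
    · exact absurd (iff_of_false h3 h4) hi
  linarith

end Sectors

lemma RevChain.ip_sum_right {Ω X ι : Type*} [Fintype Ω] [Fintype X]
    (C : RevChain Ω X) (s : Finset ι) (f : Ω → ℝ)
    (g : ι → Ω → ℝ) : C.ip f (∑ i ∈ s, g i) = ∑ i ∈ s, C.ip f (g i) := by
  simp only [RevChain.ip, Finset.sum_apply, Finset.mul_sum]
  exact Finset.sum_comm

lemma RevChain.ip_sum_sum {Ω X ι : Type*} [Fintype Ω] [Fintype X] (C : RevChain Ω X) (s : Finset ι)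
    (g : ι → Ω → ℝ) (h : ∀ i ∈ s, ∀ j ∈ s, i ≠ j → C.ip (g i) (g j) = 0) :
    C.ip (∑ i ∈ s, g i) (∑ i ∈ s, g i) = ∑ i ∈ s, C.ip (g i) (g i) := by
  rw [C.ip_sum_right]
  refine Finset.sum_congr rfl fun j hj => ?_
  rw [C.ip_comm, C.ip_sum_right, Finset.sum_eq_single j]
  · intro i hi hij
    exact h j hj i hi hij.symm
  · exact fun hj' => absurd hj hj'

section StripMixing

variable {L : ℕ}

/-- The sign of a spin. -/
def sgn (a : ZMod 2) : ℝ := if a = 0 then 1 else -1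

lemma sgn_add (a b : ZMod 2) : sgn (a + b) = sgn a * sgn b := by
  have h01 : ∀ a : ZMod 2, a = 0 ∨ a = 1 := by decide
  rcases h01 a with rfl | rfl <;> rcases h01 b with rfl | rfl <;>
    simp [sgn, show (1 : ZMod 2) + 1 = 0 from rfl]

lemma sgn_zero : sgn 0 = 1 := if_pos rfl

lemma sgn_one : sgn 1 = -1 := if_neg one_ne_zero

lemma sgn_mul_self (a : ZMod 2) : sgn a * sgn a = 1 := by
  unfold sgn; split_ifs <;> norm_num

lemma abs_sgn (a : ZMod 2) : |sgn a| = 1 := by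
  unfold sgn; split_ifs <;> norm_num

/-- The sum of a function of the column and a function of the row. -/
def gaugeCfg : (ZMod L ⊕ ZMod L → ZMod 2) →+ Cfg L where
  toFun g p := g (.inl p.1) + g (.inr p.2)
  map_zero' := by ext p; simp
  map_add' g h := by ext p; simp only [Pi.add_apply]; ring

lemma gaugeCfg_apply (g : ZMod L ⊕ ZMod L → ZMod 2) (p : Tor L) :
    gaugeCfg g p = g (.inl p.1) + g (.inr p.2) := rfl

lemma bd_gaugeCfg (g : ZMod L ⊕ ZMod L → ZMod 2) : bd (gaugeCfg g) = 0 := by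
  ext p
  simp only [bd_apply, gaugeCfg_apply, Pi.zero_apply]
  grind

variable [NeZero L]

lemma lineCfg_eq_gaugeCfg (i : ZMod L ⊕ ZMod L) : lineCfg i = gaugeCfg (Pi.single i 1) := by
  ext p
  cases i <;> simp [lineCfg, gaugeCfg_apply, Pi.single_apply]

lemma exists_eq_gaugeCfg {s : Cfg L} (hs : bd s = 0) : ∃ g, s = gaugeCfg g := by
  have h0 : ∀ x y, s (x, y) + s (x - 1, y) + s (x, y - 1) + s (x - 1, y - 1) = 0 := fun x y =>
    congrFun hs (x, y)
  have h1 : ∀ (n : ℕ) y, s ((n : ZMod L), y) + s ((n : ZMod L), y - 1) = s (0, y) + s (0, y - 1) := by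
    intro n y
    induction n with
    | zero => simp
    | succ n ih =>
      have := h0 ((n + 1 : ℕ) : ZMod L) y
      push_cast at this ⊢
      rw [add_sub_cancel_right] at this
      grind
  have h2 : ∀ x (n : ℕ), s (x, (n : ZMod L)) + s (0, (n : ZMod L)) = s (x, 0) + s (0, 0) := by
    intro x n
    induction n with
    | zero => simp
    | succ n ih =>
      have := h1 x.val ((n + 1 : ℕ) : ZMod L)
      rw [ZMod.natCast_zmod_val] at this
      push_cast at this ⊢
      rw [add_sub_cancel_right] at this
      grind
  refine ⟨Sum.elim (fun x => s (x, 0) + s (0, 0)) (fun y => s (0, y)), ?_⟩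
  ext ⟨x, y⟩
  have := h2 x y.val
  rw [ZMod.natCast_zmod_val] at this
  simp only [gaugeCfg_apply, Sum.elim_inl, Sum.elim_inr]
  grind

/-- The character of a set of lines. -/
def chi (X : Finset (ZMod L ⊕ ZMod L)) (g : ZMod L ⊕ ZMod L → ZMod 2) : ℝ := ∏ i ∈ X, sgn (g i)

lemma abs_chi (X : Finset (ZMod L ⊕ ZMod L)) (g : ZMod L ⊕ ZMod L → ZMod 2) : |chi X g| = 1 := by
  simp [chi, Finset.abs_prod, abs_sgn]

lemma chi_add_single (X : Finset (ZMod L ⊕ ZMod L)) (g : ZMod L ⊕ ZMod L → ZMod 2)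
    (i : ZMod L ⊕ ZMod L) :
    chi X (g + Pi.single i 1) = (if i ∈ X then -1 else 1) * chi X g := by
  have : ∀ j, sgn ((g + Pi.single i 1 : ZMod L ⊕ ZMod L → ZMod 2) j)
      = (if j = i then -1 else 1) * sgn (g j) := by
    intro j
    rw [Pi.add_apply, sgn_add, mul_comm]
    by_cases h : j = i
    · subst h; simp [sgn_one]
    · simp [h, sgn_zero]
  simp only [chi, this, Finset.prod_mul_distrib, Finset.prod_ite_eq']

lemma sum_chi (g : ZMod L ⊕ ZMod L → ZMod 2) :
    ∑ X, chi X g = if g = 0 then 2 ^ (2 * L) else 0 := by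
  have h := Finset.prod_one_add (f := fun i => sgn (g i)) Finset.univ
  rw [Finset.powerset_univ] at h
  unfold chi
  rw [← h]
  split_ifs with hg
  · subst hg
    simp [sgn_zero, Finset.card_univ, ZMod.card, two_mul]
    norm_num
  · obtain ⟨i, hi⟩ := Function.ne_iff.1 hg
    refine Finset.prod_eq_zero (Finset.mem_univ i) ?_
    rw [zmod_two_ne_zero.1 hi, sgn_one]
    norm_num

/-- The component of a point mass in a sector, up to a constant. -/
def comp (X : Finset (ZMod L ⊕ ZMod L)) (σ s : Cfg L) : ℝ :=
  ∑ g, chi X g * if s + σ = gaugeCfg g then 1 else 0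

/-- The number of ways to write a ground state as a sum of lines. -/
def mult (L : ℕ) [NeZero L] : ℝ := ∑ g : ZMod L ⊕ ZMod L → ZMod 2, if 0 = gaugeCfg g then 1 else 0

lemma sum_ite_eq_gaugeCfg {s : Cfg L} (hs : bd s = 0) :
    ∑ g, (if s = gaugeCfg g then (1 : ℝ) else 0) = mult L := by
  obtain ⟨g₀, rfl⟩ := exists_eq_gaugeCfg hs
  rw [← Equiv.sum_comp (Equiv.addRight g₀)]
  refine Finset.sum_congr rfl fun g _ => ?_
  have e : gaugeCfg g₀ = gaugeCfg g + gaugeCfg g₀ ↔ 0 = gaugeCfg g := right_eq_add.trans eq_comm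
  simp only [Equiv.coe_addRight, map_add, e]

lemma mult_mul_card : mult L * (GS L).card = 2 ^ (2 * L) := by
  have h : ∑ s ∈ GS L, ∑ g, (if s = gaugeCfg g then (1 : ℝ) else 0) = 2 ^ (2 * L) := by
    rw [Finset.sum_comm]
    have : ∀ g, ∑ s ∈ GS L, (if s = gaugeCfg g then (1 : ℝ) else 0) = 1 := by
      intro g
      rw [Finset.sum_ite_eq', if_pos (mem_GS.2 (bd_gaugeCfg g))]
    simp [this, Finset.card_univ, ZMod.card, two_mul]
  rw [Finset.sum_congr rfl fun s hs => sum_ite_eq_gaugeCfg (mem_GS.1 hs)] at h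
  rw [← h]
  simp [mul_comm]

lemma mult_pos : 0 < mult L := by
  have h := mult_mul_card (L := L)
  have h2 : (0 : ℝ) < 2 ^ (2 * L) := by positivity
  rw [← h] at h2
  exact pos_of_mul_pos_left h2 (Nat.cast_nonneg _)

lemma comp_of_bd_ne_zero (X : Finset (ZMod L ⊕ ZMod L)) {σ s : Cfg L} (hσ : bd σ = 0)
    (hs : bd s ≠ 0) : comp X σ s = 0 := by
  refine Finset.sum_eq_zero fun g _ => ?_
  rw [if_neg, mul_zero]
  intro h
  have := congrArg bd h
  rw [map_add, hσ, add_zero, bd_gaugeCfg] at this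
  exact hs this

lemma comp_empty {σ s : Cfg L} (hσ : bd σ = 0) (hs : bd s = 0) : comp ∅ σ s = mult L := by
  simp only [comp, chi, Finset.prod_empty, one_mul]
  exact sum_ite_eq_gaugeCfg (by rw [map_add, hs, hσ, add_zero])

lemma abs_comp_le (X : Finset (ZMod L ⊕ ZMod L)) {σ s : Cfg L} (hσ : bd σ = 0) (hs : bd s = 0) :
    |comp X σ s| ≤ mult L := by
  refine (Finset.abs_sum_le_sum_abs _ _).trans (le_of_eq ?_)
  rw [← sum_ite_eq_gaugeCfg (s := s + σ) (by rw [map_add, hs, hσ, add_zero])]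
  refine Finset.sum_congr rfl fun g _ => ?_
  rw [abs_mul, abs_chi, one_mul]
  split_ifs <;> norm_num

lemma comp_mem (X : Finset (ZMod L ⊕ ZMod L)) {σ : Cfg L} (hσ : bd σ = 0) : comp X σ ∈ sector X := by
  refine ⟨fun ω h => comp_of_bd_ne_zero X hσ fun h0 => h (isStrip_of_bd_eq_zero h0), fun i s => ?_⟩
  unfold comp
  rw [← Equiv.sum_comp (Equiv.addRight (Pi.single i 1)), Finset.mul_sum]
  refine Finset.sum_congr rfl fun g _ => ?_
  simp only [Equiv.coe_addRight, chi_add_single, map_add, ← lineCfg_eq_gaugeCfg]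
  rw [add_right_comm, mul_assoc]
  simp only [add_left_inj]

lemma sum_comp (σ : Cfg L) : ∑ X, comp X σ = (2 : ℝ) ^ (2 * L) • Pi.single σ 1 := by
  ext s
  rw [Finset.sum_apply]
  unfold comp
  rw [Finset.sum_comm]
  simp only [← Finset.sum_mul, sum_chi, ite_mul, zero_mul]
  rw [Finset.sum_ite_eq', if_pos (Finset.mem_univ _), map_zero, Pi.smul_apply, Pi.single_apply,
    smul_eq_mul]
  have : s + σ = 0 ↔ s = σ := by
    have h2 := cfg_two (L := L)
    constructor <;> intro h <;> grind
  simp only [this]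

lemma ip_comp_le (β : ℝ) (X : Finset (ZMod L ⊕ ZMod L)) {σ : Cfg L} (hσ : bd σ = 0) :
    (stripChain L β).ip (comp X σ) (comp X σ) ≤ mult L * 2 ^ (2 * L) := by
  rw [← mult_mul_card]
  calc _ = ∑ s ∈ GS L, comp X σ s ^ 2 := by
        rw [GS, Finset.sum_filter]
        refine Finset.sum_congr rfl fun s _ => ?_
        split_ifs with h
        · simp only [stripChain]
          rw [wt_of_bd_eq_zero h]; ring
        · rw [comp_of_bd_ne_zero X hσ h]; ring
    _ ≤ ∑ s ∈ GS L, mult L ^ 2 := by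
        refine Finset.sum_le_sum fun s hs => ?_
        rw [← sq_abs]
        exact pow_le_pow_left₀ (abs_nonneg _) (abs_comp_le X hσ (mem_GS.1 hs)) 2
    _ = _ := by rw [Finset.sum_const, nsmul_eq_mul]; ring

/-- The part of a point mass orthogonal to the gauge-invariant functions decays. -/
lemma ip_sum_sg_comp_le (hL : 2 ≤ L) (β : ℝ) {σ : Cfg L} (hσ : bd σ = 0) {t : ℝ} (ht : 0 ≤ t) :
    (stripChain L β).ip (∑ X ∈ Finset.univ.erase ∅, sg (stripChain L β).gen t (comp X σ))
      (∑ X ∈ Finset.univ.erase ∅, sg (stripChain L β).gen t (comp X σ))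
      ≤ mult L * 2 ^ (2 * L) * ((1 + Real.exp (-2 * rate L β * t)) ^ (2 * L) - 1) := by
  rw [RevChain.ip_sum_sum _ _ _ fun X _ Y _ h =>
    sector_ip_eq_zero β h (sector_sg_mem β (comp_mem X hσ) t) (sector_sg_mem β (comp_mem Y hσ) t)]
  have hexp : ∀ X : Finset (ZMod L ⊕ ZMod L), Real.exp (-2 * (X.card * rate L β) * t)
      = Real.exp (-2 * rate L β * t) ^ X.card := by
    intro X
    rw [← Real.exp_nat_mul]
    congr 1
    ring
  have hsum : ∑ X ∈ Finset.univ.erase (∅ : Finset (ZMod L ⊕ ZMod L)),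
      Real.exp (-2 * rate L β * t) ^ X.card = (1 + Real.exp (-2 * rate L β * t)) ^ (2 * L) - 1 := by
    have h := Finset.prod_one_add (f := fun _ : ZMod L ⊕ ZMod L => Real.exp (-2 * rate L β * t))
      Finset.univ
    rw [Finset.powerset_univ] at h
    simp only [Finset.prod_const, Finset.card_univ, Fintype.card_sum, ZMod.card] at h
    rw [two_mul, h, ← Finset.add_sum_erase _ _ (Finset.mem_univ ∅)]
    simp
  rw [← hsum, Finset.mul_sum]
  refine Finset.sum_le_sum fun X _ => ?_
  refine (sector_decay hL β (comp_mem X hσ) ht).trans ?_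
  rw [hexp, mul_comm]
  exact mul_le_mul_of_nonneg_right (ip_comp_le β X hσ) (by positivity)

lemma RevChain.ip_abs_sq_le {Ω X : Type*} [Fintype Ω] [Fintype X] (C : RevChain Ω X) (f : Ω → ℝ) :
    (∑ i, C.w i * |f i|) ^ 2 ≤ (∑ i, C.w i) * C.ip f f := by
  have := C.ip_sq_le 1 (fun i => |f i|)
  simpa [RevChain.ip, mul_assoc] using this

lemma RevChain.sum_abs_sg_le {Ω X : Type*} [Fintype Ω] [DecidableEq Ω] [Fintype X]
    (C : RevChain Ω X) {t : ℝ}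
    (ht : 0 ≤ t) (f : Ω → ℝ) : ∑ i, C.w i * |sg C.gen t f i| ≤ ∑ i, C.w i * |f i| := by
  have h1 := C.ip_one_sg t (fun i => |f i|)
  simp only [RevChain.ip, Pi.one_apply, mul_one] at h1
  rw [← h1]
  refine Finset.sum_le_sum fun i _ => mul_le_mul_of_nonneg_left ?_ (C.w_pos i).le
  rw [abs_le]
  constructor
  · have := C.isGen.sg_mono ht (f := -f) (g := fun i => |f i|) (fun j => neg_le_abs (f j)) i
    have e : sg C.gen t (-f) i = -sg C.gen t f i := by
      have := congrFun (sg_smul C.gen t (-1) f) i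
      simpa using this
    linarith
  · exact C.isGen.sg_mono ht (fun j => le_abs_self (f j)) i

/-- The indicator of the ground states. -/
def gind (η : Cfg L) : ℝ := if bd η = 0 then 1 else 0

lemma sum_wt_gind (β : ℝ) : ∑ η : Cfg L, wt β η * gind η = (GS L).card := by
  rw [GS, Finset.card_filter]
  push_cast
  refine Finset.sum_congr rfl fun η _ => ?_
  unfold gind
  split_ifs with h
  · rw [wt_of_bd_eq_zero h, one_mul]
  · ring

lemma sum_wt_abs_gind_sub (β : ℝ) :
    ∑ η : Cfg L, wt β η * |gind η / (GS L).card - 1 / Zp L β| = 2 * (1 - (GS L).card / Zp L β) := by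
  have hG := card_GS_pos (L := L)
  have hZ := Zp_pos (L := L) β
  have h : ∀ η : Cfg L, wt β η * |gind η / (GS L).card - 1 / Zp L β|
      = (1 / (GS L).card - 2 / Zp L β) * (wt β η * gind η) + 1 / Zp L β * wt β η := by
    intro η
    unfold gind
    split_ifs
    · rw [abs_of_nonneg]
      · ring
      · rw [sub_nonneg]
        exact one_div_le_one_div_of_le hG (card_GS_le_Zp β)
    · rw [zero_div, zero_sub, abs_neg, abs_of_pos (by positivity)]
      ring
  simp only [h, Finset.sum_add_distrib, ← Finset.mul_sum, sum_wt_gind]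
  rw [← Zp]
  field_simp
  ring

lemma sg_single_sub (β : ℝ) {σ : Cfg L} (hσ : bd σ = 0) (t : ℝ) (η : Cfg L) :
    sg (stripChain L β).gen t (Pi.single σ 1) η - 1 / Zp L β
      = sg (stripChain L β).gen t (fun η => gind η / (GS L).card - 1 / Zp L β) η
        + (1 / 2 ^ (2 * L)) *
          (∑ X ∈ Finset.univ.erase ∅, sg (stripChain L β).gen t (comp X σ)) η := by
  have hm := mult_pos (L := L)
  have hG := card_GS_pos (L := L)
  have hmG := mult_mul_card (L := L)
  have h2 : (0 : ℝ) < 2 ^ (2 * L) := by positivity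
  have e1 : (Pi.single σ 1 : Cfg L → ℝ) = (fun η => gind η / (GS L).card)
      + (1 / 2 ^ (2 * L) : ℝ) • ∑ X ∈ Finset.univ.erase ∅, comp X σ := by
    have hs := sum_comp (L := L) σ
    rw [← Finset.add_sum_erase _ _ (Finset.mem_univ ∅)] at hs
    have e2 : comp ∅ σ = (2 : ℝ) ^ (2 * L) • fun η => gind η / (GS L).card := by
      ext η
      rw [← hmG, Pi.smul_apply, smul_eq_mul]
      unfold gind
      split_ifs with h
      · rw [comp_empty hσ h]; field_simp
      · rw [comp_of_bd_ne_zero ∅ hσ h]; simp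
    rw [e2] at hs
    have := congrArg (fun f => (1 / 2 ^ (2 * L) : ℝ) • f) hs
    simp only [smul_add, smul_smul, one_div, inv_mul_cancel₀ h2.ne', one_smul] at this
    rw [one_div]
    exact this.symm
  have e3 : (fun η : Cfg L => gind η / (GS L).card - 1 / Zp L β)
      = (fun η => gind η / (GS L).card) - fun _ => 1 / Zp L β := rfl
  have e4 : sg (stripChain L β).gen t (fun _ => 1 / Zp L β) η = 1 / Zp L β := (stripChain L β).isGen.sg_const ..
  rw [e1, sg_linear_add, sg_smul, sg_sum, e3, sg_sub]
  simp only [Pi.add_apply, Pi.sub_apply, Pi.smul_apply, smul_eq_mul]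
  rw [e4]
  ring

lemma sum_mul_abs_le_of_eq_add {Ω : Type*} [Fintype Ω] {w F G v : Ω → ℝ} {c : ℝ}
    (hw : ∀ i, 0 ≤ w i) (hc : 0 ≤ c) (h : ∀ i, F i = G i + c * v i) :
    ∑ i, w i * |F i| ≤ ∑ i, w i * |G i| + c * ∑ i, w i * |v i| := by
  rw [Finset.mul_sum, ← Finset.sum_add_distrib]
  refine Finset.sum_le_sum fun i _ => ?_
  rw [h i]
  have h3 := abs_add_le (G i) (c * v i)
  rw [abs_mul, abs_of_nonneg hc] at h3
  have h4 := mul_le_mul_of_nonneg_left h3 (hw i)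
  linarith

lemma strip_sum_abs_le (hL : 2 ≤ L) (β : ℝ) {σ : Cfg L} (hσ : bd σ = 0) {t : ℝ} (ht : 0 ≤ t) :
    ∑ η : Cfg L, wt β η * |sg (stripChain L β).gen t (Pi.single σ 1) η - 1 / Zp L β| ≤
      2 * (1 - (GS L).card / Zp L β)
      + √(Zp L β / (GS L).card * ((1 + Real.exp (-2 * rate L β * t)) ^ (2 * L) - 1)) := by
  have hm := mult_pos (L := L)
  have hG := card_GS_pos (L := L)
  have hmG := mult_mul_card (L := L)
  have h6 := ip_sum_sg_comp_le hL β hσ ht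
  have h9 := sg_single_sub β hσ t
  have h8 := (stripChain L β).sum_abs_sg_le ht (fun η => gind η / (GS L).card - 1 / Zp L β)
  have h10 := sum_wt_abs_gind_sub (L := L) β
  generalize (∑ X ∈ Finset.univ.erase ∅, sg (stripChain L β).gen t (comp X σ)) = v at h6 h9
  generalize sg (stripChain L β).gen t (fun η => gind η / (GS L).card - 1 / Zp L β) = G at h8 h9
  have h5 : _ ≤ Zp L β * _ := (stripChain L β).ip_abs_sq_le v
  have h7 := h5.trans (mul_le_mul_of_nonneg_left h6 (Zp_pos β).le)
  refine (sum_mul_abs_le_of_eq_add (fun i => ((stripChain L β).w_pos i).le)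
    (by positivity) h9).trans ?_
  refine add_le_add (h8.trans (le_of_eq h10)) (Real.le_sqrt_of_sq_le ?_)
  rw [mul_pow]
  refine (mul_le_mul_of_nonneg_left h7 (by positivity)).trans (le_of_eq ?_)
  rw [← hmG]
  generalize (1 + Real.exp (-2 * rate L β * t)) ^ (2 * L) - 1 = u
  generalize Zp L β = z
  field_simp

end StripMixing

section Comparison

variable {L : ℕ} [NeZero L]

lemma pt_not (o : Bool) (a b : ZMod L) : pt (!o) a b = pt o b a := by
  cases o <;> rfl

lemma grows_of_bd_eq {ω : Cfg L} (o : Bool) {c u v : ZMod L}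
    (h : bd ω = dl (pt o c v) + dl (pt o c (v + 1)) + dl (pt o u v) + dl (pt o u (v + 1))) :
    Grows ω (pt o u v) := by
  refine ⟨o, (u - c).val, ZMod.val_lt _, ?_⟩
  rw [map_add, pt_sub_smul, bd_str_pt, ZMod.natCast_zmod_val, sub_sub_cancel, add_sub_cancel, h]
  exact cfg_add_self _

lemma edge_of_bd_eq {ω : Cfg L} (o : Bool) {c c' u v : ZMod L}
    (h : bd ω = dl (pt o c v) + dl (pt o c (v + 1)) + dl (pt o c' v) + dl (pt o c' (v + 1)))
    (hc : c = u ∨ c = u + 1 ∨ c' = u ∨ c' = u + 1) : Edge ω (pt o u v) := by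
  have h2 := cfg_two (L := L)
  have key : ∀ {c c' : ZMod L}, bd ω = dl (pt o c v) + dl (pt o c (v + 1)) + dl (pt o c' v)
      + dl (pt o c' (v + 1)) → c' = u ∨ c' = u + 1 → Edge ω (pt o u v) := by
    rintro c c' h (rfl | rfl)
    · exact Or.inl (grows_of_bd_eq o h)
    · refine Or.inr (grows_of_bd_eq (c := c) o ?_)
      rw [map_add, h, bd_dl_pt]
      grind
  rcases hc with hc | hc | hc | hc
  · exact key (c := c') (c' := c) (by rw [h]; abel) (Or.inl hc)
  · exact key (c := c') (c' := c) (by rw [h]; abel) (Or.inr hc)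
  · exact key h (Or.inl hc)
  · exact key h (Or.inr hc)

/-- The number of defects around a site. -/
def corners (D : Cfg L) (x : Tor L) : ℕ :=
  (if D (x.1, x.2) = 0 then 0 else 1) + (if D (x.1 + 1, x.2) = 0 then 0 else 1)
    + (if D (x.1, x.2 + 1) = 0 then 0 else 1) + (if D (x.1 + 1, x.2 + 1) = 0 then 0 else 1)

lemma sum_corners (D : Cfg L) : ∑ x, corners D x = 4 * cnt D := by
  have h : ∀ δ : Tor L, ∑ x : Tor L, (if D (x + δ) = 0 then 0 else 1) = cnt D := by
    intro δ
    refine (Equiv.sum_comp (Equiv.addRight δ) fun x => if D x = 0 then 0 else 1).trans ?_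
    rw [cnt, Finset.card_filter]
    refine Finset.sum_congr rfl fun x _ => ?_
    by_cases hx : D x = 0 <;> simp [hx]
  have h00 : ∑ x : Tor L, (if D (x.1, x.2) = 0 then 0 else 1) = cnt D := by
    simpa only [add_zero] using h 0
  have h10 : ∑ x : Tor L, (if D (x.1 + 1, x.2) = 0 then 0 else 1) = cnt D := by
    simpa only [Prod.add_def, add_zero] using h (1, 0)
  have h01 : ∑ x : Tor L, (if D (x.1, x.2 + 1) = 0 then 0 else 1) = cnt D := by
    simpa only [Prod.add_def, add_zero] using h (0, 1)
  have h11 : ∑ x : Tor L, (if D (x.1 + 1, x.2 + 1) = 0 then 0 else 1) = cnt D := h (1, 1)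
  simp only [corners, Finset.sum_add_distrib]
  omega

lemma corners_pt (o : Bool) (D : Cfg L) (u v : ZMod L) : corners D (pt o u v) =
    (if D (pt o u v) = 0 then 0 else 1) + (if D (pt o (u + 1) v) = 0 then 0 else 1)
    + (if D (pt o u (v + 1)) = 0 then 0 else 1) + (if D (pt o (u + 1) (v + 1)) = 0 then 0 else 1) := by
  cases o
  · simp only [corners, pt, Bool.false_eq_true, if_false]; omega
  · simp only [corners, pt, if_true]

lemma cnt_add_dl (D : Cfg L) (p : Tor L) :
    cnt (D + dl p) + 2 * (if D p = 0 then 0 else 1) = cnt D + 1 := by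
  split_ifs with h
  · rw [cnt_add_dl_of_eq h]
  · have := cnt_add_dl_of_ne h; omega

lemma cnt_add_bd_dl (hL : 2 ≤ L) (D : Cfg L) (x : Tor L) :
    cnt (D + bd (dl x)) + 2 * corners D x = cnt D + 4 := by
  have e1 := one_ne_zero_of_two_le hL
  obtain ⟨u, v⟩ := x
  rw [bd_dl, ← add_assoc, ← add_assoc, ← add_assoc]
  have h1 := cnt_add_dl D (u, v)
  have h2 := cnt_add_dl (D + dl (u, v)) (u + 1, v)
  have h3 := cnt_add_dl (D + dl (u, v) + dl (u + 1, v)) (u, v + 1)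
  have h4 := cnt_add_dl (D + dl (u, v) + dl (u + 1, v) + dl (u, v + 1)) (u + 1, v + 1)
  simp only [Pi.add_apply, dl_apply, Prod.mk.injEq, add_eq_left, left_eq_add, e1, false_and, and_false,
    if_false, add_zero] at h1 h2 h3 h4
  simp only [corners]
  omega

lemma bd_strip_eq_zero_iff {D : Cfg L} {o : Bool} {a a' b : ZMod L} (hL : 2 ≤ L) (ha : a ≠ a')
    (hD : D = dl (pt o a b) + dl (pt o a (b + 1)) + dl (pt o a' b) + dl (pt o a' (b + 1)))
    (c d : ZMod L) : D (pt o c d) = 0 ↔ ¬((c = a ∨ c = a') ∧ (d = b ∨ d = b + 1)) := by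
  have e1 := one_ne_zero_of_two_le hL
  simp only [hD, Pi.add_apply, dl_apply, pt_inj]
  by_cases h1 : c = a
  · subst h1
    by_cases h2 : d = b
    · subst h2; simp [ha, e1]
    · by_cases h3 : d = b + 1
      · subst h3; simp [ha, e1]
      · simp [h2, h3]
  · by_cases h1 : c = a'
    · subst h1
      by_cases h2 : d = b
      · subst h2; simp [ha.symm, e1]
      · by_cases h3 : d = b + 1
        · subst h3; simp [ha.symm, e1]
        · simp [h2, h3]
    · simp [*]

lemma corners_le_one (hL : 3 ≤ L) {ω : Cfg L} {o : Bool} {a a' b : ZMod L} (ha : a ≠ a')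
    (hD : bd ω = dl (pt o a b) + dl (pt o a (b + 1)) + dl (pt o a' b) + dl (pt o a' (b + 1)))
    {x : Tor L} (hx : ¬Edge ω x) : corners (bd ω) x ≤ 1 := by
  have e1 := one_ne_zero_of_two_le (L := L) (by omega)
  have e2 : (1 : ZMod L) + 1 ≠ 0 := by
    have := cast_ne_zero_of_lt (L := L) (m := 2) (by omega) (by omega)
    intro h
    apply this
    push_cast
    rw [← h]
    norm_num
  obtain ⟨u, v, rfl⟩ := exists_eq_pt o x
  have hA : ¬((u = a ∨ u = a') ∨ (u + 1 = a ∨ u + 1 = a')) ∨ ¬((v = b ∨ v = b + 1) ∧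
      (v + 1 = b ∨ v + 1 = b + 1)) := by
    by_contra! h
    obtain ⟨hu, hv, hv'⟩ := h
    have : v = b := by
      rcases hv with hv | hv
      · exact hv
      · subst hv
        rcases hv' with hv' | hv'
        · exact absurd (by linear_combination hv') e2
        · exact absurd (by linear_combination hv') e1
    subst this
    refine hx (edge_of_bd_eq o hD ?_)
    grind
  have hB : ¬((u = a ∨ u = a') ∧ (u + 1 = a ∨ u + 1 = a')) ∨ ¬((v = b ∨ v = b + 1) ∨
      (v + 1 = b ∨ v + 1 = b + 1)) := by
    by_contra! h
    obtain ⟨⟨hu, hu'⟩, hv⟩ := h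
    have : bd ω = dl (pt (!o) b u) + dl (pt (!o) b (u + 1)) + dl (pt (!o) (b + 1) u)
        + dl (pt (!o) (b + 1) (u + 1)) := by
      simp only [pt_not, hD]
      rcases hu with rfl | rfl
      · rcases hu' with hu' | hu'
        · exact absurd (by linear_combination hu') e1
        · rw [hu']; abel
      · rcases hu' with hu' | hu'
        · rw [hu']; abel
        · exact absurd (by linear_combination hu') e1
    refine hx ?_
    rw [← pt_not]
    refine edge_of_bd_eq (!o) this ?_
    grind
  have hz := bd_strip_eq_zero_iff (by omega) ha hD
  rw [corners_pt o]
  have z1 := hz u v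
  have z2 := hz (u + 1) v
  have z3 := hz u (v + 1)
  have z4 := hz (u + 1) (v + 1)
  clear hz
  generalize (u = a ∨ u = a') = P at *
  generalize (u + 1 = a ∨ u + 1 = a') = Q at *
  generalize (v = b ∨ v = b + 1) = R at *
  generalize (v + 1 = b ∨ v + 1 = b + 1) = S at *
  split_ifs <;> first | omega | grind

lemma abs_q_sub_q_le (hL : 3 ≤ L) {β : ℝ} (hβ : 0 ≤ β) {σ : Cfg L} (hσ : bd σ = 0) (o : Bool)
    (p : Tor L) {n : ℕ} (h1 : 1 ≤ n) (hn : n < L) (x : Tor L) :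
    |(stripChain L β).q (σ + str o p n) x - (spm L β).q (σ + str o p n) x| ≤
      Real.exp (-(8 * β)) + corners (bd (σ + str o p n)) x * Real.exp (-(6 * β)) := by
  obtain ⟨a, b, rfl⟩ := exists_eq_pt o p
  have h4 := Nd_add_str hσ o (pt o a b) h1 hn
  set ω := σ + str o (pt o a b) n with hω
  have hD : bd ω = dl (pt o a b) + dl (pt o a (b + 1)) + dl (pt o (a + (n : ZMod L)) b)
      + dl (pt o (a + (n : ZMod L)) (b + 1)) := by
    rw [hω, map_add, hσ, zero_add, bd_str_pt]
  have ha : a ≠ a + (n : ZMod L) := by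
    have := cast_ne_zero_of_lt (L := L) (m := n) (by omega) hn
    simpa using this
  simp only [stripChain, spm, h4]
  split_ifs with hx
  · have : Nd (ω + dl x) ≤ 4 := by
      obtain ⟨o', p', m, hm, h⟩ := hx.isStrip.2
      have h := eq_bd_of_bd_add_eq_zero h
      rw [Nd, h]
      obtain ⟨a', b', rfl⟩ := exists_eq_pt o' p'
      rw [bd_str_pt]
      have c1 := cnt_add_dl_le (0 : Cfg L) (pt o' a' b')
      have c2 := cnt_add_dl_le (dl (pt o' a' b')) (pt o' a' (b' + 1))
      have c3 := cnt_add_dl_le (dl (pt o' a' b') + dl (pt o' a' (b' + 1)))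
        (pt o' (a' + (m : ZMod L)) b')
      have c4 := cnt_add_dl_le (dl (pt o' a' b') + dl (pt o' a' (b' + 1))
        + dl (pt o' (a' + (m : ZMod L)) b')) (pt o' (a' + (m : ZMod L)) (b' + 1))
      rw [cnt_zero, zero_add] at c1
      omega
    rw [max_eq_left this]
    have e : Real.exp (-(4 * β)) - Real.exp (-β * (4 : ℕ)) = 0 := by
      rw [sub_eq_zero]; congr 1; push_cast; ring
    rw [e, abs_zero]
    positivity
  · have hc := corners_le_one hL ha hD hx
    have hN := cnt_add_bd_dl (by omega) (bd ω) x
    rw [← map_add, ← Nd, ← Nd, h4] at hN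
    rw [zero_sub, abs_neg, abs_of_pos (Real.exp_pos _)]
    rcases Nat.le_one_iff_eq_zero_or_eq_one.1 hc with hc | hc
    · rw [hc, show max 4 (Nd (ω + dl x)) = 8 by omega]
      refine le_of_eq ?_
      push_cast
      rw [zero_mul, add_zero]
      congr 1; ring
    · rw [hc, show max 4 (Nd (ω + dl x)) = 6 by omega]
      have : -β * ((6 : ℕ) : ℝ) = -(6 * β) := by push_cast; ring
      rw [this]
      push_cast
      have := Real.exp_pos (-(8 * β))
      linarith

lemma sum_abs_q_sub_q_le (hL : 3 ≤ L) {β : ℝ} (hβ : 0 ≤ β) {σ : Cfg L} (hσ : bd σ = 0) (o : Bool)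
    (p : Tor L) {n : ℕ} (h1 : 1 ≤ n) (hn : n < L) :
    ∑ x, |(stripChain L β).q (σ + str o p n) x - (spm L β).q (σ + str o p n) x| ≤
      (L : ℝ) ^ 2 * Real.exp (-(8 * β)) + 16 * Real.exp (-(6 * β)) := by
  refine (Finset.sum_le_sum fun x _ => abs_q_sub_q_le hL hβ hσ o p h1 hn x).trans (le_of_eq ?_)
  rw [Finset.sum_add_distrib, ← Finset.sum_mul, ← Nat.cast_sum, sum_corners,
    show cnt (bd (σ + str o p n)) = 4 from Nd_add_str hσ o p h1 hn]
  simp [Finset.card_univ, ZMod.card]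
  ring_nf

lemma q_eq_q_of_bd_eq_zero (hL : 2 ≤ L) (β : ℝ) {σ : Cfg L} (hσ : bd σ = 0) (x : Tor L) :
    (stripChain L β).q σ x = (spm L β).q σ x := by
  have hE : Edge σ x := Or.inl ⟨true, 0, by omega, by simpa [str_zero] using hσ⟩
  have hN := cnt_add_bd_dl hL (bd σ) x
  rw [← map_add, hσ, cnt_zero, ← Nd] at hN
  have hc : corners (0 : Cfg L) x = 0 := by simp [corners]
  have h0 : Nd σ = 0 := by rw [Nd, hσ, cnt_zero]
  simp only [stripChain, spm, if_pos hE, h0, show Nd (σ + dl x) = 4 by omega,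
    show max 0 4 = 4 from rfl]
  congr 1
  push_cast
  ring

/-- The discrepancy between the strip dynamics and the full dynamics. -/
def discr (β : ℝ) (ω : Cfg L) : ℝ :=
  (∑ x, |(stripChain L β).q ω x - (spm L β).q ω x|) / wt β ω

lemma discr_nonneg (β : ℝ) (ω : Cfg L) : 0 ≤ discr β ω :=
  div_nonneg (Finset.sum_nonneg fun _ _ => abs_nonneg _) (Real.exp_pos _).le

lemma abs_gen_sub_gen_le (β : ℝ) (g : Cfg L → ℝ) (h0 : ∀ i, 0 ≤ g i) (h1 : ∀ i, g i ≤ 1)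
    (ω : Cfg L) : |(((stripChain L β).gen - (spm L β).gen) *ᵥ g) ω| ≤ discr β ω := by
  rw [Matrix.sub_mulVec, Pi.sub_apply, RevChain.gen_mulVec, RevChain.gen_mulVec]
  simp only [show (stripChain L β).w ω = wt β ω from rfl, show (spm L β).w ω = wt β ω from rfl,
    show ∀ x, (stripChain L β).act x ω = ω + dl x from fun _ => rfl,
    show ∀ x, (spm L β).act x ω = ω + dl x from fun _ => rfl]
  rw [← sub_div, ← Finset.sum_sub_distrib, abs_div, abs_of_pos (show 0 < wt β ω from Real.exp_pos _)]
  refine div_le_div_of_nonneg_right ?_ (show 0 < wt β ω from Real.exp_pos _).le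
  refine (Finset.abs_sum_le_sum_abs _ _).trans (Finset.sum_le_sum fun x _ => ?_)
  rw [← sub_mul, abs_mul]
  refine mul_le_of_le_one_right (abs_nonneg _) ?_
  rw [abs_le]
  constructor <;> linarith [h0 ω, h1 ω, h0 (ω + dl x), h1 (ω + dl x)]

/-- Functions vanishing on strips. -/
def offStrip (L : ℕ) [NeZero L] : Submodule ℝ (Cfg L → ℝ) where
  carrier := {f | ∀ ω, IsStrip ω → f ω = 0}
  add_mem' hf hg ω h := by simp [hf ω h, hg ω h]
  zero_mem' ω _ := rfl
  smul_mem' c f hf ω h := by simp [hf ω h]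

lemma offStrip_gen_mem (β : ℝ) {f : Cfg L → ℝ} (hf : f ∈ offStrip L) :
    (stripChain L β).gen *ᵥ f ∈ offStrip L := by
  intro ω h
  rw [RevChain.gen_mulVec, Finset.sum_eq_zero, zero_div]
  intro x _
  simp only [stripChain]
  split_ifs with hx
  · rw [hf ω h, hf _ hx.isStrip.2]; ring
  · ring

lemma sg_strip_congr (β t : ℝ) {f g : Cfg L → ℝ} (h : ∀ ω, IsStrip ω → f ω = g ω) {σ : Cfg L}
    (hσ : IsStrip σ) : sg (stripChain L β).gen t f σ = sg (stripChain L β).gen t g σ := by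
  have hm : f - g ∈ offStrip L := fun ω hω => by simp [h ω hω]
  have := sg_mem _ (offStrip L) (fun _ h => offStrip_gen_mem β h) t (f - g) hm σ hσ
  rw [sg_sub, Pi.sub_apply] at this
  linarith

/-- The strip dynamics started at a ground state is dominated by its equilibrium for
gauge-invariant observables. -/
lemma card_mul_sg_le (β : ℝ) {t : ℝ} (ht : 0 ≤ t) {f : Cfg L → ℝ} (hf0 : ∀ ω, 0 ≤ f ω)
    (hf : ∀ τ, bd τ = 0 → ∀ ω, f (ω + τ) = f ω) {σ : Cfg L} (hσ : bd σ = 0) :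
    (GS L).card * sg (stripChain L β).gen t f σ ≤ ∑ ω, wt β ω * f ω := by
  have hc : ∀ τ, bd τ = 0 → ∀ ω, sg (stripChain L β).gen t f (ω + τ) = sg (stripChain L β).gen t f ω := by
    intro τ hτ ω
    have h1 : f ∈ twist τ 1 := mem_twist.2 fun ω => by rw [hf τ hτ ω, one_mul]
    have h2 := mem_twist.1 ((stripChain_inv β hτ).sg_mem h1 t) ω
    rwa [one_mul] at h2
  have hge : ∀ ω, 0 ≤ sg (stripChain L β).gen t f ω := (stripChain L β).isGen.sg_nonneg ht hf0
  have h1 : ∑ ω, wt β ω * sg (stripChain L β).gen t f ω = ∑ ω, wt β ω * f ω := by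
    have := (stripChain L β).ip_one_sg t f
    simp only [RevChain.ip, Pi.one_apply, mul_one] at this
    exact this
  rw [← h1]
  calc _ = ∑ ω ∈ GS L, sg (stripChain L β).gen t f ω := by
        rw [← nsmul_eq_mul, ← Finset.sum_const]
        refine Finset.sum_congr rfl fun ω hω => ?_
        have := hc (σ + ω) (by rw [map_add, hσ, mem_GS.1 hω, add_zero]) ω
        rw [← this]
        congr 1
        have h2 := cfg_two (L := L)
        grind
    _ = ∑ ω ∈ GS L, wt β ω * sg (stripChain L β).gen t f ω := by
        refine Finset.sum_congr rfl fun ω hω => ?_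
        rw [wt_of_bd_eq_zero (mem_GS.1 hω), one_mul]
    _ ≤ _ := Finset.sum_le_univ_sum_of_nonneg fun ω => mul_nonneg (Real.exp_pos _).le (hge ω)

lemma discr_add (β : ℝ) {τ : Cfg L} (hτ : bd τ = 0) (ω : Cfg L) : discr β (ω + τ) = discr β ω := by
  simp only [discr, (stripChain_inv β hτ).q, (spm_inv β hτ).q, wt_add_of_bd_eq_zero hτ]

lemma sg_discr_le (hL : 3 ≤ L) {β : ℝ} (hβ : 0 ≤ β) {t : ℝ} (ht : 0 ≤ t) {σ : Cfg L} (hσ : bd σ = 0) :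
    sg (stripChain L β).gen t (discr β) σ ≤
      2 * (L : ℝ) ^ 3 * ((L : ℝ) ^ 2 * Real.exp (-(8 * β)) + 16 * Real.exp (-(6 * β))) := by
  set c := (L : ℝ) ^ 2 * Real.exp (-(8 * β)) + 16 * Real.exp (-(6 * β)) with hc
  have hc0 : 0 ≤ c := by positivity
  rw [sg_strip_congr β t (g := fun ω => if IsStrip ω then discr β ω else 0)
    (fun ω h => (if_pos h).symm) (isStrip_of_bd_eq_zero hσ)]
  have hG := card_GS_pos (L := L)
  refine le_of_mul_le_mul_left ?_ hG
  refine (card_mul_sg_le β ht (fun ω => ?_) (fun τ hτ ω => ?_) hσ).trans ?_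
  · split_ifs
    · exact discr_nonneg β ω
    · exact le_rfl
  · simp only [IsStrip.add hτ, discr_add β hτ]
  have e : ∀ ω : Cfg L, wt β ω * (if IsStrip ω then discr β ω else 0)
      = if IsStrip ω ∧ bd ω ≠ 0 then ∑ x, |(stripChain L β).q ω x - (spm L β).q ω x| else 0 := by
    intro ω
    have hw : 0 < wt β ω := Real.exp_pos _
    by_cases h1 : IsStrip ω
    · by_cases h2 : bd ω = 0
      · simp [h2, discr, q_eq_q_of_bd_eq_zero (show 2 ≤ L by omega) β h2]
      · rw [if_pos h1, if_pos ⟨h1, h2⟩, discr]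
        field_simp
    · simp [h1]
  rw [Finset.sum_congr rfl fun ω _ => e ω]
  refine (sum_strip_le _ fun ω => Finset.sum_nonneg fun _ _ => abs_nonneg _).trans ?_
  refine (lineSum_mono (G := fun o p σ => (L : ℝ) * c) fun o p σ hσ => ?_).trans (le_of_eq ?_)
  · refine (Finset.sum_le_card_nsmul _ _ c fun n hn => ?_).trans ?_
    · rw [Finset.mem_Ico] at hn
      exact sum_abs_q_sub_q_le hL hβ (mem_GS.1 hσ) o p hn.1 hn.2
    · rw [nsmul_eq_mul, Nat.card_Ico]
      refine mul_le_mul_of_nonneg_right ?_ hc0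
      exact_mod_cast Nat.sub_le L 1
  · rw [lineSum_const, Finset.sum_const, nsmul_eq_mul]
    ring

/-- The full dynamics follows the strip dynamics. -/
lemma abs_sg_strip_sub_sg_le (hL : 3 ≤ L) {β : ℝ} (hβ : 0 ≤ β) {t : ℝ} (ht : 0 ≤ t)
    {f : Cfg L → ℝ} (h0 : ∀ i, 0 ≤ f i) (h1 : ∀ i, f i ≤ 1) {σ : Cfg L} (hσ : bd σ = 0) :
    |sg (stripChain L β).gen t f σ - sg (spm L β).gen t f σ| ≤
      2 * (L : ℝ) ^ 3 * ((L : ℝ) ^ 2 * Real.exp (-(8 * β)) + 16 * Real.exp (-(6 * β))) * t :=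
  abs_sg_sub_sg_le (spm L β).isGen (stripChain L β).isGen (discr β)
    (fun g h0 h1 i => abs_gen_sub_gen_le β g h0 h1 i) ht f h0 h1 σ _
    fun _ hs _ => sg_discr_le hL hβ hs hσ

end Comparison

section SecondMoment

variable {Ω ι : Type*} [Fintype Ω]

/-- The bilinear observable on two disjoint sets of signs. -/
def bil (A B : Finset ι) (a : ι → Ω → ℝ) (ω : Ω) : ℝ := ∑ i ∈ A, ∑ j ∈ B, a i ω * a j ω

lemma sum_mul_bil (A B : Finset ι) (a : ι → Ω → ℝ) (p : Ω → ℝ) :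
    ∑ ω, p ω * bil A B a ω = ∑ i ∈ A, ∑ j ∈ B, ∑ ω, p ω * (a i ω * a j ω) := by
  simp only [bil, Finset.mul_sum]
  rw [Finset.sum_comm]
  exact Finset.sum_congr rfl fun i _ => Finset.sum_comm

lemma sum_mul_bil_sq (A B : Finset ι) (a : ι → Ω → ℝ) (p : Ω → ℝ) :
    ∑ ω, p ω * bil A B a ω ^ 2 = ∑ i ∈ A, ∑ i' ∈ A, ∑ j ∈ B, ∑ j' ∈ B,
      ∑ ω, p ω * (a i ω * a i' ω * (a j ω * a j' ω)) := by
  have h : ∀ ω, p ω * bil A B a ω ^ 2 = ∑ i ∈ A, ∑ i' ∈ A, ∑ j ∈ B, ∑ j' ∈ B,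
      p ω * (a i ω * a i' ω * (a j ω * a j' ω)) := by
    intro ω
    have : bil A B a ω = (∑ i ∈ A, a i ω) * ∑ j ∈ B, a j ω := by
      rw [bil, Finset.sum_mul_sum]
    simp only [← Finset.mul_sum, ← Finset.sum_mul]
    rw [this]
    ring
  rw [Finset.sum_congr rfl fun ω _ => h ω, Finset.sum_comm]
  refine Finset.sum_congr rfl fun i _ => ?_
  rw [Finset.sum_comm]
  refine Finset.sum_congr rfl fun i' _ => ?_
  rw [Finset.sum_comm]
  refine Finset.sum_congr rfl fun j _ => ?_
  rw [Finset.sum_comm]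

lemma second_moment_le {A B : Finset ι} (hAB : Disjoint A B) {h : ℕ} (hA : A.card = h)
    (hB : B.card = h) {a : ι → Ω → ℝ} (ha : ∀ i ω, a i ω * a i ω = 1) {p : Ω → ℝ}
    (h1 : ∑ ω, p ω = 1) {E2 E4 : ℝ} (hE2 : 0 ≤ E2) (hE4 : 0 ≤ E4)
    (h2 : ∀ i j, i ≠ j → ∑ ω, p ω * (a i ω * a j ω) ≤ E2)
    (h4 : ∀ i i' j j', i ≠ i' → i ≠ j → i ≠ j' → i' ≠ j → i' ≠ j' → j ≠ j' →
      ∑ ω, p ω * (a i ω * a i' ω * (a j ω * a j' ω)) ≤ E4) :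
    ∑ ω, p ω * bil A B a ω ^ 2 ≤ (h : ℝ) ^ 4 * E4 + 2 * h ^ 3 * E2 + h ^ 2 := by
  rw [sum_mul_bil_sq]
  calc _ ≤ ∑ i ∈ A, ∑ i' ∈ A, ∑ j ∈ B, ∑ j' ∈ B, (E4 + (if i = i' then E2 else 0)
        + (if j = j' then E2 else 0) + if i = i' then (if j = j' then 1 else 0) else 0) := by
        refine Finset.sum_le_sum fun i hi => Finset.sum_le_sum fun i' hi' =>
          Finset.sum_le_sum fun j hj => Finset.sum_le_sum fun j' hj' => ?_
        have hne : ∀ {i j}, i ∈ A → j ∈ B → i ≠ j := fun hi hj h =>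
          Finset.disjoint_left.1 hAB hi (h ▸ hj)
        by_cases e1 : i = i'
        · subst e1
          by_cases e2 : j = j'
          · subst e2
            simp only [ha, mul_one, h1, if_true]
            linarith
          · simp only [ha, one_mul, if_true, if_neg e2]
            linarith [h2 j j' e2]
        · by_cases e2 : j = j'
          · subst e2
            simp only [ha, mul_one, if_true, if_neg e1]
            linarith [h2 i i' e1]
          · simp only [if_neg e1, if_neg e2]
            linarith [h4 i i' j j' e1 (hne hi hj) (hne hi hj') (hne hi' hj) (hne hi' hj') e2]
    _ = _ := by
        have s1 : ∀ (S : Finset ι) (c : ℝ), ∑ i ∈ S, ∑ i' ∈ S, (if i = i' then c else 0) = S.card * c := by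
          intro S c
          rw [← nsmul_eq_mul, ← Finset.sum_const]
          refine Finset.sum_congr rfl fun i hi => ?_
          rw [Finset.sum_ite_eq, if_pos hi]
        simp only [Finset.sum_add_distrib, Finset.sum_const, nsmul_eq_mul, hA, hB]
        have s2 : ∀ i i' : ι, ∑ j ∈ B, ∑ j' ∈ B, (if i = i' then (if j = j' then (1 : ℝ) else 0) else 0)
            = if i = i' then (h : ℝ) else 0 := by
          intro i i'
          split_ifs
          · rw [s1, hB, mul_one]
          · simp
        simp only [s2, s1, hA, hB, ← Finset.mul_sum]
        ring

lemma sum_ite_bil_le {A B : Finset ι} {h : ℕ} (hh : 1 ≤ h) (hA : A.card = h) (hB : B.card = h)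
    {a : ι → Ω → ℝ} {p : Ω → ℝ} (hp : ∀ ω, 0 ≤ p ω) (h1 : ∑ ω, p ω = 1) {m M : ℝ} (hm : 0 < m)
    (h2 : ∀ i ∈ A, ∀ j ∈ B, m ≤ ∑ ω, p ω * (a i ω * a j ω))
    (hM : ∑ ω, p ω * bil A B a ω ^ 2 ≤ M) :
    ∑ ω, p ω * (if (h : ℝ) ^ 2 * m / 2 < bil A B a ω then 0 else 1)
      ≤ 4 * (M / (h : ℝ) ^ 4 / m ^ 2 - 1) := by
  have hh' : (0 : ℝ) < h := by exact_mod_cast hh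
  set k := (h : ℝ) ^ 2 * m with hk
  have hk0 : 0 < k := by positivity
  have hmean : k ≤ ∑ ω, p ω * bil A B a ω := by
    rw [sum_mul_bil]
    calc k = ∑ i ∈ A, ∑ j ∈ B, m := by
          simp only [Finset.sum_const, nsmul_eq_mul, hA, hB, hk]; ring
      _ ≤ _ := Finset.sum_le_sum fun i hi => Finset.sum_le_sum fun j hj => h2 i hi j hj
  calc _ ≤ ∑ ω, (4 / k ^ 2 * (p ω * bil A B a ω ^ 2) - 8 / k * (p ω * bil A B a ω) + 4 * p ω) := by
        refine Finset.sum_le_sum fun ω _ => ?_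
        have e : 4 / k ^ 2 * (p ω * bil A B a ω ^ 2) - 8 / k * (p ω * bil A B a ω) + 4 * p ω
            = p ω * (2 * (bil A B a ω - k) / k) ^ 2 := by field_simp; ring
        rw [e]
        refine mul_le_mul_of_nonneg_left ?_ (hp ω)
        split_ifs with hY
        · positivity
        · rw [not_lt] at hY
          have : 2 * (bil A B a ω - k) / k ≤ -1 := by
            rw [div_le_iff₀ hk0]; linarith
          nlinarith
    _ = 4 / k ^ 2 * (∑ ω, p ω * bil A B a ω ^ 2) - 8 / k * (∑ ω, p ω * bil A B a ω) + 4 := by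
        rw [Finset.sum_add_distrib, Finset.sum_sub_distrib, ← Finset.mul_sum, ← Finset.mul_sum,
          ← Finset.mul_sum, h1, mul_one]
    _ ≤ 4 / k ^ 2 * M - 8 / k * k + 4 := by gcongr
    _ = _ := by rw [hk]; field_simp; ring

lemma sum_ite_lt_bil_le {A B : Finset ι} {a : ι → Ω → ℝ} {p : Ω → ℝ} (hp : ∀ ω, 0 ≤ p ω) {k M : ℝ}
    (hk : 0 < k) (hM : ∑ ω, p ω * bil A B a ω ^ 2 ≤ M) :
    ∑ ω, p ω * (if k < bil A B a ω then 1 else 0) ≤ M / k ^ 2 := by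
  calc _ ≤ ∑ ω, (p ω * bil A B a ω ^ 2) / k ^ 2 := by
        refine Finset.sum_le_sum fun ω _ => ?_
        rw [mul_div_assoc]
        refine mul_le_mul_of_nonneg_left ?_ (hp ω)
        split_ifs with hY
        · rw [one_le_div (by positivity)]
          exact pow_le_pow_left₀ hk.le hY.le 2
        · positivity
    _ = (∑ ω, p ω * bil A B a ω ^ 2) / k ^ 2 := by rw [Finset.sum_div]
    _ ≤ _ := by gcongr

lemma sum_sub_le_tv {μ ν f : Ω → ℝ} (hμ : ∑ ω, μ ω = 1) (hν : ∑ ω, ν ω = 1) (h0 : ∀ ω, 0 ≤ f ω)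
    (h1 : ∀ ω, f ω ≤ 1) : ∑ ω, μ ω * f ω - ∑ ω, ν ω * f ω ≤ tv μ ν := by
  have h : ∑ ω, (μ ω - ν ω) * (2 * f ω - 1) ≤ ∑ ω, |μ ω - ν ω| := by
    refine Finset.sum_le_sum fun ω _ => (le_abs_self _).trans ?_
    rw [abs_mul]
    refine mul_le_of_le_one_right (abs_nonneg _) ?_
    rw [abs_le]
    constructor <;> linarith [h0 ω, h1 ω]
  have e : ∑ ω, (μ ω - ν ω) * (2 * f ω - 1) = 2 * (∑ ω, μ ω * f ω - ∑ ω, ν ω * f ω) := by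
    have : ∀ ω, (μ ω - ν ω) * (2 * f ω - 1) = 2 * (μ ω * f ω - ν ω * f ω) - (μ ω - ν ω) :=
      fun ω => by ring
    rw [Finset.sum_congr rfl fun ω _ => this ω, Finset.sum_sub_distrib, ← Finset.mul_sum,
      Finset.sum_sub_distrib, Finset.sum_sub_distrib, hμ, hν]
    ring
  rw [tv]
  linarith

end SecondMoment

section Correlations

variable {L : ℕ} [NeZero L]

lemma sector_sq_le (β : ℝ) {X : Finset (ZMod L ⊕ ZMod L)} {F : Cfg L → ℝ} (hF : F ∈ sector X)
    {σ : Cfg L} (hσ : bd σ = 0) : (GS L).card * F σ ^ 2 ≤ (stripChain L β).ip F F := by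
  have h2 : (0 : ℝ) < 2 ^ (2 * L) := by positivity
  have hm := mult_pos (L := L)
  have hG := card_GS_pos (L := L)
  have h : (stripChain L β).ip (comp X σ) F = 2 ^ (2 * L) * F σ := by
    have e1 : (stripChain L β).ip F (∑ Y, comp Y σ) = (stripChain L β).ip F (comp X σ) := by
      rw [RevChain.ip_sum_right, Finset.sum_eq_single X]
      · intro Y _ hY
        exact sector_ip_eq_zero β (Ne.symm hY) hF (comp_mem Y hσ)
      · simp
    rw [RevChain.ip_comm, ← e1, sum_comp, RevChain.ip_smul_right]
    congr 1
    simp only [RevChain.ip, Pi.single_apply, mul_ite, mul_one, mul_zero]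
    rw [Finset.sum_ite_eq', if_pos (Finset.mem_univ _),
      show (stripChain L β).w σ = 1 from wt_of_bd_eq_zero hσ β, one_mul]
  have h3 := (stripChain L β).ip_sq_le (comp X σ) F
  rw [h] at h3
  have h4 := h3.trans (mul_le_mul_of_nonneg_right (ip_comp_le β X hσ)
    ((stripChain L β).ip_self_nonneg F))
  rw [← mult_mul_card] at h4
  generalize (stripChain L β).ip F F = I at *
  have h5 : mult L ^ 2 * (GS L).card * ((GS L).card * F σ ^ 2) ≤ mult L ^ 2 * (GS L).card * I := by
    linarith
  exact le_of_mul_le_mul_left h5 (by positivity)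

/-- The product of the spins of a set of columns on the bottom row. -/
def colProd (X : Finset (ZMod L)) (ω : Cfg L) : ℝ := ∏ i ∈ X, sgn (ω (i, 0))

lemma abs_colProd (X : Finset (ZMod L)) (ω : Cfg L) : |colProd X ω| = 1 := by
  simp [colProd, Finset.abs_prod, abs_sgn]

lemma colProd_add (X : Finset (ZMod L)) (ω τ : Cfg L) :
    colProd X (ω + τ) = colProd X τ * colProd X ω := by
  simp only [colProd, Pi.add_apply, sgn_add, Finset.prod_mul_distrib, mul_comm]

lemma colProd_inl (X : Finset (ZMod L)) (c : ZMod L) :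
    colProd X (lineCfg (.inl c)) = if c ∈ X then -1 else 1 := by
  have : ∀ i, sgn (lineCfg (.inl c) ((i, 0) : Tor L)) = if i = c then -1 else 1 := by
    intro i
    rw [lineCfg_eq_gaugeCfg, gaugeCfg_apply]
    by_cases h : i = c
    · subst h; simp [sgn_one]
    · simp [h, sgn_zero]
  simp only [colProd, this, Finset.prod_ite_eq']

lemma colProd_inr {X : Finset (ZMod L)} (hX : Even X.card) (c : ZMod L) :
    colProd X (lineCfg (.inr c)) = 1 := by
  have : ∀ i, sgn (lineCfg (.inr c) ((i, 0) : Tor L)) = if 0 = c then -1 else 1 := by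
    intro i
    rw [lineCfg_eq_gaugeCfg, gaugeCfg_apply]
    by_cases h : 0 = c
    · subst h; simp [sgn_one]
    · simp [h, sgn_zero]
  simp only [colProd, this, Finset.prod_const]
  split_ifs
  · exact hX.neg_one_pow
  · exact one_pow _

/-- The restriction of a function to strips. -/
def onStrip (f : Cfg L → ℝ) (ω : Cfg L) : ℝ := if IsStrip ω then f ω else 0

lemma onStrip_colProd_mem {X : Finset (ZMod L)} (hX : Even X.card) :
    onStrip (colProd X) ∈ sector (X.map Function.Embedding.inl) := by
  refine ⟨fun ω h => if_neg h, fun i ω => ?_⟩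
  have hi : colProd X (lineCfg i) = if i ∈ X.map Function.Embedding.inl then -1 else 1 := by
    cases i with
    | inl c => rw [colProd_inl]; simp
    | inr c => rw [colProd_inr hX]; simp
  simp only [onStrip, IsStrip.add (bd_lineCfg i), colProd_add, hi]
  split_ifs <;> simp

/-- The total weight of the strips. -/
lemma sum_wt_isStrip_le (β : ℝ) : ∑ ω : Cfg L, (if IsStrip ω then wt β ω else 0)
    ≤ (1 + 2 * (L : ℝ) ^ 3 * Real.exp (-(4 * β))) * (GS L).card := by
  have h := sum_wt_strip_const_le (L := L) β zero_le_one
  have e : ∀ ω : Cfg L, (if IsStrip ω then wt β ω else 0)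
      = wt β ω * gind ω + if IsStrip ω ∧ bd ω ≠ 0 then wt β ω * 1 else 0 := by
    intro ω
    unfold gind
    by_cases h : bd ω = 0
    · simp [h, isStrip_of_bd_eq_zero h]
    · simp [h]
  rw [Finset.sum_congr rfl fun ω _ => e ω, Finset.sum_add_distrib, sum_wt_gind]
  linarith

lemma ip_onStrip_le (β : ℝ) {f : Cfg L → ℝ} (hf : ∀ ω, |f ω| ≤ 1) :
    (stripChain L β).ip (onStrip f) (onStrip f)
      ≤ (1 + 2 * (L : ℝ) ^ 3 * Real.exp (-(4 * β))) * (GS L).card := by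
  refine le_trans (Finset.sum_le_sum fun ω _ => ?_) (sum_wt_isStrip_le β)
  unfold onStrip
  split_ifs
  · have hw : 0 < wt β ω := Real.exp_pos _
    rw [mul_assoc, show (stripChain L β).w ω = wt β ω from rfl]
    refine mul_le_of_le_one_right hw.le ?_
    have := abs_le.1 (hf ω)
    nlinarith
  · simp

lemma sg_colProd_le (hL : 2 ≤ L) (β : ℝ) {X : Finset (ZMod L)} (hX : Even X.card) {t : ℝ}
    (ht : 0 ≤ t) {σ : Cfg L} (hσ : bd σ = 0) : sg (stripChain L β).gen t (colProd X) σ ≤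
      Real.exp (-(X.card * rate L β * t)) * √(1 + 2 * (L : ℝ) ^ 3 * Real.exp (-(4 * β))) := by
  have hG := card_GS_pos (L := L)
  rw [sg_strip_congr β t (g := onStrip (colProd X)) (fun ω h => (if_pos h).symm)
    (isStrip_of_bd_eq_zero hσ)]
  have hmem := onStrip_colProd_mem hX
  have h1 := sector_sq_le β (sector_sg_mem β hmem t) hσ
  have h2 := sector_decay hL β hmem ht
  have h3 := ip_onStrip_le β (f := colProd X) fun ω => (abs_colProd X ω).le
  rw [Finset.card_map] at h2
  have h4 := h1.trans (h2.trans (mul_le_mul_of_nonneg_left h3 (Real.exp_pos _).le))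
  generalize sg (stripChain L β).gen t (onStrip (colProd X)) σ = y at *
  refine le_trans (Real.le_sqrt_of_sq_le (y := Real.exp (-(X.card * rate L β * t)) ^ 2 *
    (1 + 2 * (L : ℝ) ^ 3 * Real.exp (-(4 * β)))) ?_) (le_of_eq ?_)
  · rw [← Real.exp_nat_mul, show ((2 : ℕ) : ℝ) * -(X.card * rate L β * t)
      = -2 * (X.card * rate L β) * t by push_cast; ring]
    refine le_of_mul_le_mul_left ?_ hG
    linarith
  · rw [Real.sqrt_mul (by positivity), Real.sqrt_sq (Real.exp_pos _).le]

lemma sum_wt_colProd (β : ℝ) {X : Finset (ZMod L)} (hX : X.Nonempty) :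
    ∑ ω : Cfg L, wt β ω * colProd X ω = 0 := by
  obtain ⟨c, hc⟩ := hX
  have h : ∑ ω : Cfg L, wt β ω * colProd X ω = ∑ ω : Cfg L, -(wt β ω * colProd X ω) := by
    refine Eq.trans (Equiv.sum_comp (Equiv.addRight (lineCfg (.inl c)))
      fun ω : Cfg L => wt β ω * colProd X ω).symm (Finset.sum_congr rfl fun ω _ => ?_)
    simp only [Equiv.coe_addRight, colProd_add, colProd_inl, if_pos hc,
      wt_add_of_bd_eq_zero (bd_lineCfg (Sum.inl c))]
    ring
  rw [Finset.sum_neg_distrib] at h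
  linarith

/-- Truncation to `[-1, 1]`. -/
def clamp (x : ℝ) : ℝ := max (-1) (min 1 x)

lemma abs_clamp_le (x : ℝ) : |clamp x| ≤ 1 :=
  abs_le.2 ⟨le_max_left _ _, max_le (by norm_num) (min_le_left _ _)⟩

lemma clamp_neg (x : ℝ) : clamp (-x) = -clamp x := by
  unfold clamp
  rcases le_total x 1 with h1 | h1 <;> rcases le_total (-1) x with h2 | h2 <;>
    simp only [min_def, max_def] <;> split_ifs <;> linarith

lemma clamp_of_one_le {x : ℝ} (h : 1 ≤ x) : clamp x = 1 := by
  rw [clamp, min_eq_left h, max_eq_right (by norm_num)]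

lemma abs_clamp_sub_le (x y : ℝ) : |clamp x - clamp y| ≤ |x - y| := by
  unfold clamp
  refine (abs_max_sub_max_le_max _ _ _ _).trans (max_le (by simp) ?_)
  exact (abs_min_sub_min_le_max _ _ _ _).trans (max_le (by simp) le_rfl)

lemma clamp_sgn_mul (a : ZMod 2) (x : ℝ) : clamp (sgn a * x) = sgn a * clamp x := by
  unfold sgn
  split_ifs
  · simp
  · simp [clamp_neg]

/-- The agreement of two columns. -/
def agree (i j : ZMod L) (ω : Cfg L) : ℝ := ∑ y, sgn (ω (i, y) + ω (j, y))

lemma agree_add {σ : Cfg L} (hσ : bd σ = 0) (i j : ZMod L) (ω : Cfg L) :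
    agree i j (ω + σ) = sgn (σ (i, 0) + σ (j, 0)) * agree i j ω := by
  obtain ⟨g, rfl⟩ := exists_eq_gaugeCfg hσ
  rw [agree, agree, Finset.mul_sum]
  refine Finset.sum_congr rfl fun y _ => ?_
  rw [← sgn_add]
  congr 1
  simp only [Pi.add_apply, gaugeCfg_apply]
  grind

lemma abs_agree_add_dl_sub_le (i j : ZMod L) (ω : Cfg L) (x : Tor L) :
    |agree i j (ω + dl x) - agree i j ω| ≤ 2 := by
  rw [agree, agree, ← Finset.sum_sub_distrib, Finset.sum_eq_single x.2]
  · have h1 := abs_le.1 (abs_sgn ((ω + dl x) (i, x.2) + (ω + dl x) (j, x.2))).le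
    have h2 := abs_le.1 (abs_sgn (ω (i, x.2) + ω (j, x.2))).le
    rw [abs_le]
    constructor <;> linarith
  · intro y _ hy
    have : ∀ k, dl x (k, y) = 0 := by
      intro k
      obtain ⟨u, v⟩ := x
      simp only at hy
      simp [dl_apply, hy]
    simp [this]
  · simp

lemma le_agree_of_row {i j b : ZMod L} {ω : Cfg L} (h : ∀ k y, y ≠ b → ω (k, y) = 0) :
    (L : ℝ) - 2 ≤ agree i j ω := by
  have h1 : ∀ y, y ∈ Finset.univ.erase b → sgn (ω (i, y) + ω (j, y)) = 1 := by
    intro y hy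
    rw [h i y (Finset.ne_of_mem_erase hy), h j y (Finset.ne_of_mem_erase hy), add_zero, sgn_zero]
  rw [agree, ← Finset.add_sum_erase _ _ (Finset.mem_univ b), Finset.sum_congr rfl h1]
  simp only [Finset.sum_const, Finset.card_erase_of_mem (Finset.mem_univ b), Finset.card_univ,
    ZMod.card, nsmul_eq_mul, mul_one]
  have := (abs_le.1 (abs_sgn (ω (i, b) + ω (j, b))).le).1
  rw [Nat.cast_sub (NeZero.one_le), Nat.cast_one]
  linarith

/-- A smoothed version of the product of the signs of two columns. -/
def smooth (i j : ZMod L) (ω : Cfg L) : ℝ := clamp (agree i j ω / (L - 2))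

lemma smooth_add {σ : Cfg L} (hσ : bd σ = 0) (i j : ZMod L) (ω : Cfg L) :
    smooth i j (ω + σ) = sgn (σ (i, 0) + σ (j, 0)) * smooth i j ω := by
  rw [smooth, agree_add hσ, mul_div_assoc, clamp_sgn_mul, smooth]

lemma smooth_of_le (hL : 3 ≤ L) {i j : ZMod L} {ω : Cfg L} (h : (L : ℝ) - 2 ≤ agree i j ω) :
    smooth i j ω = 1 := by
  have : (3 : ℝ) ≤ L := by exact_mod_cast hL
  refine clamp_of_one_le ?_
  rwa [one_le_div (by linarith)]

lemma smooth_zero (hL : 3 ≤ L) (i j : ZMod L) : smooth i j 0 = 1 :=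
  smooth_of_le hL (le_agree_of_row (b := 0) fun _ _ _ => rfl)

lemma smooth_of_bd_eq_zero (hL : 3 ≤ L) {σ : Cfg L} (hσ : bd σ = 0) (i j : ZMod L) :
    smooth i j σ = sgn (σ (i, 0) + σ (j, 0)) := by
  have := smooth_add hσ i j 0
  rwa [zero_add, smooth_zero hL, mul_one] at this

lemma smooth_str_true (hL : 3 ≤ L) (i j : ZMod L) (p : Tor L) (n : ℕ) :
    smooth i j (str true p n) = 1 := by
  refine smooth_of_le hL (le_agree_of_row (b := p.2) fun k y hy => ?_)
  rw [str, Finset.sum_apply]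
  refine Finset.sum_eq_zero fun m _ => ?_
  rw [add_smul_true]
  simp [dl_apply, hy]

lemma smooth_str_false (hL : 3 ≤ L) {i j : ZMod L} {p : Tor L} (h1 : p.1 ≠ i) (h2 : p.1 ≠ j) (n : ℕ) :
    smooth i j (str false p n) = 1 := by
  have h : agree i j (str false p n) = L := by
    have : ∀ {k}, p.1 ≠ k → ∀ y, str false p n (k, y) = 0 := by
      intro k hk y
      rw [str, Finset.sum_apply]
      refine Finset.sum_eq_zero fun m _ => ?_
      rw [add_smul_false]
      simp [dl_apply, hk.symm]
    simp [agree, this h1, this h2, sgn_zero, Finset.card_univ, ZMod.card]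
  exact smooth_of_le hL (by rw [h]; linarith)

lemma sq_smooth_str_succ_sub_le (hL : 3 ≤ L) (i j : ZMod L) (o : Bool) (p : Tor L) (n : ℕ) :
    (smooth i j (str o p (n + 1)) - smooth i j (str o p n)) ^ 2 ≤
      if o = false ∧ (p.1 = i ∨ p.1 = j) then (2 / ((L : ℝ) - 2)) ^ 2 else 0 := by
  have h3 : (3 : ℝ) ≤ L := by exact_mod_cast hL
  split_ifs with h
  · rw [← sq_abs]
    refine pow_le_pow_left₀ (abs_nonneg _) ((abs_clamp_sub_le _ _).trans ?_) 2
    rw [← sub_div, abs_div, abs_of_pos (show 0 < (L : ℝ) - 2 by linarith), str_succ]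
    gcongr
    · linarith
    · exact abs_agree_add_dl_sub_le i j _ _
  · cases o
    · simp only [true_and, not_or] at h
      rw [smooth_str_false hL h.1 h.2, smooth_str_false hL h.1 h.2]
      norm_num
    · rw [smooth_str_true hL, smooth_str_true hL]
      norm_num

lemma dir_onStrip_smooth_le (hL : 3 ≤ L) (β : ℝ) (i j : ZMod L) :
    (stripChain L β).dir (onStrip (smooth i j)) ≤
      8 * Real.exp (-(4 * β)) * ((L : ℝ) / (L - 2)) ^ 2 * (GS L).card := by
  have h3 : (3 : ℝ) ≤ L := by exact_mod_cast hL
  refine (dir_le_lineSum β _).trans ?_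
  have e : Real.exp (-(4 * β)) * (2 * (L : ℝ) * (L * (2 / ((L : ℝ) - 2)) ^ 2) * (GS L).card)
      = 8 * Real.exp (-(4 * β)) * ((L : ℝ) / (L - 2)) ^ 2 * (GS L).card := by
    have : (L : ℝ) - 2 ≠ 0 := by linarith
    field_simp
    ring
  rw [← e]
  refine mul_le_mul_of_nonneg_left ?_ (Real.exp_pos _).le
  calc _ ≤ lineSum (fun o p _ => if o = false ∧ (p.1 = i ∨ p.1 = j)
        then (L : ℝ) * (2 / ((L : ℝ) - 2)) ^ 2 else 0) := by
        refine lineSum_mono fun o p σ hσ => ?_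
        have hσ := mem_GS.1 hσ
        have hs : ∀ n, n ≤ L → onStrip (smooth i j) (σ + str o p n)
            = sgn (σ (i, 0) + σ (j, 0)) * smooth i j (str o p n) := by
          intro n hn
          rw [onStrip, if_pos, add_comm, smooth_add hσ]
          exact ⟨o, p, n, hn, by rw [cfg_add_add_self]; exact hσ⟩
        refine (Finset.sum_le_card_nsmul _ _ (if o = false ∧ (p.1 = i ∨ p.1 = j)
          then (2 / ((L : ℝ) - 2)) ^ 2 else 0) fun n hn => ?_).trans (le_of_eq ?_)
        · rw [Finset.mem_range] at hn
          rw [hs n hn.le, hs (n + 1) hn, ← mul_sub, mul_pow, sq (sgn _), sgn_mul_self, one_mul]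
          exact sq_smooth_str_succ_sub_le hL i j o p n
        · rw [Finset.card_range, nsmul_eq_mul, mul_ite, mul_zero]
    _ ≤ _ := by
        set c := (L : ℝ) * (2 / ((L : ℝ) - 2)) ^ 2 with hc
        have hc0 : 0 ≤ c := by positivity
        simp only [lineSum, Finset.sum_const, nsmul_eq_mul, Fintype.sum_bool, Bool.true_eq_false,
          false_and, if_false, mul_zero, Finset.sum_const_zero, zero_add, true_and]
        rw [← Finset.mul_sum, mul_comm]
        refine mul_le_mul_of_nonneg_right ?_ (Nat.cast_nonneg _)
        rw [Fintype.sum_prod_type]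
        refine (Eq.le (b := ∑ u : ZMod L, ∑ _v : ZMod L, if u = i ∨ u = j then c else 0)
          (Finset.sum_congr rfl fun u _ => Finset.sum_congr rfl fun v _ => by congr)).trans ?_
        simp only [Finset.sum_const, Finset.card_univ, ZMod.card, nsmul_eq_mul]
        rw [← Finset.mul_sum]
        have : ∑ u : ZMod L, (if u = i ∨ u = j then c else 0)
            ≤ ∑ u : ZMod L, ((if u = i then c else 0) + if u = j then c else 0) := by
          refine Finset.sum_le_sum fun u _ => ?_
          by_cases h1 : u = i <;> by_cases h2 : u = j <;> simp [h1, h2] <;> split_ifs <;> linarith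
        rw [Finset.sum_add_distrib, Finset.sum_ite_eq', Finset.sum_ite_eq',
          if_pos (Finset.mem_univ _), if_pos (Finset.mem_univ _)] at this
        have h5 := mul_le_mul_of_nonneg_left this (Nat.cast_nonneg (α := ℝ) L)
        linarith

end Correlations

section LowerBound

variable {L : ℕ} [NeZero L]

lemma onStrip_smooth_add {τ : Cfg L} (hτ : bd τ = 0) (i j : ZMod L) (ω : Cfg L) :
    onStrip (smooth i j) (ω + τ) = sgn (τ (i, 0) + τ (j, 0)) * onStrip (smooth i j) ω := by
  simp only [onStrip, IsStrip.add hτ, smooth_add hτ]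
  split_ifs <;> simp

lemma abs_onStrip_smooth_le (i j : ZMod L) (ω : Cfg L) : |onStrip (smooth i j) ω| ≤ 1 := by
  unfold onStrip
  split_ifs
  · exact abs_clamp_le _
  · simp

lemma onStrip_smooth_of_bd_eq_zero (hL : 3 ≤ L) {σ : Cfg L} (hσ : bd σ = 0) (i j : ZMod L) :
    onStrip (smooth i j) σ = sgn (σ (i, 0) + σ (j, 0)) := by
  rw [onStrip, if_pos (isStrip_of_bd_eq_zero hσ), smooth_of_bd_eq_zero hL hσ]

lemma abs_sg_le_one (β : ℝ) {t : ℝ} (ht : 0 ≤ t) {f : Cfg L → ℝ} (hf : ∀ ω, |f ω| ≤ 1) (ω : Cfg L) :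
    |sg (stripChain L β).gen t f ω| ≤ 1 := by
  refine ((stripChain L β).isGen.sg_abs_le ht f ω).trans ?_
  have := (stripChain L β).isGen.sg_mono ht hf ω
  rwa [(stripChain L β).isGen.sg_const] at this

lemma ip_smooth_sg_le (hL : 3 ≤ L) (β : ℝ) {t : ℝ} (ht : 0 ≤ t) (i j : ZMod L) :
    (stripChain L β).ip (onStrip (smooth i j)) (sg (stripChain L β).gen t (onStrip (smooth i j)))
      ≤ (GS L).card * (sg (stripChain L β).gen t (onStrip (smooth i j)) 0
        + 2 * (L : ℝ) ^ 3 * Real.exp (-(4 * β))) := by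
  have hu : ∀ τ : Cfg L, bd τ = 0 → sg (stripChain L β).gen t (onStrip (smooth i j)) τ
      = sgn (τ (i, 0) + τ (j, 0)) * sg (stripChain L β).gen t (onStrip (smooth i j)) 0 := by
    intro τ hτ
    have h1 : onStrip (smooth i j) ∈ twist τ (sgn (τ (i, 0) + τ (j, 0))) :=
      mem_twist.2 (onStrip_smooth_add hτ i j)
    have := mem_twist.1 ((stripChain_inv β hτ).sg_mem h1 t) 0
    rwa [zero_add] at this
  have hle := abs_sg_le_one β ht (abs_onStrip_smooth_le (L := L) i j)
  generalize sg (stripChain L β).gen t (onStrip (smooth i j)) = u at *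
  have h := sum_wt_strip_const_le (L := L) β zero_le_one
  calc (stripChain L β).ip (onStrip (smooth i j)) u
      ≤ ∑ ω : Cfg L, (wt β ω * gind ω * u 0 + if IsStrip ω ∧ bd ω ≠ 0 then wt β ω * 1 else 0) := by
        refine Finset.sum_le_sum fun ω _ => ?_
        rw [show (stripChain L β).w ω = wt β ω from rfl, mul_assoc]
        have hw : 0 < wt β ω := Real.exp_pos _
        by_cases hb : bd ω = 0
        · rw [onStrip_smooth_of_bd_eq_zero hL hb, hu ω hb, ← mul_assoc (sgn _), sgn_mul_self]
          simp [gind, hb]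
        · by_cases hs : IsStrip ω
          · simp only [gind, hb, if_false, mul_zero, zero_mul, hs, ne_eq, not_false_eq_true,
              and_self, if_true, zero_add]
            refine mul_le_mul_of_nonneg_left ((le_abs_self _).trans ?_) hw.le
            rw [abs_mul]
            exact mul_le_one₀ (abs_onStrip_smooth_le i j ω) (abs_nonneg _) (hle ω)
          · simp [gind, hb, hs, onStrip]
    _ ≤ _ := by
        rw [Finset.sum_add_distrib, ← Finset.sum_mul, sum_wt_gind]
        linarith

lemma card_le_ip_smooth (hL : 3 ≤ L) (β : ℝ) (i j : ZMod L) :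
    ((GS L).card : ℝ) ≤ (stripChain L β).ip (onStrip (smooth i j)) (onStrip (smooth i j)) := by
  rw [← sum_wt_gind β]
  refine Finset.sum_le_sum fun ω _ => ?_
  rw [show (stripChain L β).w ω = wt β ω from rfl, mul_assoc]
  refine mul_le_mul_of_nonneg_left ?_ (Real.exp_pos _).le
  by_cases hb : bd ω = 0
  · rw [onStrip_smooth_of_bd_eq_zero hL hb, sgn_mul_self]
    simp [gind, hb]
  · simp only [gind, hb, if_false]
    exact mul_self_nonneg _

/-- An upper bound on the decay rate of the correlation between two columns. -/
def pairRate (L : ℕ) (β : ℝ) : ℝ := 8 * Real.exp (-(4 * β)) * ((L : ℝ) / (L - 2)) ^ 2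

lemma le_sg_smooth (hL : 3 ≤ L) (β : ℝ) {t : ℝ} (ht : 0 ≤ t) (i j : ZMod L) :
    Real.exp (-pairRate L β * t) - 2 * (L : ℝ) ^ 3 * Real.exp (-(4 * β))
      ≤ sg (stripChain L β).gen t (onStrip (smooth i j)) 0 := by
  have hG := card_GS_pos (L := L)
  have h1 := ip_smooth_sg_le hL β ht i j
  have h2 := card_le_ip_smooth hL β i j
  have h3 := dir_onStrip_smooth_le hL β i j
  have hI := hG.trans_le h2
  have h4 := (stripChain L β).exp_mul_ip_le_ip_sg ((stripChain L β).dir (onStrip (smooth i j)) /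
    (stripChain L β).ip (onStrip (smooth i j)) (onStrip (smooth i j))) ht (onStrip (smooth i j))
    (div_mul_cancel₀ _ hI.ne').symm
  generalize (stripChain L β).ip (onStrip (smooth i j)) (onStrip (smooth i j)) = I at *
  generalize (stripChain L β).dir (onStrip (smooth i j)) = D at *
  have h5 : D / I ≤ pairRate L β := by
    rw [div_le_iff₀ hI]
    exact h3.trans (mul_le_mul_of_nonneg_left h2 (by positivity))
  have h6 : Real.exp (-pairRate L β * t) * (GS L).card ≤ Real.exp (-(D / I) * t) * I :=
    mul_le_mul (Real.exp_le_exp.2 (by nlinarith)) h2 hG.le (Real.exp_pos _).le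
  have h7 := (h6.trans h4).trans h1
  rw [mul_comm] at h7
  have := le_of_mul_le_mul_left h7 hG
  linarith

lemma colProd_pair {i j : ZMod L} (h : i ≠ j) (ω : Cfg L) :
    colProd {i, j} ω = sgn (ω (i, 0)) * sgn (ω (j, 0)) := by
  rw [colProd, Finset.prod_pair h]

lemma le_sg_colProd (hL : 3 ≤ L) (β : ℝ) {t : ℝ} (ht : 0 ≤ t) {i j : ZMod L} (hij : i ≠ j) :
    Real.exp (-pairRate L β * t) - 6 * (L : ℝ) ^ 3 * Real.exp (-(4 * β))
      ≤ sg (stripChain L β).gen t (colProd {i, j}) 0 := by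
  have hG := card_GS_pos (L := L)
  have h0 : bd (0 : Cfg L) = 0 := map_zero _
  have h1 := le_sg_smooth hL β ht i j
  rw [sg_strip_congr β t (f := colProd {i, j}) (g := onStrip (colProd {i, j}))
    (fun ω h => (if_pos h).symm) (isStrip_of_bd_eq_zero h0)]
  set g : Cfg L → ℝ := fun ω => if IsStrip ω ∧ bd ω ≠ 0 then 2 else 0 with hg
  have hle : ∀ ω, onStrip (smooth i j) ω ≤ (onStrip (colProd {i, j}) + g) ω := by
    intro ω
    have a1 := abs_le.1 (abs_onStrip_smooth_le i j ω)
    simp only [Pi.add_apply, hg]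
    by_cases hs : IsStrip ω
    · by_cases hb : bd ω = 0
      · rw [onStrip_smooth_of_bd_eq_zero hL hb, onStrip, if_pos hs, colProd_pair hij, sgn_add]
        simp [hb]
      · rw [if_pos ⟨hs, hb⟩]
        have a2 := abs_le.1 (abs_colProd {i, j} ω).le
        have : onStrip (colProd {i, j}) ω = colProd {i, j} ω := if_pos hs
        linarith [a1.2, a2.1]
    · simp [onStrip, hs]
  have h2 := (stripChain L β).isGen.sg_mono ht hle 0
  rw [sg_linear_add, Pi.add_apply] at h2
  have h3 := card_mul_sg_le β ht (f := g) (fun ω => by simp only [hg]; split_ifs <;> norm_num)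
    (fun τ hτ ω => by simp only [hg, IsStrip.add hτ, map_add, hτ, add_zero]) h0
  have h4 := sum_wt_strip_const_le (L := L) β (zero_le_two (α := ℝ))
  have h5 : ∑ ω : Cfg L, wt β ω * g ω = ∑ ω : Cfg L, (if IsStrip ω ∧ bd ω ≠ 0 then wt β ω * 2 else 0) := by
    refine Finset.sum_congr rfl fun ω _ => ?_
    simp only [hg, mul_ite, mul_zero]
  rw [h5] at h3
  have h6 := h3.trans h4
  rw [mul_comm] at h6
  have h7 := le_of_mul_le_mul_right h6 hG
  linarith

lemma exists_disjoint_card {h : ℕ} (hh : 2 * h ≤ L) :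
    ∃ A B : Finset (ZMod L), Disjoint A B ∧ A.card = h ∧ B.card = h := by
  obtain ⟨A, -, hA⟩ := Finset.exists_subset_card_eq (s := (Finset.univ : Finset (ZMod L)))
    (n := h) (by rw [Finset.card_univ, ZMod.card]; omega)
  obtain ⟨B, hB, hB'⟩ := Finset.exists_subset_card_eq (s := Aᶜ) (n := h)
    (by rw [Finset.card_compl, ZMod.card, hA]; omega)
  exact ⟨A, B, disjoint_compl_right.mono_right hB, hA, hB'⟩

lemma colProd_four {i i' j j' : ZMod L} (h1 : i ≠ i') (h2 : i ≠ j) (h3 : i ≠ j') (h4 : i' ≠ j)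
    (h5 : i' ≠ j') (h6 : j ≠ j') (ω : Cfg L) : colProd {i, i', j, j'} ω =
      sgn (ω (i, 0)) * sgn (ω (i', 0)) * (sgn (ω (j, 0)) * sgn (ω (j', 0))) := by
  rw [colProd, Finset.prod_insert (by simp [*]), Finset.prod_insert (by simp [*]),
    Finset.prod_pair h6]
  ring

lemma card_four {i i' j j' : ZMod L} (h1 : i ≠ i') (h2 : i ≠ j) (h3 : i ≠ j') (h4 : i' ≠ j)
    (h5 : i' ≠ j') (h6 : j ≠ j') : ({i, i', j, j'} : Finset (ZMod L)).card = 4 := by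
  rw [Finset.card_insert_of_notMem (by simp [*]), Finset.card_insert_of_notMem (by simp [*]),
    Finset.card_pair h6]

/-- The normalised Gibbs weight. -/
def gibbs (L : ℕ) [NeZero L] (β : ℝ) (η : Cfg L) : ℝ := wt β η / Zp L β

lemma sum_gibbs (β : ℝ) : ∑ η : Cfg L, gibbs L β η = 1 := by
  simp only [gibbs]
  rw [← Finset.sum_div]
  exact div_self (Zp_pos (L := L) β).ne'

lemma sum_gibbs_colProd (β : ℝ) {X : Finset (ZMod L)} (hX : X.Nonempty) :
    ∑ ω : Cfg L, gibbs L β ω * colProd X ω = 0 := by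
  simp only [gibbs, div_mul_eq_mul_div]
  rw [← Finset.sum_div, sum_wt_colProd β hX, zero_div]

/-- The error made when replacing the dynamics by strips, per unit of time. -/
def stripErr (L : ℕ) (β : ℝ) : ℝ :=
  2 * (L : ℝ) ^ 3 * ((L : ℝ) ^ 2 * Real.exp (-(8 * β)) + 16 * Real.exp (-(6 * β)))

theorem le_tv_ground (hL : 3 ≤ L) {β : ℝ} (hβ : 0 ≤ β) {t : ℝ} (ht : 0 ≤ t) {h : ℕ} (hh : 1 ≤ h)
    (hhL : 2 * h ≤ L) {m E2 E4 : ℝ} (hm : 0 < m)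
    (hm' : m ≤ Real.exp (-pairRate L β * t) - 6 * (L : ℝ) ^ 3 * Real.exp (-(4 * β)))
    (hE2 : Real.exp (-(2 * rate L β * t)) * √(1 + 2 * (L : ℝ) ^ 3 * Real.exp (-(4 * β))) ≤ E2)
    (hE4 : Real.exp (-(4 * rate L β * t)) * √(1 + 2 * (L : ℝ) ^ 3 * Real.exp (-(4 * β))) ≤ E4) :
    1 - 4 * (((h : ℝ) ^ 4 * E4 + 2 * h ^ 3 * E2 + h ^ 2) / (h : ℝ) ^ 4 / m ^ 2 - 1)
      - (h : ℝ) ^ 2 / ((h : ℝ) ^ 2 * m / 2) ^ 2 - stripErr L β * t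
      ≤ tv (NormedSpace.exp (t • (spm L β).gen) 0) (gibbs L β) := by
  have h0 : bd (0 : Cfg L) = 0 := map_zero _
  have hh' : (0 : ℝ) < h := by exact_mod_cast hh
  obtain ⟨A, B, hAB, hA, hB⟩ := exists_disjoint_card hhL
  set a : ZMod L → Cfg L → ℝ := fun i ω => sgn (ω (i, 0)) with ha
  set p : Cfg L → ℝ := NormedSpace.exp (t • (stripChain L β).gen) 0 with hp
  have hpsum : ∑ ω, p ω = 1 := (stripChain L β).isGen.sum_exp t 0
  have hp0 : ∀ ω, 0 ≤ p ω := (stripChain L β).isGen.exp_nonneg ht 0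
  have hsg : ∀ f : Cfg L → ℝ, ∑ ω, p ω * f ω = sg (stripChain L β).gen t f 0 := fun f => rfl
  have M1 : ∑ ω, p ω * bil A B a ω ^ 2 ≤ (h : ℝ) ^ 4 * E4 + 2 * h ^ 3 * E2 + h ^ 2 := by
    refine second_moment_le hAB hA hB (fun i ω => sgn_mul_self _) hpsum
      (le_trans (by positivity) hE2) (le_trans (by positivity) hE4) (fun i j hij => ?_)
      (fun i i' j j' h1 h2 h3 h4 h5 h6 => ?_)
    · simp only [ha, ← colProd_pair hij]
      rw [hsg]
      refine le_trans (sg_colProd_le (by omega) β ?_ ht h0) ?_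
      · rw [Finset.card_pair hij]; exact even_two
      · rw [Finset.card_pair hij]; exact_mod_cast hE2
    · simp only [ha, ← colProd_four h1 h2 h3 h4 h5 h6]
      rw [hsg]
      refine le_trans (sg_colProd_le (by omega) β ?_ ht h0) ?_
      · rw [card_four h1 h2 h3 h4 h5 h6]; decide
      · rw [card_four h1 h2 h3 h4 h5 h6]; exact_mod_cast hE4
  have M2 : ∑ ω, gibbs L β ω * bil A B a ω ^ 2 ≤ (h : ℝ) ^ 4 * 0 + 2 * h ^ 3 * 0 + h ^ 2 := by
    refine second_moment_le hAB hA hB (fun i ω => sgn_mul_self _) (sum_gibbs β)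
      le_rfl le_rfl (fun i j hij => ?_) (fun i i' j j' h1 h2 h3 h4 h5 h6 => ?_)
    · simp only [ha, ← colProd_pair hij]
      exact (sum_gibbs_colProd β (by simp)).le
    · simp only [ha, ← colProd_four h1 h2 h3 h4 h5 h6]
      exact (sum_gibbs_colProd β (by simp)).le
  have N1 := sum_ite_bil_le hh hA hB hp0 hpsum hm (fun i hi j hj => by
    have hij : i ≠ j := fun e => Finset.disjoint_left.1 hAB hi (e ▸ hj)
    simp only [ha, ← colProd_pair hij]
    rw [hsg]
    exact hm'.trans (le_sg_colProd hL β ht hij)) M1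
  have N2 := sum_ite_lt_bil_le (A := A) (B := B) (a := a) (p := gibbs L β)
    (fun ω => div_nonneg (Real.exp_pos _).le (Zp_pos (L := L) β).le)
    (k := (h : ℝ) ^ 2 * m / 2) (by positivity) M2
  set F : Cfg L → ℝ := fun ω => if (h : ℝ) ^ 2 * m / 2 < bil A B a ω then 1 else 0 with hF
  have hF0 : ∀ ω, 0 ≤ F ω := fun ω => by simp only [hF]; split_ifs <;> norm_num
  have hF1 : ∀ ω, F ω ≤ 1 := fun ω => by simp only [hF]; split_ifs <;> norm_num
  have e1 : ∑ ω, p ω * (if (h : ℝ) ^ 2 * m / 2 < bil A B a ω then 0 else 1)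
      = 1 - ∑ ω, p ω * F ω := by
    refine Eq.trans ?_ (congrArg (· - ∑ ω, p ω * F ω) hpsum)
    rw [← Finset.sum_sub_distrib]
    refine Finset.sum_congr rfl fun ω _ => ?_
    simp only [hF]
    split_ifs <;> ring
  have N3 := sum_sub_le_tv ((spm L β).isGen.sum_exp t 0) (sum_gibbs β) hF0 hF1
  have N4 := (abs_le.1 (abs_sg_strip_sub_sg_le hL hβ ht hF0 hF1 h0)).2
  have e3 : ∑ ω, NormedSpace.exp (t • (spm L β).gen) 0 ω * F ω = sg (spm L β).gen t F 0 := rfl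
  rw [e3] at N3
  rw [e1, hsg] at N1
  rw [mul_zero, mul_zero, add_zero, zero_add] at N2
  unfold stripErr
  linarith

end LowerBound

section UpperBound

lemma tv_triangle {Ω : Type*} [Fintype Ω] (μ ν ρ : Ω → ℝ) : tv μ ν ≤ tv μ ρ + tv ρ ν := by
  unfold tv
  rw [← add_div, ← Finset.sum_add_distrib]
  gcongr with ω
  exact abs_sub_le _ _ _

lemma tv_le_of_forall {Ω : Type*} [Fintype Ω] {μ ν : Ω → ℝ} (hμ : ∑ ω, μ ω = 1)
    (hν : ∑ ω, ν ω = 1) {c : ℝ} (h : ∀ f : Ω → ℝ, (∀ ω, 0 ≤ f ω) → (∀ ω, f ω ≤ 1) →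
      ∑ ω, μ ω * f ω - ∑ ω, ν ω * f ω ≤ c) : tv μ ν ≤ c := by
  refine le_trans (le_of_eq ?_) (h (fun ω => if ν ω ≤ μ ω then 1 else 0)
    (fun ω => by split_ifs <;> norm_num) (fun ω => by split_ifs <;> norm_num))
  have e : ∑ ω, |μ ω - ν ω| = ∑ ω, (2 * (μ ω * (if ν ω ≤ μ ω then 1 else 0)
      - ν ω * (if ν ω ≤ μ ω then 1 else 0)) - (μ ω - ν ω)) := by
    refine Finset.sum_congr rfl fun ω _ => ?_
    split_ifs with hc
    · rw [abs_of_nonneg (by linarith)]; ring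
    · rw [abs_of_neg (by linarith)]; ring
  rw [tv, e, Finset.sum_sub_distrib, ← Finset.mul_sum, Finset.sum_sub_distrib,
    Finset.sum_sub_distrib, hμ, hν]
  ring

variable {L : ℕ} [NeZero L]

theorem tv_ground_le (hL : 3 ≤ L) {β : ℝ} (hβ : 0 ≤ β) {t : ℝ} (ht : 0 ≤ t) {σ : Cfg L}
    (hσ : bd σ = 0) : tv (NormedSpace.exp (t • (spm L β).gen) σ) (gibbs L β) ≤
      stripErr L β * t + (2 * (1 - (GS L).card / Zp L β)
      + √(Zp L β / (GS L).card * ((1 + Real.exp (-2 * rate L β * t)) ^ (2 * L) - 1))) / 2 := by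
  refine (tv_triangle _ _ (NormedSpace.exp (t • (stripChain L β).gen) σ)).trans (add_le_add ?_ ?_)
  · refine tv_le_of_forall ((spm L β).isGen.sum_exp t σ) ((stripChain L β).isGen.sum_exp t σ)
      fun f h0 h1 => ?_
    have := (abs_le.1 (abs_sg_strip_sub_sg_le hL hβ ht h0 h1 hσ)).1
    have e1 : ∑ ω, NormedSpace.exp (t • (spm L β).gen) σ ω * f ω = sg (spm L β).gen t f σ := rfl
    have e2 : ∑ ω, NormedSpace.exp (t • (stripChain L β).gen) σ ω * f ω
      = sg (stripChain L β).gen t f σ := rfl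
    rw [e1, e2]
    unfold stripErr
    linarith
  · unfold tv
    refine div_le_div_of_nonneg_right (le_trans (le_of_eq ?_)
      (strip_sum_abs_le (by omega) β hσ ht)) zero_le_two
    refine Finset.sum_congr rfl fun η _ => ?_
    have h := (stripChain L β).exp_reversible t σ η
    rw [show (stripChain L β).w σ = 1 from wt_of_bd_eq_zero hσ β, one_mul,
      show (stripChain L β).w η = wt β η from rfl] at h
    have hw : 0 < wt β η := Real.exp_pos _
    rw [h, gibbs, sg, Matrix.mulVec_single_one, Matrix.col_apply, ← mul_one_div, ← mul_sub,
      abs_mul, abs_of_pos hw]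

theorem tv_le (hL : 3 ≤ L) {β : ℝ} {K : ℕ} (hP : Params L β K) {s : ℝ}
    (hs : 4 * β * pathConst L β K * Real.log (β * L ^ 2 + 1) ≤ s) {t : ℝ} (ht : 0 ≤ t)
    (σ : Cfg L) : tv (NormedSpace.exp ((s + t) • (spm L β).gen) σ) (gibbs L β) ≤
      16 / β + (stripErr L β * t + (2 * (1 - (GS L).card / Zp L β)
      + √(Zp L β / (GS L).card * ((1 + Real.exp (-2 * rate L β * t)) ^ (2 * L) - 1))) / 2) := by
  have hβ := hP.one_le
  have hs0 : 0 ≤ s := by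
    refine le_trans ?_ hs
    have := hP.pathConst_pos
    have := Real.log_nonneg (x := β * L ^ 2 + 1) (by nlinarith [sq_nonneg (L : ℝ)])
    positivity
  have hA := (spm L β).isGen
  refine (hA.tv_add_le hs0 t (gibbs L β) σ).trans ?_
  have hD : ∀ η : Cfg L, bd η = 0 → _ := fun η hη => tv_ground_le (β := β) hL (by linarith) ht hη
  have hnn : 0 ≤ stripErr L β * t + (2 * (1 - (GS L).card / Zp L β)
      + √(Zp L β / (GS L).card * ((1 + Real.exp (-2 * rate L β * t)) ^ (2 * L) - 1))) / 2 :=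
    le_trans (div_nonneg (Finset.sum_nonneg fun _ _ => abs_nonneg _) zero_le_two)
      (hD 0 (map_zero _))
  generalize stripErr L β * t + (2 * (1 - (GS L).card / Zp L β)
      + √(Zp L β / (GS L).card * ((1 + Real.exp (-2 * rate L β * t)) ^ (2 * L) - 1))) / 2 = D at *
  have hle : ∀ j, tv (NormedSpace.exp (t • (spm L β).gen) j) (gibbs L β)
      ≤ (exc + fun _ => D : Cfg L → ℝ) j := by
    intro j
    rw [Pi.add_apply]
    by_cases hj : bd j = 0
    · have := hD j hj
      simpa [exc, hj] using this
    · rw [exc, if_neg hj]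
      refine le_trans ?_ (le_add_of_nonneg_right hnn)
      refine tv_le_of_forall (hA.sum_exp t j) (sum_gibbs β) fun f h0 h1 => ?_
      have h2 : ∑ ω, NormedSpace.exp (t • (spm L β).gen) j ω * f ω ≤ 1 := by
        rw [← hA.sum_exp t j]
        exact Finset.sum_le_sum fun ω _ => mul_le_of_le_one_right (hA.exp_nonneg ht j ω) (h1 ω)
      have h3 : 0 ≤ ∑ ω, gibbs L β ω * f ω := Finset.sum_nonneg fun ω _ =>
        mul_nonneg (div_nonneg (Real.exp_pos _).le (Zp_pos (L := L) β).le) (h0 ω)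
      linarith
  refine (hA.sg_mono hs0 hle σ).trans ?_
  rw [sg_linear_add, Pi.add_apply, hA.sg_const]
  exact add_le_add_left (hit_ground hP hs σ) D

/-- The distance to equilibrium decreases. -/
lemma tv_antitone {Ω : Type*} [Fintype Ω] [DecidableEq Ω] {A : Matrix Ω Ω ℝ} (hA : IsGen A)
    {ν : Ω → ℝ} {s t : ℝ} (hst : s ≤ t) {c : ℝ}
    (h : ∀ σ, tv (NormedSpace.exp (s • A) σ) ν ≤ c) (σ : Ω) :
    tv (NormedSpace.exp (t • A) σ) ν ≤ c := by
  have h1 := hA.tv_add_le (sub_nonneg.2 hst) s ν σ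
  rw [sub_add_cancel] at h1
  refine h1.trans ?_
  have := hA.sg_mono (sub_nonneg.2 hst) h σ
  rwa [hA.sg_const] at this

end UpperBound

section Transport

variable {L : ℕ} [NeZero L]

/-- The reflected identification of `Fin L` with `ZMod L`. -/
def coordEquiv (L : ℕ) [NeZero L] : Fin L ≃ ZMod L :=
  Equiv.ofBijective (fun i => -((i.val : ℕ) : ZMod L)) (by
    rw [Fintype.bijective_iff_injective_and_card]
    refine ⟨fun i j h => Fin.ext ?_, by simp [ZMod.card]⟩
    have h2 := congrArg ZMod.val (neg_injective h)
    rwa [ZMod.val_natCast_of_lt i.2, ZMod.val_natCast_of_lt j.2] at h2)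

lemma coordEquiv_fsucc (i : Fin L) : coordEquiv L (fsucc i) = coordEquiv L i - 1 := by
  change -(((i.val + 1) % L : ℕ) : ZMod L) = -((i.val : ℕ) : ZMod L) - 1
  rw [ZMod.natCast_mod]
  push_cast
  ring

/-- The sites of the torus. -/
def siteEquiv (L : ℕ) [NeZero L] : Fin L × Fin L ≃ Tor L :=
  (coordEquiv L).prodCongr (coordEquiv L)

lemma siteEquiv_mk (i j : Fin L) : siteEquiv L (i, j) = (coordEquiv L i, coordEquiv L j) := rfl

/-- The two spin values. -/
def spinEquiv : ZMod 2 ≃ Bool where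
  toFun a := decide (a = 0)
  invFun b := if b then 0 else 1
  left_inv a := by
    by_cases h : a = 0
    · simp [h]
    · simp [zmod_two_ne_zero.1 h]
  right_inv b := by cases b <;> simp

lemma sval_spinEquiv (a : ZMod 2) : sval (spinEquiv a) = sgn a := by
  simp [sval, spinEquiv, sgn]

lemma spinEquiv_add_one (a : ZMod 2) : spinEquiv (a + 1) = !spinEquiv a := by
  by_cases h : a = 0
  · simp [spinEquiv, h]
  · rw [zmod_two_ne_zero.1 h]
    have : (1 : ZMod 2) + 1 = 0 := by decide
    simp [spinEquiv, this]

/-- The identification of the two encodings of spin configurations. -/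
def cfgEquiv (L : ℕ) [NeZero L] : Cfg L ≃ ConfigP L :=
  (siteEquiv L).symm.arrowCongr spinEquiv

lemma cfgEquiv_apply (s : Cfg L) (x : Fin L × Fin L) :
    cfgEquiv L s x = spinEquiv (s (siteEquiv L x)) := rfl

lemma plaqP_cfgEquiv (s : Cfg L) (x : Fin L × Fin L) :
    plaqP L (cfgEquiv L s) x = sgn (bd s (siteEquiv L x)) := by
  obtain ⟨i, j⟩ := x
  simp only [plaqP, cfgEquiv_apply, sval_spinEquiv, bd_apply, siteEquiv_mk, coordEquiv_fsucc,
    sgn_add]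

lemma hamP_cfgEquiv (s : Cfg L) : hamP L (cfgEquiv L s) = Nd s - (L : ℝ) ^ 2 / 2 := by
  have h1 : ∑ x, plaqP L (cfgEquiv L s) x = ∑ p, sgn (bd s p) := by
    simp only [plaqP_cfgEquiv]
    exact Equiv.sum_comp (siteEquiv L) fun p => sgn (bd s p)
  have h2 : ∀ a : ZMod 2, sgn a = 1 - 2 * if a ≠ 0 then 1 else 0 := by
    intro a
    unfold sgn
    by_cases h : a = 0 <;> simp [h]
    norm_num
  rw [hamP, h1, Finset.sum_congr rfl fun p _ => h2 (bd s p), Finset.sum_sub_distrib,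
    ← Finset.mul_sum, Nd, cnt, Finset.card_filter]
  push_cast
  simp only [Finset.sum_const, Finset.card_univ, Fintype.card_prod, ZMod.card, nsmul_eq_mul]
  push_cast
  ring

lemma flipP_cfgEquiv (s : Cfg L) (x : Fin L × Fin L) :
    flipP L (cfgEquiv L s) x = cfgEquiv L (s + dl (siteEquiv L x)) := by
  funext y
  rw [flipP, cfgEquiv_apply, cfgEquiv_apply, Pi.add_apply, dl_apply]
  by_cases h : y = x
  · simp [h, spinEquiv_add_one]
  · simp [h]

lemma metroRateP_cfgEquiv {β : ℝ} (hβ : 0 ≤ β) (s : Cfg L) (x : Tor L) :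
    metroRateP L β (cfgEquiv L s) (cfgEquiv L (s + dl x)) = (spm L β).q s x / (spm L β).w s := by
  change _ = Real.exp (-β * (max (Nd s) (Nd (s + dl x)) : ℕ)) / Real.exp (-β * Nd s)
  rw [metroRateP, hamP_cfgEquiv, hamP_cfgEquiv, ← Real.exp_sub]
  rcases le_total (Nd s) (Nd (s + dl x)) with h | h
  · rw [max_eq_right h, min_eq_right]
    · congr 1; ring
    · rw [Real.exp_le_one_iff]
      have : (Nd s : ℝ) ≤ Nd (s + dl x) := by exact_mod_cast h
      nlinarith
  · rw [max_eq_left h, min_eq_left, sub_self, Real.exp_zero]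
    rw [Real.one_le_exp_iff]
    have : (Nd (s + dl x) : ℝ) ≤ Nd s := by exact_mod_cast h
    nlinarith

lemma genP_cfgEquiv {β : ℝ} (hβ : 0 ≤ β) (s s' : Cfg L) :
    genP L β (cfgEquiv L s) (cfgEquiv L s') = (spm L β).gen s s' := by
  have hne : ∀ x, s ≠ s + dl x := by
    intro x h
    have := congrFun h x
    rw [Pi.add_apply, dl_self] at this
    simp at this
  rw [genP, RevChain.gen]
  simp only [(cfgEquiv L).apply_eq_iff_eq, flipP_cfgEquiv]
  rw [Finset.sum_div]
  split_ifs with h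
  · subst h
    rw [← Finset.sum_neg_distrib]
    refine Eq.trans ?_ (Equiv.sum_comp (siteEquiv L) _)
    refine Finset.sum_congr rfl fun x _ => ?_
    rw [metroRateP_cfgEquiv hβ, show (spm L β).act (siteEquiv L x) s' = s' + dl (siteEquiv L x) from rfl,
      if_neg (hne _)]
    ring
  · refine Eq.trans ?_ (Equiv.sum_comp (siteEquiv L) _)
    refine Finset.sum_congr rfl fun x _ => ?_
    rw [metroRateP_cfgEquiv hβ, show (spm L β).act (siteEquiv L x) s = s + dl (siteEquiv L x) from rfl]
    by_cases h2 : s' = s + dl (siteEquiv L x) <;> simp [h2]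

lemma mexp_submatrix {m n : Type*} [Fintype m] [Fintype n] [DecidableEq m] [DecidableEq n]
    (e : m ≃ n) {A : Matrix n n ℝ} {B : Matrix m m ℝ} (h : ∀ i j, A (e i) (e j) = B i j) (i j : m) :
    mexp A (e i) (e j) = mexp B i j := by
  have hB : B = A.submatrix e e := by ext i j; exact (h i j).symm
  have hp : ∀ k, (A ^ k).submatrix e e = B ^ k := by
    intro k
    induction k with
    | zero => rw [pow_zero, pow_zero, Matrix.submatrix_one_equiv]
    | succ k ih => rw [pow_succ, pow_succ, ← ih, hB, Matrix.submatrix_mul_equiv]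
  unfold mexp
  simp only [← hp, Matrix.submatrix_apply]

lemma tv_comp_equiv {m n : Type*} [Fintype m] [Fintype n] (e : m ≃ n) (μ ν : n → ℝ) :
    tv μ ν = tv (fun i => μ (e i)) fun i => ν (e i) := by
  unfold tv
  rw [← Equiv.sum_comp e]

lemma gibbsP_cfgEquiv (β : ℝ) (s : Cfg L) : gibbsP L β (cfgEquiv L s) = gibbs L β s := by
  have h : ∀ s : Cfg L, Real.exp (-β * hamP L (cfgEquiv L s))
      = Real.exp (β * ((L : ℝ) ^ 2 / 2)) * wt β s := by
    intro s
    rw [hamP_cfgEquiv, wt, ← Real.exp_add]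
    congr 1
    ring
  rw [gibbsP, ← Equiv.sum_comp (cfgEquiv L), Finset.sum_congr rfl fun s _ => h s, h,
    ← Finset.mul_sum, mul_div_mul_left _ _ (Real.exp_pos _).ne']
  rfl

theorem tmixP_eq {β : ℝ} (hβ : 0 ≤ β) (ε : ℝ) : tmixP L β ε = sInf {t : ℝ | 0 < t ∧
    ∀ σ : Cfg L, tv (NormedSpace.exp (t • (spm L β).gen) σ) (gibbs L β) < ε} := by
  have h : ∀ (t : ℝ) (s : Cfg L), tv (mexp (t • genP L β) (cfgEquiv L s)) (gibbsP L β)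
      = tv (NormedSpace.exp (t • (spm L β).gen) s) (gibbs L β) := by
    intro t s
    rw [tv_comp_equiv (cfgEquiv L), ← mexp_eq_exp]
    congr 1
    · funext s'
      exact mexp_submatrix (cfgEquiv L) (fun i j => by
        rw [Matrix.smul_apply, Matrix.smul_apply, genP_cfgEquiv hβ]) s s'
    · funext s'
      exact gibbsP_cfgEquiv β s'
  unfold tmixP
  simp only [← (cfgEquiv L).forall_congr_right (q := fun σ => tv (mexp (_ • genP L β) σ) (gibbsP L β) < ε), h]

end Transport

section Asymptotics

open Filter Topology

lemma tendsto_pow_mul_exp_neg (n : ℕ) {c : ℝ} (hc : 0 < c) :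
    Tendsto (fun β : ℝ => β ^ n * Real.exp (-(c * β))) atTop (𝓝 0) := by
  have := tendsto_rpow_mul_exp_neg_mul_atTop_nhds_zero n c hc
  simpa only [Real.rpow_natCast, neg_mul] using this

lemma tendsto_exp_neg {c : ℝ} (hc : 0 < c) :
    Tendsto (fun β : ℝ => Real.exp (-(c * β))) atTop (𝓝 0) := by
  simpa using tendsto_pow_mul_exp_neg 0 hc

lemma Lc_le (β : ℝ) : (Lc β : ℝ) ≤ Real.exp (β / 2) := Nat.floor_le (Real.exp_pos _).le

lemma lt_Lc_add_one (β : ℝ) : Real.exp (β / 2) < Lc β + 1 := Nat.lt_floor_add_one _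

lemma Lc_pow_le (β : ℝ) (n : ℕ) : (Lc β : ℝ) ^ n ≤ Real.exp (n * β / 2) := by
  rw [mul_div_assoc, Real.exp_nat_mul]
  exact pow_le_pow_left₀ (Nat.cast_nonneg _) (Lc_le β) n

lemma half_exp_le_Lc {β : ℝ} (hβ : 2 ≤ β) : Real.exp (β / 2) / 2 ≤ Lc β := by
  have h1 := lt_Lc_add_one β
  have h2 := Real.add_one_le_exp (β / 2)
  linarith

lemma tendsto_Lc : Tendsto (fun β : ℝ => (Lc β : ℝ)) atTop atTop := by
  refine tendsto_atTop_mono' atTop (f₁ := fun β => β / 4) ?_ (tendsto_id.atTop_div_const (by norm_num))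
  filter_upwards [eventually_ge_atTop 2] with β hβ
  have h1 := half_exp_le_Lc hβ
  have h2 := Real.add_one_le_exp (β / 2)
  linarith

lemma tendsto_inv_Lc : Tendsto (fun β : ℝ => (Lc β : ℝ)⁻¹) atTop (𝓝 0) :=
  tendsto_inv_atTop_zero.comp tendsto_Lc

lemma tendsto_mul_inv_Lc : Tendsto (fun β : ℝ => β * (Lc β : ℝ)⁻¹) atTop (𝓝 0) := by
  have h := (tendsto_pow_mul_exp_neg 1 (c := 1 / 2) (by norm_num)).const_mul 2
  rw [mul_zero] at h
  refine squeeze_zero' ?_ ?_ h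
  · filter_upwards [eventually_ge_atTop 0] with β hβ
    positivity
  · filter_upwards [eventually_ge_atTop 2] with β hβ
    have h1 := half_exp_le_Lc hβ
    have h2 : (Lc β : ℝ)⁻¹ ≤ (Real.exp (β / 2) / 2)⁻¹ := inv_anti₀ (by positivity) h1
    have h3 : (Real.exp (β / 2) / 2)⁻¹ = 2 * Real.exp (-(1 / 2 * β)) := by
      rw [Real.exp_neg, show 1 / 2 * β = β / 2 by ring]
      field_simp
    rw [h3] at h2
    have := mul_le_mul_of_nonneg_left h2 (show 0 ≤ β by linarith)
    linarith

/-- The scale of the proportion of strips. -/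
def density (β : ℝ) : ℝ := (Lc β : ℝ) ^ 3 * Real.exp (-(4 * β))

lemma density_nonneg (β : ℝ) : 0 ≤ density β := by unfold density; positivity

lemma density_le (β : ℝ) : density β ≤ Real.exp (-(5 / 2 * β)) := by
  have h := mul_le_mul_of_nonneg_right (Lc_pow_le β 3) (Real.exp_pos (-(4 * β))).le
  rw [← Real.exp_add] at h
  refine h.trans (le_of_eq (congrArg Real.exp ?_))
  push_cast
  ring

lemma tendsto_mul_density : Tendsto (fun β : ℝ => β * density β) atTop (𝓝 0) := by
  refine squeeze_zero' ?_ ?_ (tendsto_pow_mul_exp_neg 1 (c := 5 / 2) (by norm_num))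
  · filter_upwards [eventually_ge_atTop 0] with β hβ
    exact mul_nonneg hβ (density_nonneg β)
  · filter_upwards [eventually_ge_atTop 0] with β hβ
    rw [pow_one]
    exact mul_le_mul_of_nonneg_left (density_le β) hβ

lemma tendsto_density : Tendsto density atTop (𝓝 0) :=
  squeeze_zero density_nonneg density_le (tendsto_exp_neg (by norm_num))

/-- The cutoff time. -/
def cutTime (β : ℝ) : ℝ := β * Real.exp (4 * β) / 16

lemma cutTime_pos {β : ℝ} (hβ : 0 < β) : 0 < cutTime β := by unfold cutTime; positivity

lemma rate_mul_cutTime {β : ℝ} (hL : 0 < Lc β) : rate (Lc β) β * cutTime β =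
    β / 4 * ((1 + 20 * density β) * (1 + 6 * (Lc β : ℝ)⁻¹))⁻¹ := by
  have hL' : (0 : ℝ) < Lc β := by exact_mod_cast hL
  have he : Real.exp (4 * β) = (Real.exp (-(4 * β)))⁻¹ := by rw [Real.exp_neg, inv_inv]
  unfold rate cutTime density
  rw [he]
  have hE := Real.exp_pos (-(4 * β))
  generalize (Lc β : ℝ) = l at *
  generalize Real.exp (-(4 * β)) = e at *
  have h1 : 1 + 20 * (l ^ 3 * e) ≠ 0 := by positivity
  have h2 : 1 + 6 * l⁻¹ ≠ 0 := by positivity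
  have h3 : (1 + 4 * l ^ 3 * e) * (l + 6) / (4 * l * e) + 4 * l ^ 2 * (l + 6)
      = (1 + 20 * (l ^ 3 * e)) * (1 + 6 * l⁻¹) / (4 * e) := by
    field_simp
    ring
  rw [h3]
  field_simp
  ring

lemma pairRate_mul_cutTime {β : ℝ} (hL : 0 < Lc β) : pairRate (Lc β) β * cutTime β =
    β / 2 * ((1 - 2 * (Lc β : ℝ)⁻¹) ^ 2)⁻¹ := by
  have hL' : (0 : ℝ) < Lc β := by exact_mod_cast hL
  have he : Real.exp (4 * β) = (Real.exp (-(4 * β)))⁻¹ := by rw [Real.exp_neg, inv_inv]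
  unfold pairRate cutTime
  rw [he]
  have hE := Real.exp_pos (-(4 * β))
  generalize (Lc β : ℝ) = l at *
  generalize Real.exp (-(4 * β)) = e at *
  have h3 : l / (l - 2) = (1 - 2 * l⁻¹)⁻¹ := by
    rw [show 1 - 2 * l⁻¹ = (l - 2) / l by field_simp, inv_div]
  rw [h3, inv_pow]
  field_simp
  ring

lemma tendsto_rate_factor :
    Tendsto (fun β : ℝ => ((1 + 20 * density β) * (1 + 6 * (Lc β : ℝ)⁻¹))⁻¹) atTop (𝓝 1) := by
  have := (((tendsto_density.const_mul 20).const_add 1).mul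
    ((tendsto_inv_Lc.const_mul 6).const_add 1)).inv₀ (by norm_num)
  simpa using this

lemma tendsto_pairRate_factor :
    Tendsto (fun β : ℝ => ((1 - 2 * (Lc β : ℝ)⁻¹) ^ 2)⁻¹) atTop (𝓝 1) := by
  have := (((tendsto_inv_Lc.const_mul 2).const_sub 1).pow 2).inv₀ (by norm_num)
  simpa using this

lemma tendsto_stripErr_mul_cutTime :
    Tendsto (fun β : ℝ => stripErr (Lc β) β * cutTime β) atTop (𝓝 0) := by
  have h := (tendsto_pow_mul_exp_neg 1 (c := 1 / 2) (by norm_num)).const_mul 3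
  rw [mul_zero] at h
  refine squeeze_zero' ?_ ?_ h
  · filter_upwards [eventually_ge_atTop 0] with β hβ
    unfold stripErr cutTime
    positivity
  · filter_upwards [eventually_ge_atTop 0] with β hβ
    have h2 := Lc_pow_le β 2
    have h3 := Lc_pow_le β 3
    have h4 : (Lc β : ℝ) ^ 2 * Real.exp (-(8 * β)) + 16 * Real.exp (-(6 * β))
        ≤ 17 * Real.exp (-(6 * β)) := by
      have := mul_le_mul_of_nonneg_right h2 (Real.exp_pos (-(8 * β))).le
      rw [← Real.exp_add] at this
      have h5 := Real.exp_le_exp.2 (show ((2 : ℕ) : ℝ) * β / 2 + -(8 * β) ≤ -(6 * β) by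
        push_cast; linarith)
      linarith
    unfold stripErr cutTime
    calc _ ≤ 2 * Real.exp ((3 : ℕ) * β / 2) * (17 * Real.exp (-(6 * β)))
          * (β * Real.exp (4 * β) / 16) := by gcongr
      _ = (34 / 16) * β * (Real.exp ((3 : ℕ) * β / 2) * Real.exp (-(6 * β)) * Real.exp (4 * β)) := by
          ring
      _ = (34 / 16) * β * Real.exp (-(1 / 2 * β)) := by
          rw [← Real.exp_add, ← Real.exp_add]
          congr 2
          push_cast
          ring
      _ ≤ 3 * (β ^ 1 * Real.exp (-(1 / 2 * β))) := by
          have : 0 ≤ β * Real.exp (-(1 / 2 * β)) := by positivity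
          rw [pow_one]
          linarith

end Asymptotics

section UpperAsymptotics

open Filter Topology

lemma pathConst_le {β : ℝ} (hβ : 1 ≤ β) : pathConst (Lc β) β (⌈β⌉₊ ^ 2) ≤
    Real.exp (4 * β) * (17 / β ^ 2 + 244 * β ^ 4 * Real.exp (-(1 / 2 * β))) := by
  have hc1 : β ≤ ⌈β⌉₊ := Nat.le_ceil β
  have hc2 : (⌈β⌉₊ : ℝ) < β + 1 := Nat.ceil_lt_add_one (by linarith)
  have h3 := Lc_pow_le β 3
  have h4 := Lc_pow_le β 4
  have hL2 : (Lc β : ℝ) ^ 2 ≤ Real.exp (2 * β) :=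
    (Lc_pow_le β 2).trans (Real.exp_le_exp.2 (by push_cast; linarith))
  have hL0 : (0 : ℝ) ≤ Lc β := Nat.cast_nonneg _
  unfold pathConst
  push_cast
  generalize (Lc β : ℝ) = l at *
  generalize (⌈β⌉₊ : ℝ) = k at *
  have hE := Real.exp_pos (2 * β)
  have hl3 : l ^ 3 ≤ l * Real.exp (2 * β) := by
    nlinarith [mul_le_mul_of_nonneg_left hL2 hL0]
  have hk2 : β ^ 2 ≤ k ^ 2 := pow_le_pow_left₀ (by linarith) hc1 2
  have hk3 : 2 * k ^ 2 + 3 ≤ 11 * β ^ 2 := by nlinarith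
  have hk4 : (2 * k ^ 2 + 3) ^ 2 ≤ 121 * β ^ 4 := by
    have := pow_le_pow_left₀ (by positivity) hk3 2
    nlinarith
  have hβ4 : 1 ≤ β ^ 4 := one_le_pow₀ hβ
  calc _ ≤ l ^ 2 / β ^ 2 * l * (l * Real.exp (2 * β) + l * 16 * Real.exp (2 * β))
        + 2 * l * l * (l * Real.exp (2 * β) * β ^ 4 + l * (121 * β ^ 4) * Real.exp (2 * β)) := by
        gcongr
        exact hl3.trans (le_mul_of_one_le_right (by positivity) hβ4)
    _ = 17 / β ^ 2 * (l ^ 4 * Real.exp (2 * β)) + 244 * β ^ 4 * (l ^ 3 * Real.exp (2 * β)) := by ring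
    _ ≤ 17 / β ^ 2 * (Real.exp ((4 : ℕ) * β / 2) * Real.exp (2 * β))
        + 244 * β ^ 4 * (Real.exp ((3 : ℕ) * β / 2) * Real.exp (2 * β)) := by gcongr
    _ = _ := by
        rw [← Real.exp_add, ← Real.exp_add, mul_add, mul_left_comm (Real.exp (4 * β)),
          ← Real.exp_add, mul_comm (Real.exp (4 * β))]
        congr 3 <;> push_cast <;> ring_nf

lemma eventually_hit_le {δ : ℝ} (hδ : 0 < δ) : ∀ᶠ β : ℝ in atTop,
    4 * β * pathConst (Lc β) β (⌈β⌉₊ ^ 2) * Real.log (β * (Lc β : ℝ) ^ 2 + 1) ≤ δ * cutTime β := by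
  have h1 : Tendsto (fun β : ℝ => 17 * β⁻¹ + 244 * (β ^ 5 * Real.exp (-(1 / 2 * β)))) atTop (𝓝 0) := by
    have := (tendsto_inv_atTop_zero.const_mul (17 : ℝ)).add
      ((tendsto_pow_mul_exp_neg 5 (c := 1 / 2) (by norm_num)).const_mul 244)
    simpa using this
  filter_upwards [eventually_ge_atTop 1, h1.eventually_le_const (show 0 < δ / 128 by positivity)]
    with β hβ h
  have hp := pathConst_le hβ
  have hlog : Real.log (β * (Lc β : ℝ) ^ 2 + 1) ≤ 2 * β := by
    have h2 := Lc_pow_le β 2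
    rw [Real.log_le_iff_le_exp (by positivity), show 2 * β = β + β by ring, Real.exp_add]
    have h3 : Real.exp ((2 : ℕ) * β / 2) = Real.exp β := by congr 1; push_cast; ring
    rw [h3] at h2
    have h4 := Real.add_one_le_exp β
    have h5 : 1 ≤ Real.exp β := Real.one_le_exp (by linarith)
    nlinarith
  have hpc : 0 ≤ pathConst (Lc β) β (⌈β⌉₊ ^ 2) := by unfold pathConst; positivity
  have hE := Real.exp_pos (4 * β)
  calc _ ≤ 4 * β * (Real.exp (4 * β) * (17 / β ^ 2 + 244 * β ^ 4 * Real.exp (-(1 / 2 * β))))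
        * (2 * β) := by
        gcongr
        exact Real.log_nonneg (le_add_of_nonneg_left (by positivity))
    _ = 8 * (β * Real.exp (4 * β)) * (17 * β⁻¹ + 244 * (β ^ 5 * Real.exp (-(1 / 2 * β)))) := by
        field_simp
        norm_num
    _ ≤ 8 * (β * Real.exp (4 * β)) * (δ / 128) := by gcongr
    _ = _ := by unfold cutTime; ring

lemma eventually_params : ∀ᶠ β : ℝ in atTop, Params (Lc β) β (⌈β⌉₊ ^ 2) := by
  have h1 : ∀ᶠ β : ℝ in atTop, β * (Lc β : ℝ)⁻¹ ≤ 1 / 4 :=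
    tendsto_mul_inv_Lc.eventually_le_const (by norm_num)
  filter_upwards [eventually_ge_atTop 3, h1, tendsto_Lc.eventually_ge_atTop 1] with β hβ h1 hL
  have hc1 : β ≤ ⌈β⌉₊ := Nat.le_ceil β
  have hc2 : (⌈β⌉₊ : ℝ) < β + 1 := Nat.ceil_lt_add_one (by linarith)
  refine ⟨by linarith, ?_, ?_, ?_⟩
  · have : 3 ≤ ⌈β⌉₊ := by exact_mod_cast hβ.trans hc1
    nlinarith
  · rw [← div_eq_mul_inv, div_le_iff₀ (by linarith)] at h1
    have : (2 * (⌈β⌉₊ : ℝ) ^ 2) ≤ (Lc β : ℝ) ^ 2 := by nlinarith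
    exact_mod_cast this
  · refine (Lc_pow_le β 2).trans (le_of_eq ?_)
    congr 1
    push_cast
    ring

lemma tendsto_mixing_term {δ : ℝ} (hδ : 0 < δ) : Tendsto (fun β : ℝ =>
    √(2 * ((1 + Real.exp (-2 * rate (Lc β) β * ((1 + δ) * cutTime β))) ^ (2 * Lc β) - 1)))
    atTop (𝓝 0) := by
  have hbound : Tendsto (fun β : ℝ => √(2 * (Real.exp (2 * Real.exp (-(δ / 4 * β))) - 1)))
      atTop (𝓝 0) := by
    have h := (tendsto_exp_neg (show 0 < δ / 4 by positivity)).const_mul 2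
    have h2 := ((((Real.continuous_exp.tendsto _).comp h).sub_const 1).const_mul 2).sqrt
    simpa [Function.comp_def] using h2
  have h1 : ∀ᶠ β : ℝ in atTop, (1 + δ / 2) / (1 + δ) ≤
      ((1 + 20 * density β) * (1 + 6 * (Lc β : ℝ)⁻¹))⁻¹ :=
    tendsto_rate_factor.eventually_const_le (by rw [div_lt_one (by positivity)]; linarith)
  refine squeeze_zero' (Eventually.of_forall fun _ => Real.sqrt_nonneg _) ?_ hbound
  filter_upwards [h1, eventually_ge_atTop 1, tendsto_Lc.eventually_ge_atTop 1] with β h1 hβ hL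
  have hL' : 0 < Lc β := by exact_mod_cast hL
  refine Real.sqrt_le_sqrt (mul_le_mul_of_nonneg_left (sub_le_sub_right ?_ 1) zero_le_two)
  have hr := rate_mul_cutTime hL'
  have h2 : -2 * rate (Lc β) β * ((1 + δ) * cutTime β) ≤ -(β / 2) + -(δ / 4 * β) := by
    have h3 : (1 + δ / 2) * β / 4 ≤ (1 + δ) * (rate (Lc β) β * cutTime β) := by
      rw [hr]
      rw [div_le_iff₀ (by positivity)] at h1
      nlinarith
    linarith
  have h4 := Real.exp_le_exp.2 h2
  rw [Real.exp_add] at h4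
  set y := Real.exp (-2 * rate (Lc β) β * ((1 + δ) * cutTime β)) with hy
  have h5 : (Lc β : ℝ) * y ≤ Real.exp (-(δ / 4 * β)) := by
    calc _ ≤ Real.exp (β / 2) * (Real.exp (-(β / 2)) * Real.exp (-(δ / 4 * β))) :=
          mul_le_mul (Lc_le β) h4 (Real.exp_pos _).le (Real.exp_pos _).le
      _ = _ := by rw [← mul_assoc, ← Real.exp_add, add_neg_cancel, Real.exp_zero, one_mul]
  calc (1 + y) ^ (2 * Lc β) ≤ Real.exp y ^ (2 * Lc β) := by
        refine pow_le_pow_left₀ (by positivity) ?_ _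
        linarith [Real.add_one_le_exp y]
    _ = Real.exp (2 * (Lc β * y)) := by
        rw [← Real.exp_nat_mul]
        congr 1
        push_cast
        ring
    _ ≤ _ := Real.exp_le_exp.2 (by linarith)

theorem eventually_mixed {ε δ : ℝ} (hε : 0 < ε) (hδ : 0 < δ) : ∀ᶠ β : ℝ in atTop,
    ∃ _ : NeZero (Lc β), ∀ σ : Cfg (Lc β),
      tv (NormedSpace.exp (((1 + 2 * δ) * cutTime β) • (spm (Lc β) β).gen) σ) (gibbs (Lc β) β) < ε := by
  have hlim : Tendsto (fun β : ℝ => 16 * β⁻¹ + ((1 + δ) * (stripErr (Lc β) β * cutTime β)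
      + (2 * Real.exp (-(1 * β)) + √(2 * ((1 + Real.exp (-2 * rate (Lc β) β *
        ((1 + δ) * cutTime β))) ^ (2 * Lc β) - 1))) / 2)) atTop (𝓝 0) := by
    have := (tendsto_inv_atTop_zero.const_mul (16 : ℝ)).add
      ((tendsto_stripErr_mul_cutTime.const_mul (1 + δ)).add
      ((((tendsto_exp_neg one_pos).const_mul 2).add (tendsto_mixing_term hδ)).div_const 2))
    simpa using this
  filter_upwards [hlim.eventually_lt_const hε, eventually_params, eventually_hit_le hδ,
    tendsto_Lc.eventually_ge_atTop 3, eventually_ge_atTop 1] with β hlt hP hs hL hβ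
  have hL' : 3 ≤ Lc β := by exact_mod_cast hL
  have : NeZero (Lc β) := ⟨by omega⟩
  refine ⟨this, fun σ => ?_⟩
  have ht : 0 ≤ (1 + δ) * cutTime β := mul_nonneg (by linarith) (cutTime_pos (by linarith)).le
  have h := tv_le hL' hP hs ht σ
  rw [show δ * cutTime β + (1 + δ) * cutTime β = (1 + 2 * δ) * cutTime β by ring] at h
  refine (h.trans ?_).trans_lt hlt
  have hZ := Zp_pos (L := Lc β) β
  have hG := card_GS_pos (L := Lc β)
  have h1 : 1 - (GS (Lc β)).card / Zp (Lc β) β ≤ Real.exp (-(1 * β)) := by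
    have := hP.sum_wt_exc_le
    rw [sum_wt_exc] at this
    rw [sub_le_iff_le_add, ← sub_le_iff_le_add', le_div_iff₀ hZ, one_mul]
    linarith
  have h2 : Zp (Lc β) β / (GS (Lc β)).card ≤ 2 := by
    rw [div_le_iff₀ hG]
    exact hP.Zp_le
  have h3 : 0 ≤ (1 + Real.exp (-2 * rate (Lc β) β * ((1 + δ) * cutTime β))) ^ (2 * Lc β) - 1 :=
    sub_nonneg.2 (one_le_pow₀ (by linarith [Real.exp_pos (-2 * rate (Lc β) β * ((1 + δ) * cutTime β))]))
  have h4 := Real.sqrt_le_sqrt (mul_le_mul_of_nonneg_right h2 h3)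
  rw [div_eq_mul_inv 16 β]
  linarith

end UpperAsymptotics

section LowerAsymptotics

open Filter Topology

/-- The two-point function, up to a small error. -/
def pairCorr (δ β : ℝ) : ℝ := Real.exp (-pairRate (Lc β) β * ((1 - δ) * cutTime β))

lemma tendsto_rate_gap : Tendsto (fun β : ℝ => β * (((1 - 2 * (Lc β : ℝ)⁻¹) ^ 2)⁻¹
    - ((1 + 20 * density β) * (1 + 6 * (Lc β : ℝ)⁻¹))⁻¹)) atTop (𝓝 0) := by
  have hnum : Tendsto (fun β : ℝ => (20 * (β * density β) + 10 * (β * (Lc β : ℝ)⁻¹)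
      + 120 * (β * density β * (Lc β : ℝ)⁻¹) - 4 * (β * (Lc β : ℝ)⁻¹ * (Lc β : ℝ)⁻¹))
      * (((1 - 2 * (Lc β : ℝ)⁻¹) ^ 2)⁻¹ * ((1 + 20 * density β) * (1 + 6 * (Lc β : ℝ)⁻¹))⁻¹))
      atTop (𝓝 0) := by
    have := ((((tendsto_mul_density.const_mul 20).add (tendsto_mul_inv_Lc.const_mul 10)).add
      ((tendsto_mul_density.mul tendsto_inv_Lc).const_mul 120)).sub
      ((tendsto_mul_inv_Lc.mul tendsto_inv_Lc).const_mul 4)).mul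
      (tendsto_pairRate_factor.mul tendsto_rate_factor)
    simpa using this
  refine hnum.congr' ?_
  filter_upwards [tendsto_Lc.eventually_ge_atTop 3] with β hL
  have ha : (Lc β : ℝ)⁻¹ ≤ 3⁻¹ := inv_anti₀ (by norm_num) hL
  have ha0 : 0 ≤ (Lc β : ℝ)⁻¹ := by positivity
  have hb := density_nonneg β
  generalize (Lc β : ℝ)⁻¹ = a at *
  generalize density β = b at *
  have h1 : 1 - 2 * a ≠ 0 := by norm_num at ha; linarith
  have h2 : 1 + 20 * b ≠ 0 := by positivity
  have h3 : 1 + 6 * a ≠ 0 := by positivity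
  rw [inv_sub_inv (pow_ne_zero 2 h1) (mul_ne_zero h2 h3), div_eq_mul_inv, ← mul_inv]
  ring

lemma tendsto_corr_ratio (δ : ℝ) : Tendsto (fun β : ℝ =>
    Real.exp ((pairRate (Lc β) β - 2 * rate (Lc β) β) * ((1 - δ) * cutTime β))) atTop (𝓝 1) := by
  have h := (Real.continuous_exp.tendsto _).comp (tendsto_rate_gap.const_mul ((1 - δ) / 2))
  rw [mul_zero, Real.exp_zero] at h
  refine h.congr' ?_
  filter_upwards [tendsto_Lc.eventually_ge_atTop 3] with β hL
  have hL' : 0 < Lc β := by exact_mod_cast (show (0 : ℝ) < Lc β by linarith)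
  rw [Function.comp_apply]
  congr 1
  have h1 := pairRate_mul_cutTime hL'
  have h2 := rate_mul_cutTime hL'
  linear_combination (-(1 - δ)) * h1 + 2 * (1 - δ) * h2

lemma eventually_le_pairCorr {δ : ℝ} (hδ : 0 < δ) (hδ1 : δ < 1) : ∀ᶠ β : ℝ in atTop,
    Real.exp (-(β / 2)) * Real.exp (δ / 4 * β) ≤ pairCorr δ β := by
  have h1 : ∀ᶠ β : ℝ in atTop, ((1 - 2 * (Lc β : ℝ)⁻¹) ^ 2)⁻¹ ≤ (1 - δ / 2) / (1 - δ) :=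
    tendsto_pairRate_factor.eventually_le_const (by rw [lt_div_iff₀ (by linarith)]; linarith)
  filter_upwards [h1, tendsto_Lc.eventually_ge_atTop 3, eventually_ge_atTop 0] with β h1 hL hβ
  have hL' : 0 < Lc β := by exact_mod_cast (show (0 : ℝ) < Lc β by linarith)
  rw [le_div_iff₀ (by linarith)] at h1
  have h2 := pairRate_mul_cutTime hL'
  rw [← Real.exp_add, pairCorr, Real.exp_le_exp]
  have h3 : (1 - δ) * (pairRate (Lc β) β * cutTime β) ≤ β / 2 * (1 - δ / 2) := by
    rw [h2]
    nlinarith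
  linarith

lemma tendsto_inv_mul_pairCorr {δ : ℝ} (hδ : 0 < δ) (hδ1 : δ < 1) : Tendsto (fun β : ℝ =>
    (((Lc β / 2 : ℕ) : ℝ) * pairCorr δ β)⁻¹) atTop (𝓝 0) := by
  have h := (tendsto_exp_neg (show 0 < δ / 4 by positivity)).const_mul 8
  rw [mul_zero] at h
  refine squeeze_zero' ?_ ?_ h
  · refine Eventually.of_forall fun β => ?_
    unfold pairCorr
    positivity
  · filter_upwards [eventually_le_pairCorr hδ hδ1, eventually_ge_atTop 2,
      tendsto_Lc.eventually_ge_atTop 2] with β h1 hβ hL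
    have h2 := half_exp_le_Lc hβ
    have h3 : (Lc β : ℝ) / 4 ≤ ((Lc β / 2 : ℕ) : ℝ) := by
      have : Lc β ≤ 2 * (Lc β / 2) + 1 := by omega
      have : (Lc β : ℝ) ≤ 2 * ((Lc β / 2 : ℕ) : ℝ) + 1 := by exact_mod_cast this
      linarith
    have h4 : Real.exp (δ / 4 * β) / 8 ≤ ((Lc β / 2 : ℕ) : ℝ) * pairCorr δ β := by
      calc Real.exp (δ / 4 * β) / 8
          = Real.exp (β / 2) / 8 * (Real.exp (-(β / 2)) * Real.exp (δ / 4 * β)) := by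
            have hc : Real.exp (β / 2) * Real.exp (-(β / 2)) = 1 := by
              rw [← Real.exp_add, add_neg_cancel, Real.exp_zero]
            linear_combination (-(Real.exp (δ / 4 * β)) / 8) * hc
        _ ≤ _ := mul_le_mul (by linarith) h1 (by positivity) (by positivity)
    refine (inv_anti₀ (by positivity) h4).trans (le_of_eq ?_)
    rw [Real.exp_neg, inv_div, div_eq_mul_inv]

lemma tendsto_corr_error {δ : ℝ} (hδ : 0 < δ) (hδ1 : δ < 1) : Tendsto (fun β : ℝ =>
    1 - 6 * (density β / pairCorr δ β)) atTop (𝓝 1) := by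
  have h : Tendsto (fun β : ℝ => density β / pairCorr δ β) atTop (𝓝 0) := by
    refine squeeze_zero' ?_ ?_ (tendsto_exp_neg (c := 2) two_pos)
    · exact Eventually.of_forall fun β => div_nonneg (density_nonneg β) (Real.exp_pos _).le
    · filter_upwards [eventually_le_pairCorr hδ hδ1, eventually_ge_atTop 0] with β h1 hβ
      rw [div_le_iff₀ (show 0 < pairCorr δ β from Real.exp_pos _)]
      refine (density_le β).trans (le_trans ?_ (mul_le_mul_of_nonneg_left h1 (Real.exp_pos _).le))
      rw [← Real.exp_add, ← Real.exp_add, Real.exp_le_exp]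
      nlinarith
  simpa using (h.const_mul 6).const_sub 1

lemma moment_identity {h M g w r : ℝ} (hh : h ≠ 0) (hM : M ≠ 0) (hr : r ≠ 0) :
    1 - 4 * ((h ^ 4 * (g ^ 2 * M ^ 2 * w) + 2 * h ^ 3 * (g * M * w) + h ^ 2) / h ^ 4 / (r * M) ^ 2 - 1)
      - h ^ 2 / (h ^ 2 * (r * M) / 2) ^ 2
    = 1 - 4 * (g ^ 2 * w / r ^ 2 + 2 * (h * M)⁻¹ * g * w / r ^ 2 + (h * M)⁻¹ ^ 2 / r ^ 2 - 1)
      - 4 * ((h * M)⁻¹ ^ 2 / r ^ 2) := by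
  field_simp
  ring

theorem eventually_not_mixed {ε δ : ℝ} (hε : 0 < ε) (hδ : 0 < δ) (hδ1 : δ < 1) :
    ∀ᶠ β : ℝ in atTop, ∃ _ : NeZero (Lc β), 1 - ε <
      tv (NormedSpace.exp (((1 - δ) * cutTime β) • (spm (Lc β) β).gen) 0) (gibbs (Lc β) β) := by
  have hu := tendsto_inv_mul_pairCorr hδ hδ1
  have hg := tendsto_corr_ratio δ
  have hr := tendsto_corr_error hδ hδ1
  have hw : Tendsto (fun β : ℝ => √(1 + 2 * density β)) atTop (𝓝 1) := by
    simpa using ((tendsto_density.const_mul 2).const_add 1).sqrt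
  have hr2 : Tendsto (fun β : ℝ => (1 - 6 * (density β / pairCorr δ β)) ^ 2) atTop (𝓝 1) := by
    simpa using hr.pow 2
  have hlim := ((((((hg.pow 2).mul hw).div hr2 one_ne_zero).add
    ((((hu.const_mul 2).mul hg).mul hw).div hr2 one_ne_zero)).add
    ((hu.pow 2).div hr2 one_ne_zero)).sub_const 1).const_mul 4 |>.const_sub 1 |>.sub
    (((hu.pow 2).div hr2 one_ne_zero).const_mul 4) |>.sub
    (tendsto_stripErr_mul_cutTime.const_mul (1 - δ))
  have hlt := hlim.eventually_const_lt (u := 1 - ε) (by norm_num; exact hε)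
  filter_upwards [hlt, tendsto_Lc.eventually_ge_atTop 3, eventually_ge_atTop 1,
    hr.eventually_const_lt (show (0 : ℝ) < 1 by norm_num)] with β hlt hL hβ hr0
  simp only [Pi.div_apply] at hlt
  have hL' : 3 ≤ Lc β := by exact_mod_cast hL
  have : NeZero (Lc β) := ⟨by omega⟩
  refine ⟨this, hlt.trans_le ?_⟩
  have ht : 0 ≤ (1 - δ) * cutTime β := mul_nonneg (by linarith) (cutTime_pos (by linarith)).le
  have hM : 0 < pairCorr δ β := Real.exp_pos _
  have hh : 1 ≤ Lc β / 2 := by omega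
  have hh' : (0 : ℝ) < ((Lc β / 2 : ℕ) : ℝ) := by exact_mod_cast hh
  set g := Real.exp ((pairRate (Lc β) β - 2 * rate (Lc β) β) * ((1 - δ) * cutTime β)) with hgdef
  have hb : 2 * (Lc β : ℝ) ^ 3 * Real.exp (-(4 * β)) = 2 * density β := by unfold density; ring
  have hgM : Real.exp (-(2 * rate (Lc β) β * ((1 - δ) * cutTime β))) = g * pairCorr δ β := by
    rw [hgdef, pairCorr, ← Real.exp_add]
    congr 1
    ring
  have hgM2 : Real.exp (-(4 * rate (Lc β) β * ((1 - δ) * cutTime β))) = g ^ 2 * pairCorr δ β ^ 2 := by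
    rw [← mul_pow, ← hgM, ← Real.exp_nat_mul]
    congr 1
    push_cast
    ring
  have key := le_tv_ground hL' (by linarith : (0 : ℝ) ≤ β) ht hh (by omega)
    (m := (1 - 6 * (density β / pairCorr δ β)) * pairCorr δ β)
    (E2 := g * pairCorr δ β * √(1 + 2 * density β))
    (E4 := g ^ 2 * pairCorr δ β ^ 2 * √(1 + 2 * density β)) (mul_pos hr0 hM)
    (le_of_eq (by
      change _ = pairCorr δ β - _
      rw [sub_mul, mul_assoc, div_mul_cancel₀ _ hM.ne']
      unfold density
      ring))
    (le_of_eq (by rw [hb, hgM])) (le_of_eq (by rw [hb, hgM2]))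
  rw [moment_identity hh'.ne' hM.ne' hr0.ne'] at key
  linarith

end LowerAsymptotics

section Cutoff

open Filter Topology

theorem eventually_ratio_mem {ε δ : ℝ} (hε0 : 0 < ε) (hε : ε < 1 / 2) (hδ : 0 < δ) (hδ1 : δ < 1) :
    ∀ᶠ β : ℝ in atTop, 1 ≤ tmixP (Lc β) β ε / tmixP (Lc β) β (1 - ε) ∧
      tmixP (Lc β) β ε / tmixP (Lc β) β (1 - ε) ≤ (1 + 2 * δ) / (1 - δ) := by
  filter_upwards [eventually_mixed hε0 hδ, eventually_not_mixed hε0 hδ hδ1,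
    eventually_ge_atTop 1] with β ⟨_, hmix⟩ ⟨_, hnot⟩ hβ
  have hT := cutTime_pos (show 0 < β by linarith)
  rw [tmixP_eq (by linarith), tmixP_eq (by linarith)]
  set S : ℝ → Set ℝ := fun ε => {t : ℝ | 0 < t ∧
    ∀ σ : Cfg (Lc β), tv (NormedSpace.exp (t • (spm (Lc β) β).gen) σ) (gibbs (Lc β) β) < ε} with hS
  have hbdd : ∀ ε, BddBelow (S ε) := fun ε => ⟨0, fun t ht => ht.1.le⟩
  have hmem : (1 + 2 * δ) * cutTime β ∈ S ε := ⟨by positivity, hmix⟩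
  have hsub : S ε ⊆ S (1 - ε) := fun t ht => ⟨ht.1, fun σ => (ht.2 σ).trans (by linarith)⟩
  have h1 : sInf (S (1 - ε)) ≤ sInf (S ε) := csInf_le_csInf (hbdd _) ⟨_, hmem⟩ hsub
  have h2 : sInf (S ε) ≤ (1 + 2 * δ) * cutTime β := csInf_le (hbdd _) hmem
  have h3 : (1 - δ) * cutTime β ≤ sInf (S (1 - ε)) := by
    refine le_csInf ⟨_, hsub hmem⟩ fun t ht => ?_
    by_contra hlt
    have := tv_antitone (spm (Lc β) β).isGen (not_le.1 hlt).le (fun σ => (ht.2 σ).le) 0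
    linarith
  have h4 : 0 < (1 - δ) * cutTime β := mul_pos (by linarith) hT
  have h5 := h4.trans_le h3
  change 1 ≤ sInf (S ε) / sInf (S (1 - ε)) ∧ sInf (S ε) / sInf (S (1 - ε)) ≤ _
  refine ⟨(one_le_div h5).2 h1, ?_⟩
  exact (div_le_div₀ (by positivity) h2 h4 h3).trans (le_of_eq (mul_div_mul_right _ _ hT.ne'))

end Cutoff

/-- Theorem `ThmMainResPer`, cutoff: the square plaquette model with
periodic boundary conditions on the critical length scale exhibits cutoff: for each
`0 < ε < 1/2`, `T_mix(L_c, ε)/T_mix(L_c, 1-ε) → 1` as `β → ∞`. -/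
theorem spm_periodic_cutoff (ε : ℝ) (hε0 : 0 < ε) (hε : ε < 1 / 2) :
    Filter.Tendsto (fun β : ℝ => tmixP (Lc β) β ε / tmixP (Lc β) β (1 - ε))
      Filter.atTop (nhds 1) := by
  rw [tendsto_order]
  refine ⟨fun a ha => ?_, fun a ha => ?_⟩
  · filter_upwards [eventually_ratio_mem hε0 hε (δ := 1 / 2) (by norm_num) (by norm_num)] with β h
    exact ha.trans_le h.1
  · have hd : 0 < (a - 1) / (2 * (a + 2)) := div_pos (by linarith) (by linarith)
    have hd1 : (a - 1) / (2 * (a + 2)) < 1 := by rw [div_lt_one (by linarith)]; linarith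
    filter_upwards [eventually_ratio_mem hε0 hε hd hd1] with β h
    refine h.2.trans_lt ?_
    rw [div_lt_iff₀ (by linarith)]
    have e : (a - 1) / (2 * (a + 2)) * (a + 2) = (a - 1) / 2 := by field_simp
    linarith

end
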